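/- Let d ≥ 2, δ ∈ (0,1], and C₀ > 0. Suppose K : ℝ^d × ℝ^d → ℂ satisfies |K(x,y)| ≤ C₀|x−y|^{−d} for x ≠ y, together with the δ-regularity conditions: |K(x₁,y) − K(x₂,y)| ≤ C₀|x₁−x₂|^δ/|x₁−y|^{d+δ} whenever |x₁−y| > 2|x₁−x₂|, and |K(x,y₁) − K(x,y₂)| ≤ C₀|y₁−y₂|^δ/|x−y₁|^{d+δ} whenever |x−y₁| > 2|y₁−y₂|. Let Ω : ℝ^d \ {0} → ℝ be homogeneous of degree zero with ‖Ω‖_{L log⁺L(S^{d−1})} < ∞. Assume that for every f ∈ C_c^∞(ℝ^d) the principal value T_Ω f(x) = lim_{ε→0} ∫_{|x−y|>ε} Ω(x−y) K(x,y) f(y) dy exists for almost every x and that ‖T_Ω f‖_{L²(ℝ^d)} ≤ A ‖Ω‖_{L log⁺L} ‖f‖_{L²(ℝ^d)} for some A > 0. Then there is a constant C, depending only on d, δ, C₀ and A, such that for every λ > 0 and every f ∈ C_c^∞(ℝ^d), λ · m({x ∈ ℝ^d : |T_Ω f(x)| > λ}) ≤ C · 𝒞_Ω · ‖f‖_{L¹(ℝ^d)}.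 -/

import Mathlib

open MeasureTheory Metric Filter Topology

noncomputable section

/-- The surface measure on the unit sphere `S^{d-1}` of `ℝ^d`. -/
def sphereMeasure (d : ℕ) :
    Measure (sphere (0 : EuclideanSpace ℝ (Fin d)) 1) :=
  (volume : Measure (EuclideanSpace ℝ (Fin d))).toSphere

/-- `‖Ω‖_{L¹(S^{d-1})}`. -/
def sphL1 (d : ℕ) (Ω : EuclideanSpace ℝ (Fin d) → ℝ) : ℝ :=
  ∫ θ : sphere (0 : EuclideanSpace ℝ (Fin d)) 1, |Ω θ| ∂(sphereMeasure d)

/-- `‖Ω‖_{L log⁺ L(S^{d-1})} = ∫ |Ω| log(2+|Ω|)`. -/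
def sphLlogL (d : ℕ) (Ω : EuclideanSpace ℝ (Fin d) → ℝ) : ℝ :=
  ∫ θ : sphere (0 : EuclideanSpace ℝ (Fin d)) 1,
    |Ω θ| * Real.log (2 + |Ω θ|) ∂(sphereMeasure d)

/-- The constant `𝒞_Ω`. -/
def COmega (d : ℕ) (Ω : EuclideanSpace ℝ (Fin d) → ℝ) : ℝ :=
  sphLlogL d Ω +
    ∫ θ : sphere (0 : EuclideanSpace ℝ (Fin d)) 1,
      |Ω θ| * (1 + max (Real.log (|Ω θ| / sphL1 d Ω)) 0) ∂(sphereMeasure d)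

set_option linter.unusedSectionVars false

section Geometry
variable {E : Type*} [NormedAddCommGroup E] [InnerProductSpace ℝ E] [FiniteDimensional ℝ E]
  [MeasurableSpace E] [BorelSpace E]

/-- A measure which is small on balls of radius `2 * h * R` is small on tubes of width `h * R`. -/
theorem measure_tube_le (μ : Measure E) (e : E) (he : ‖e‖ = 1) {h R A : ℝ} (hh : 0 < h)
    (hh1 : h ≤ 1) (hR : 0 < R) (hA : 0 ≤ A) (c : ENNReal) (x₀ : E)
    (hc : ∀ x, μ (closedBall x (2 * h * R)) ≤ c) :
    μ {x | ∃ a : ℝ, |a| ≤ A * R ∧ ‖x - x₀ - a • e‖ ≤ h * R} ≤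
      ENNReal.ofReal ((2 * A + 3) / h) * c := by
  set n : ℤ := ⌈A / h⌉ with hn
  have hn0 : 0 ≤ n := Int.ceil_nonneg (by positivity)
  have hsub : {x | ∃ a : ℝ, |a| ≤ A * R ∧ ‖x - x₀ - a • e‖ ≤ h * R} ⊆
      ⋃ k ∈ Finset.Icc (-n) n, closedBall (x₀ + ((k : ℝ) * h * R) • e) (2 * h * R) := by
    rintro x ⟨a, ha, hx⟩
    have hhR : 0 < h * R := by positivity
    set k : ℤ := round (a / (h * R)) with hk
    have h1 : |a - k * (h * R)| ≤ h * R := by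
      have := abs_sub_round (a / (h * R))
      rw [← hk] at this
      have h2 : a - k * (h * R) = (a / (h * R) - k) * (h * R) := by field_simp
      rw [h2, abs_mul, abs_of_pos hhR]
      nlinarith
    have habs : |a / (h * R)| ≤ A / h := by
      rw [abs_div, abs_of_pos hhR, div_le_div_iff₀ hhR hh]
      nlinarith
    have hle : |a / (h * R)| ≤ (n : ℝ) := habs.trans (Int.le_ceil _)
    simp only [Set.mem_iUnion, Finset.mem_Icc]
    refine ⟨k, ⟨?_, ?_⟩, ?_⟩
    · rw [hk, round_eq, Int.le_floor]
      push_cast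
      linarith [(abs_le.1 hle).1]
    · have : k < n + 1 := by
        rw [hk, round_eq, Int.floor_lt]
        push_cast
        linarith [(abs_le.1 hle).2]
      omega
    · rw [mem_closedBall, dist_eq_norm]
      have : x - (x₀ + ((k : ℝ) * h * R) • e) = (x - x₀ - a • e) + (a - k * (h * R)) • e := by
        module
      rw [this]
      refine (norm_add_le _ _).trans ?_
      rw [norm_smul, he, mul_one, Real.norm_eq_abs]
      linarith
  refine (measure_mono hsub).trans ((measure_biUnion_finset_le _ _).trans ?_)
  refine (Finset.sum_le_sum fun k _ => hc _).trans ?_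
  rw [Finset.sum_const, nsmul_eq_mul]
  gcongr
  rw [← ENNReal.ofReal_natCast]
  apply ENNReal.ofReal_le_ofReal
  have hcard : ((Finset.Icc (-n) n).card : ℝ) = 2 * n + 1 := by
    rw [Int.card_Icc]
    have : ((n + 1 - -n).toNat : ℤ) = n + 1 - -n := Int.toNat_of_nonneg (by omega)
    have h3 : (((n + 1 - -n).toNat : ℤ) : ℝ) = ((n + 1 - -n : ℤ) : ℝ) := by rw [this]
    push_cast at h3
    rw [h3]; ring
  rw [hcard]
  have := Int.ceil_lt_add_one (A / h)
  rw [← hn] at this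
  rw [le_div_iff₀ hh]
  have h4 : A / h * h = A := by field_simp
  nlinarith

theorem card_mul_pow_le_of_separated [Nontrivial E] {ι : Type*} (S : Finset ι) (p : ι → E)
    {r R : ℝ} (hr : 0 < r) (hR0 : 0 < R) (hsep : ∀ i ∈ S, ∀ j ∈ S, i ≠ j → 2 * r ≤ dist (p i) (p j))
    (hR : ∀ i ∈ S, ‖p i‖ + r ≤ R) :
    (S.card : ℝ) * r ^ Module.finrank ℝ E ≤ R ^ Module.finrank ℝ E := by
  have hd : (↑S : Set ι).PairwiseDisjoint fun i => ball (p i) r := by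
    intro i hi j hj hij
    exact ball_disjoint_ball (by linarith [hsep i hi j hj hij])
  have h1 := measure_biUnion_finset (μ := (volume : Measure E)) hd
    (fun i _ => measurableSet_ball)
  have h2 : (⋃ i ∈ S, ball (p i) r) ⊆ ball (0 : E) R := by
    refine Set.iUnion₂_subset fun i hi => ball_subset_ball' ?_
    rw [dist_zero_right]; linarith [hR i hi]
  have h3 := measure_mono (μ := (volume : Measure E)) h2
  rw [h1] at h3
  simp only [Measure.addHaar_ball_of_pos _ _ hr, Measure.addHaar_ball_of_pos _ _ hR0,
    Finset.sum_const, nsmul_eq_mul] at h3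
  rw [← mul_assoc] at h3
  have hv : volume (ball (0 : E) 1) ≠ 0 := (measure_ball_pos _ _ one_pos).ne'
  have hv' : volume (ball (0 : E) 1) ≠ ⊤ := measure_ball_lt_top.ne
  have h4 := (ENNReal.mul_le_mul_iff_left hv hv').1 h3
  rw [← ENNReal.ofReal_natCast, ← ENNReal.ofReal_mul (by positivity)] at h4
  exact (ENNReal.ofReal_le_ofReal_iff (by positivity)).1 h4


theorem exists_sphere_net [Nontrivial E] {h : ℝ} (hh : 0 < h) :
    ∃ V : Finset E, (∀ v ∈ V, ‖v‖ = 1) ∧ (∀ v ∈ V, ∀ w ∈ V, v ≠ w → h ≤ dist v w) ∧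
      ∀ θ : E, ‖θ‖ = 1 → ∃ v ∈ V, dist θ v < h := by
  classical
  let P : Finset E → Prop := fun V => (∀ v ∈ V, ‖v‖ = 1) ∧ ∀ v ∈ V, ∀ w ∈ V, v ≠ w → h ≤ dist v w
  let N : Set ℕ := {n | ∃ V : Finset E, P V ∧ V.card = n}
  have hne : N.Nonempty := ⟨0, ∅, by simp [P], rfl⟩
  have hb : BddAbove N := by
    refine ⟨⌈(1 + h / 2) ^ Module.finrank ℝ E / (h / 2) ^ Module.finrank ℝ E⌉₊, ?_⟩
    rintro n ⟨V, hV, rfl⟩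
    have := card_mul_pow_le_of_separated V (fun v => v) (r := h / 2) (R := 1 + h / 2)
      (by positivity) (by positivity) (fun v hv w hw hvw => by linarith [hV.2 v hv w hw hvw])
      (fun v hv => by rw [hV.1 v hv])
    have h2 : (V.card : ℝ) ≤ (1 + h / 2) ^ Module.finrank ℝ E / (h / 2) ^ Module.finrank ℝ E := by
      rwa [le_div_iff₀ (by positivity)]
    exact_mod_cast h2.trans (Nat.le_ceil _)
  obtain ⟨V, hV, hVc⟩ := Nat.sSup_mem hne hb
  refine ⟨V, hV.1, hV.2, fun θ hθ => ?_⟩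
  by_contra! hcon
  have hnot : θ ∉ V := fun hm => by have := hcon θ hm; simp at this; linarith
  have hmem : (insert θ V).card ∈ N := by
    refine ⟨insert θ V, ⟨?_, ?_⟩, rfl⟩
    · intro v hv
      rcases Finset.mem_insert.1 hv with rfl | hv
      · exact hθ
      · exact hV.1 v hv
    · intro v hv w hw hvw
      rcases Finset.mem_insert.1 hv with hv' | hv' <;> rcases Finset.mem_insert.1 hw with hw' | hw'
      · exact absurd (hv'.trans hw'.symm) hvw
      · rw [hv']; exact hcon w hw'
      · rw [hw', dist_comm]; exact hcon v hv'
      · exact hV.2 v hv' w hw' hvw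
  have := le_csSup hb hmem
  rw [Finset.card_insert_of_notMem hnot, ← hVc] at this
  omega

/-- Few elements of a separated subset of the sphere are nearly orthogonal to a given direction. -/
theorem card_nearly_orthogonal_le [Nontrivial E] {h ρ : ℝ} (hh : 0 < h) (hhρ : h ≤ ρ) (hρ : ρ ≤ 1)
    (V : Finset E) (hV : ∀ v ∈ V, ‖v‖ = 1)
    (hsep : ∀ v ∈ V, ∀ w ∈ V, v ≠ w → h / 2 ≤ dist v w)
    (u : E) (hu : ‖u‖ = 1) (hVu : ∀ v ∈ V, |inner ℝ v u| ≤ ρ) :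
    (V.card : ℝ) * h ^ Module.finrank ℝ E ≤ 52 ^ Module.finrank ℝ E * (ρ * h) := by
  have hρ0 : 0 < ρ := hh.trans_le hhρ
  set n := ⌈1 / h⌉₊
  set m := ⌈1 / ρ⌉₊
  let p : E × ℕ × ℕ → E := fun x => (1 + x.2.1 * h) • x.1 + (10 * ρ * x.2.2) • u
  let S : Finset (E × ℕ × ℕ) := V ×ˢ (Finset.range n ×ˢ Finset.range m)
  have hk : ∀ k ∈ Finset.range n, (k : ℝ) * h ≤ 1 := fun k hk => by
    have := Nat.lt_ceil.1 (Finset.mem_range.1 hk)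
    rw [lt_div_iff₀ hh] at this; exact this.le
  have hl : ∀ l ∈ Finset.range m, (l : ℝ) * ρ ≤ 1 := fun k hk => by
    have := Nat.lt_ceil.1 (Finset.mem_range.1 hk)
    rw [lt_div_iff₀ hρ0] at this; exact this.le
  have key := card_mul_pow_le_of_separated S p (r := h / 4) (R := 13) (by positivity)
    (by norm_num) ?_ ?_
  · have hc : (S.card : ℝ) = V.card * (n * m) := by
      simp [S, Finset.card_product]
    rw [hc] at key
    have h1 : 1 / h ≤ n := Nat.le_ceil _
    have h2 : 1 / ρ ≤ m := Nat.le_ceil _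
    have h3 : (V.card : ℝ) * (1 / h * (1 / ρ)) * (h / 4) ^ Module.finrank ℝ E ≤
        13 ^ Module.finrank ℝ E := le_trans (by gcongr) key
    have h4 : (52 : ℝ) ^ Module.finrank ℝ E =
      13 ^ Module.finrank ℝ E * 4 ^ Module.finrank ℝ E := by rw [← mul_pow]; norm_num
    rw [h4]
    rw [div_pow] at h3
    calc (V.card : ℝ) * h ^ Module.finrank ℝ E
        = (V.card : ℝ) * (1 / h * (1 / ρ)) * (h ^ Module.finrank ℝ E / 4 ^ Module.finrank ℝ E) *
          (4 ^ Module.finrank ℝ E * (ρ * h)) := by field_simp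
      _ ≤ 13 ^ Module.finrank ℝ E * (4 ^ Module.finrank ℝ E * (ρ * h)) := by gcongr
      _ = _ := by ring
  · rintro ⟨v, k, l⟩ hi ⟨w, k', l'⟩ hj hij
    simp only [S, Finset.mem_product] at hi hj
    obtain ⟨hv, hkm, hlm⟩ := hi
    obtain ⟨hw, hkm', hlm'⟩ := hj
    have hk1 := hk k hkm
    have hk2 := hk k' hkm'
    have hk3 : 0 ≤ (k : ℝ) * h := by positivity
    have hk4 : 0 ≤ (k' : ℝ) * h := by positivity
    rw [dist_eq_norm]
    by_cases hll : l = l'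
    · subst hll
      have e1 : p (v, k, l) - p (w, k', l) = (1 + k * h) • v - (1 + k' * h) • w := by
        simp only [p]; module
      rw [e1]
      by_cases hkk : k = k'
      · subst hkk
        have hvw : v ≠ w := fun hh => hij (by rw [hh])
        rw [← smul_sub, norm_smul, ← dist_eq_norm, Real.norm_eq_abs, abs_of_pos (by positivity)]
        have := hsep v hv w hw hvw
        nlinarith
      · have h1 : |(1 + k * h) - (1 + k' * h)| ≤ ‖(1 + k * h) • v - (1 + k' * h) • w‖ := by
          have := abs_norm_sub_norm_le ((1 + k * h) • v) ((1 + k' * h) • w)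
          rwa [norm_smul (1 + k * h), norm_smul (1 + k' * h) w, hV v hv, hV w hw, mul_one, mul_one,
            Real.norm_of_nonneg (by positivity), Real.norm_of_nonneg (by positivity)] at this
        have h2 : (1 : ℝ) ≤ |(k : ℝ) - k'| := by
          have : (1 : ℤ) ≤ |(k : ℤ) - k'| := Int.one_le_abs (by omega)
          exact_mod_cast this
        have h3 : (1 + k * h) - (1 + k' * h) = ((k : ℝ) - k') * h := by ring
        rw [h3, abs_mul, abs_of_pos hh] at h1
        nlinarith
    · have h2 : (1 : ℝ) ≤ |(l : ℝ) - l'| := by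
        have : (1 : ℤ) ≤ |(l : ℤ) - l'| := Int.one_le_abs (by omega)
        exact_mod_cast this
      have h1 : |inner ℝ (p (v, k, l) - p (w, k', l')) u| ≤ ‖p (v, k, l) - p (w, k', l')‖ := by
        refine (abs_real_inner_le_norm _ _).trans (by rw [hu, mul_one])
      have h3 : (inner ℝ (p (v, k, l) - p (w, k', l')) u : ℝ) =
          (1 + k * h) * inner ℝ v u - (1 + k' * h) * inner ℝ w u + 10 * ρ * (l - l') := by
        simp only [p, inner_sub_left, inner_add_left, real_inner_smul_left,
          real_inner_self_eq_norm_sq, hu]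
        ring
      have h4 : |(1 + k * h) * inner ℝ v u| ≤ 2 * ρ := by
        rw [abs_mul, abs_of_pos (by positivity)]
        exact mul_le_mul (by linarith) (hVu v hv) (abs_nonneg _) (by norm_num)
      have h5 : |(1 + k' * h) * inner ℝ w u| ≤ 2 * ρ := by
        rw [abs_mul, abs_of_pos (by positivity)]
        exact mul_le_mul (by linarith) (hVu w hw) (abs_nonneg _) (by norm_num)
      have h6 : 10 * ρ ≤ |10 * ρ * ((l : ℝ) - l')| := by
        rw [abs_mul, abs_of_pos (by positivity : 0 < 10 * ρ)]
        nlinarith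
      rw [h3] at h1
      have h7 := abs_sub_abs_le_abs_sub (10 * ρ * ((l : ℝ) - l'))
        (-((1 + k * h) * inner ℝ v u - (1 + k' * h) * inner ℝ w u))
      rw [abs_neg, sub_neg_eq_add, add_comm (10 * ρ * ((l : ℝ) - l'))] at h7
      have h8 := abs_sub ((1 + k * h) * inner ℝ v u) ((1 + k' * h) * inner ℝ w u)
      linarith
  · rintro ⟨v, k, l⟩ hi
    simp only [S, Finset.mem_product] at hi
    obtain ⟨hv, hkm, hlm⟩ := hi
    have hk1 := hk k hkm
    have hl1 := hl l hlm
    have h1 : ‖p (v, k, l)‖ ≤ (1 + k * h) * 1 + 10 * ρ * l * 1 := by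
      refine (norm_add_le _ _).trans ?_
      rw [norm_smul, norm_smul, hV v hv, hu, Real.norm_eq_abs, Real.norm_eq_abs,
        abs_of_nonneg (by positivity), abs_of_nonneg (by positivity)]
    nlinarith

end Geometry

section Polar
variable {E : Type*} [NormedAddCommGroup E] [InnerProductSpace ℝ E] [FiniteDimensional ℝ E]
  [MeasurableSpace E] [BorelSpace E] [Nontrivial E]

theorem norm_smul_normalize_sphere (x : ({0}ᶜ : Set E)) :
    ((homeomorphUnitSphereProd E x).2 : ℝ) • ((homeomorphUnitSphereProd E x).1 : E) = x := by
  have hx : ‖(x : E)‖ ≠ 0 := norm_ne_zero_iff.2 x.2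
  simp [smul_smul, hx]

theorem lintegral_polar {F : E → ENNReal} (hF : Measurable F) :
    ∫⁻ x, F x = ∫⁻ θ : sphere (0 : E) 1, (∫⁻ r in Set.Ioi (0 : ℝ),
      ENNReal.ofReal (r ^ (Module.finrank ℝ E - 1)) * F (r • (θ : E)))
        ∂(volume : Measure E).toSphere := by
  let g : sphere (0 : E) 1 × Set.Ioi (0 : ℝ) → ENNReal := fun p => F ((p.2 : ℝ) • (p.1 : E))
  have hg : Measurable g := hF.comp (by fun_prop)
  calc ∫⁻ x, F x = ∫⁻ x : ({0}ᶜ : Set E), F x ∂((volume : Measure E).comap Subtype.val) := by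
        rw [lintegral_subtype_comap (measurableSet_singleton _).compl, restrict_compl_singleton]
    _ = ∫⁻ x : ({0}ᶜ : Set E), g (homeomorphUnitSphereProd E x) ∂((volume : Measure E).comap Subtype.val) := by
        congr 1; ext x; simp only [g, norm_smul_normalize_sphere]
    _ = ∫⁻ p, g p ∂((volume : Measure E).toSphere.prod
          (Measure.volumeIoiPow (Module.finrank ℝ E - 1))) :=
        (volume : Measure E).measurePreserving_homeomorphUnitSphereProd.lintegral_comp hg
    _ = _ := by
        rw [lintegral_prod _ hg.aemeasurable]
        congr 1; ext θ
        rw [Measure.volumeIoiPow, lintegral_withDensity_eq_lintegral_mul _ (by fun_prop)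
          (by fun_prop)]
        simp only [Pi.mul_apply]
        exact lintegral_subtype_comap measurableSet_Ioi
          (fun r : ℝ => ENNReal.ofReal (r ^ (Module.finrank ℝ E - 1)) * F (r • (θ : E)))

theorem integral_polar {F : E → ℂ} (hF : Integrable F) :
    ∫ x, F x = ∫ θ : sphere (0 : E) 1, (∫ r in Set.Ioi (0 : ℝ),
      (r ^ (Module.finrank ℝ E - 1)) • F (r • (θ : E))) ∂(volume : Measure E).toSphere := by
  let g : sphere (0 : E) 1 × Set.Ioi (0 : ℝ) → ℂ := fun p => F ((p.2 : ℝ) • (p.1 : E))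
  have hgF : (fun x : ({0}ᶜ : Set E) => F x) = g ∘ homeomorphUnitSphereProd E := by
    ext x; simp only [g, Function.comp, norm_smul_normalize_sphere]
  have hgi : Integrable g ((volume : Measure E).toSphere.prod
          (Measure.volumeIoiPow (Module.finrank ℝ E - 1))) := by
    rw [← (volume : Measure E).measurePreserving_homeomorphUnitSphereProd.integrable_comp_emb
      (Homeomorph.measurableEmbedding _), ← hgF]
    rw [← Function.comp_def F, ← integrableOn_iff_comap_subtypeVal
      (measurableSet_singleton _).compl]
    exact hF.integrableOn
  calc ∫ x, F x = ∫ x : ({0}ᶜ : Set E), F x ∂((volume : Measure E).comap Subtype.val) := by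
        rw [integral_subtype_comap (measurableSet_singleton _).compl, restrict_compl_singleton]
    _ = ∫ x : ({0}ᶜ : Set E), g (homeomorphUnitSphereProd E x) ∂((volume : Measure E).comap Subtype.val) := by
        rw [hgF]; rfl
    _ = ∫ p, g p ∂((volume : Measure E).toSphere.prod
          (Measure.volumeIoiPow (Module.finrank ℝ E - 1))) :=
        (volume : Measure E).measurePreserving_homeomorphUnitSphereProd.integral_comp
          (Homeomorph.measurableEmbedding _) g
    _ = _ := by
        rw [integral_prod _ hgi]
        congr 1; ext θ
        simp only [Measure.volumeIoiPow, ENNReal.ofReal]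
        rw [integral_withDensity_eq_integral_smul (by fun_prop),
          integral_subtype_comap measurableSet_Ioi fun r : ℝ =>
            Real.toNNReal (r ^ (Module.finrank ℝ E - 1)) • F (r • (θ : E))]
        refine setIntegral_congr_fun measurableSet_Ioi fun r hr => ?_
        simp only [NNReal.smul_def, Real.coe_toNNReal _ (pow_nonneg (le_of_lt hr) _)]

end Polar

section Bump
open FourierTransform Real

theorem norm_fourier_le_integral {V : Type*} [NormedAddCommGroup V] [InnerProductSpace ℝ V]
    [FiniteDimensional ℝ V] [MeasurableSpace V] [BorelSpace V] (f : V → ℂ) (w : V) :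
    ‖𝓕 f w‖ ≤ ∫ x, ‖f x‖ :=
  VectorFourier.norm_fourierIntegral_le_integral_norm _ _ _ _ _

/-- A smooth bump on `[0, 2]` whose integer translates sum to one. -/
def stepBump (x : ℝ) : ℝ := smoothTransition x - smoothTransition (x - 1)

theorem stepBump_contDiff {n : ℕ∞} : ContDiff ℝ n stepBump :=
  smoothTransition.contDiff.sub (smoothTransition.contDiff.comp (contDiff_id.sub contDiff_const))

theorem stepBump_nonneg (x : ℝ) : 0 ≤ stepBump x :=
  sub_nonneg.2 (smoothTransition.monotone (by linarith))

theorem stepBump_le_one (x : ℝ) : stepBump x ≤ 1 := by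
  have h1 := smoothTransition.le_one x
  have h2 := smoothTransition.nonneg (x - 1)
  unfold stepBump; linarith

theorem stepBump_of_nonpos {x : ℝ} (hx : x ≤ 0) : stepBump x = 0 := by
  rw [stepBump, smoothTransition.zero_of_nonpos hx, smoothTransition.zero_of_nonpos (by linarith),
    sub_zero]

theorem stepBump_of_two_le {x : ℝ} (hx : 2 ≤ x) : stepBump x = 0 := by
  rw [stepBump, smoothTransition.one_of_one_le (by linarith),
    smoothTransition.one_of_one_le (by linarith), sub_self]

theorem sum_stepBump {a b : ℕ} (hab : a ≤ b) (x : ℝ) :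
    ∑ m ∈ Finset.Ico a b, stepBump (x - m) = smoothTransition (x - a) - smoothTransition (x - b) := by
  induction b, hab using Nat.le_induction with
  | base => simp
  | succ n hn ih =>
    rw [Finset.sum_Ico_succ_top hn, ih, stepBump]
    push_cast
    rw [sub_sub x]; ring

theorem sum_stepBump_eq_one {a b : ℕ} (hab : a ≤ b) {x : ℝ} (ha : a + 1 ≤ x) (hb : x ≤ b) :
    ∑ m ∈ Finset.Ico a b, stepBump (x - m) = 1 := by
  rw [sum_stepBump hab, smoothTransition.one_of_one_le (by linarith),
    smoothTransition.zero_of_nonpos (by linarith), sub_zero]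

theorem sum_stepBump_le_one {a b : ℕ} (hab : a ≤ b) (x : ℝ) :
    ∑ m ∈ Finset.Ico a b, stepBump (x - m) ≤ 1 := by
  rw [sum_stepBump hab]
  linarith [smoothTransition.le_one (x - a), smoothTransition.nonneg (x - b)]

theorem stepBump_hasCompactSupport : HasCompactSupport stepBump :=
  HasCompactSupport.intro (K := Set.Icc 0 2) isCompact_Icc fun x hx => by
    by_cases h0 : x ≤ 0
    · exact stepBump_of_nonpos h0
    · exact stepBump_of_two_le (by
        by_contra h2; exact hx ⟨(not_le.1 h0).le, (not_le.1 h2).le⟩)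

theorem exists_fourier_bound_of_contDiff {f : ℝ → ℂ} (hfs : ContDiff ℝ (⊤ : ℕ∞) f)
    (hfc : HasCompactSupport f) (N : ℕ) : ∃ C : ℝ, 0 < C ∧ ∀ a : ℝ,
    ‖𝓕 f a‖ ≤ C ∧ ‖𝓕 f a‖ * |a| ^ N ≤ C := by
  have hsupp : ∀ n : ℕ, HasCompactSupport (iteratedDeriv n f) := fun n => by
    induction n with
    | zero => simpa using hfc
    | succ n ih => rw [iteratedDeriv_succ]; exact ih.deriv
  have hint : ∀ n : ℕ, Integrable (iteratedDeriv n f) := fun n =>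
    (hfs.continuous_iteratedDeriv n
      (by exact_mod_cast (le_top : (n : ℕ∞) ≤ ⊤))).integrable_of_hasCompactSupport (hsupp n)
  refine ⟨(∫ x, ‖f x‖) + (∫ x, ‖iteratedDeriv N f x‖) + 1, by positivity, fun a => ⟨?_, ?_⟩⟩
  · have := norm_fourier_le_integral f a
    have h2 : 0 ≤ ∫ x, ‖iteratedDeriv N f x‖ := by positivity
    linarith
  · have h1 := norm_fourier_le_integral (iteratedDeriv N f) a
    rw [fourier_iteratedDeriv (N := ⊤) hfs (fun n _ => hint n) le_top] at h1
    rw [norm_smul, norm_pow] at h1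
    have h3 : |a| ≤ ‖(2 * π * Complex.I * a : ℂ)‖ := by
      simp only [norm_mul, Complex.norm_real, Complex.norm_I, mul_one, Complex.norm_ofNat,
        Real.norm_eq_abs, abs_of_pos Real.pi_pos]
      nlinarith [Real.pi_gt_three, abs_nonneg a]
    have h2 : 0 ≤ ∫ x, ‖f x‖ := by positivity
    have h4 : |a| ^ N * ‖𝓕 f a‖ ≤ ‖(2 * π * Complex.I * a : ℂ)‖ ^ N * ‖𝓕 f a‖ := by gcongr
    linarith

theorem exists_fourier_stepBump_bound (N : ℕ) : ∃ C : ℝ, 0 < C ∧ ∀ a : ℝ,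
    ‖𝓕 (fun x => (stepBump x : ℂ)) a‖ ≤ C ∧ ‖𝓕 (fun x => (stepBump x : ℂ)) a‖ * |a| ^ N ≤ C :=
  exists_fourier_bound_of_contDiff (Complex.ofRealCLM.contDiff.comp stepBump_contDiff)
    (stepBump_hasCompactSupport.comp_left Complex.ofReal_zero) N

/-- Decay of oscillatory integrals against the scaled and translated bump. -/
theorem exists_oscillatory_stepBump_bound (N : ℕ) : ∃ C : ℝ, 0 < C ∧ ∀ (H a : ℝ) (m : ℕ), 0 < H →
    ‖∫ r in Set.Ioi (0 : ℝ), Complex.exp (↑(-2 * π * r * a) * Complex.I) *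
      (stepBump (r / H - m) : ℂ)‖ ≤ H * C ∧
    ‖∫ r in Set.Ioi (0 : ℝ), Complex.exp (↑(-2 * π * r * a) * Complex.I) *
      (stepBump (r / H - m) : ℂ)‖ * (H * |a|) ^ N ≤ H * C := by
  obtain ⟨C, hC, hb⟩ := exists_fourier_stepBump_bound N
  refine ⟨C, hC, fun H a m hH => ?_⟩
  have key : ‖∫ r in Set.Ioi (0 : ℝ), Complex.exp (↑(-2 * π * r * a) * Complex.I) *
      (stepBump (r / H - m) : ℂ)‖ = H * ‖𝓕 (fun x => (stepBump x : ℂ)) (H * a)‖ := by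
    rw [setIntegral_eq_integral_of_forall_compl_eq_zero]
    · let G : ℝ → ℂ := fun x => Complex.exp (↑(-2 * π * (H * (x + m)) * a) * Complex.I) *
        (stepBump x : ℂ)
      have e1 : (fun r : ℝ => Complex.exp (↑(-2 * π * r * a) * Complex.I) *
          (stepBump (r / H - m) : ℂ)) = fun r => G (r / H - m) := by
        ext r
        simp only [G]
        congr 4
        field_simp
        ring
      rw [e1, Measure.integral_comp_div (fun r => G (r - m)), integral_sub_right_eq_self,
        norm_smul, Real.norm_eq_abs, abs_abs, abs_of_pos hH]
      congr 1
      rw [fourier_real_eq_integral_exp_smul]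
      have e2 : G = fun x => Complex.exp (↑(-2 * π * (H * m) * a) * Complex.I) *
          (Complex.exp (↑(-2 * π * x * (H * a)) * Complex.I) • (stepBump x : ℂ)) := by
        ext x
        simp only [G, smul_eq_mul, ← mul_assoc, ← Complex.exp_add]
        congr 2
        push_cast
        ring
      rw [e2, integral_const_mul, norm_mul, Complex.norm_exp_ofReal_mul_I, one_mul]
    · intro r hr
      have hr' : r ≤ 0 := not_lt.1 hr
      rw [stepBump_of_nonpos]
      · simp
      · have : r / H ≤ 0 := div_nonpos_of_nonpos_of_nonneg hr' hH.le
        have : (0 : ℝ) ≤ m := Nat.cast_nonneg m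
        linarith
  obtain ⟨h1, h2⟩ := hb (H * a)
  rw [abs_mul, abs_of_pos hH] at h2
  rw [key]
  exact ⟨by gcongr, by rw [mul_assoc]; gcongr⟩

end Bump

section Kernel
open FourierTransform Real
variable {E : Type*} [NormedAddCommGroup E] [InnerProductSpace ℝ E]

/-- The cone of aperture `h` about the unit vector `v`. -/
def cap (v : E) (h : ℝ) : Set E := {z | ‖z - ‖z‖ • v‖ ≤ h * ‖z‖}

theorem isClosed_cap (v : E) (h : ℝ) : IsClosed (cap v h) :=
  isClosed_le (by fun_prop) (by fun_prop)

theorem smul_mem_cap_iff {v z : E} {h r : ℝ} (hr : 0 < r) : r • z ∈ cap v h ↔ z ∈ cap v h := by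
  simp only [cap, Set.mem_ofPred_eq, norm_smul, Real.norm_eq_abs, abs_of_pos hr]
  rw [mul_smul, ← smul_sub, norm_smul, Real.norm_eq_abs, abs_of_pos hr]
  constructor <;> intro hh <;> nlinarith

/-- The partition of unity subordinate to the cones about the elements of `V`. -/
def capPart (V : Finset E) (h : ℝ) (v z : E) : ℝ :=
  (cap v h).indicator 1 z / ∑ w ∈ V, (cap w h).indicator (1 : E → ℝ) z

theorem capPart_nonneg (V : Finset E) (h : ℝ) (v z : E) : 0 ≤ capPart V h v z :=
  div_nonneg (Set.indicator_nonneg (fun _ _ => zero_le_one) _)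
    (Finset.sum_nonneg fun _ _ => Set.indicator_nonneg (fun _ _ => zero_le_one) _)

theorem capPart_eq_zero {V : Finset E} {h : ℝ} {v z : E} (hz : z ∉ cap v h) :
    capPart V h v z = 0 := by
  simp [capPart, hz]

theorem capPart_le_one {V : Finset E} (h : ℝ) {v : E} (hv : v ∈ V) (z : E) :
    capPart V h v z ≤ 1 :=
  div_le_one_of_le₀ (Finset.single_le_sum
    (f := fun w => (cap w h).indicator (1 : E → ℝ) z)
    (fun _ _ => Set.indicator_nonneg (fun _ _ => zero_le_one) _) hv)
    (Finset.sum_nonneg fun _ _ => Set.indicator_nonneg (fun _ _ => zero_le_one) _)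

theorem capPart_smul (V : Finset E) (h : ℝ) (v z : E) {r : ℝ} (hr : 0 < r) :
    capPart V h v (r • z) = capPart V h v z := by
  have key : ∀ w : E, (cap w h).indicator (1 : E → ℝ) (r • z) = (cap w h).indicator 1 z := by
    intro w
    by_cases hz : z ∈ cap w h
    · rw [Set.indicator_of_mem hz, Set.indicator_of_mem ((smul_mem_cap_iff hr).2 hz)]; rfl
    · rw [Set.indicator_of_notMem hz, Set.indicator_of_notMem (mt (smul_mem_cap_iff hr).1 hz)]
  simp only [capPart, key]

theorem sum_capPart {V : Finset E} {h : ℝ} {z : E} (hz : ∃ v ∈ V, z ∈ cap v h) :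
    ∑ v ∈ V, capPart V h v z = 1 := by
  obtain ⟨v, hv, hvz⟩ := hz
  unfold capPart
  rw [← Finset.sum_div, div_self]
  have := Finset.single_le_sum (f := fun w => (cap w h).indicator (1 : E → ℝ) z)
    (fun _ _ => Set.indicator_nonneg (fun _ _ => zero_le_one) _) hv
  have h1 : (cap v h).indicator (1 : E → ℝ) z = 1 := by simp [hvz]
  linarith

theorem sum_capPart_le_one (V : Finset E) (h : ℝ) (z : E) : ∑ v ∈ V, capPart V h v z ≤ 1 := by
  unfold capPart
  rw [← Finset.sum_div]
  exact div_self_le_one _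

theorem exists_mem_cap_of_net {V : Finset E} {h : ℝ} (hV : ∀ θ : E, ‖θ‖ = 1 → ∃ v ∈ V, dist θ v < h)
    {z : E} (hz : z ≠ 0) : ∃ v ∈ V, z ∈ cap v h := by
  have hz0 : 0 < ‖z‖ := norm_pos_iff.2 hz
  obtain ⟨v, hv, hd⟩ := hV (‖z‖⁻¹ • z) (norm_smul_inv_norm hz)
  refine ⟨v, hv, ?_⟩
  have : z - ‖z‖ • v = ‖z‖ • (‖z‖⁻¹ • z - v) := by
    rw [smul_sub, smul_smul, mul_inv_cancel₀ hz0.ne', one_smul]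
  rw [cap, Set.mem_ofPred_eq, this, norm_smul, norm_norm, ← dist_eq_norm]
  nlinarith

variable [MeasurableSpace E] [BorelSpace E]

theorem measurable_capPart (V : Finset E) (h : ℝ) (v : E) : Measurable (capPart V h v) := by
  have : ∀ w : E, Measurable ((cap w h).indicator (1 : E → ℝ)) := fun w =>
    measurable_one.indicator (isClosed_cap w h).measurableSet
  exact (this v).div (Finset.measurable_fun_sum _ fun w _ => this w)

/-- The elementary kernel at radial scale `D`, radial position `m` and direction `v`. -/
def kern (V : Finset E) (h : ℝ) (Ω : E → ℝ) (D : ℝ) (m : ℕ) (v z : E) : ℝ :=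
  D⁻¹ * (‖z‖ ^ (Module.finrank ℝ E - 1))⁻¹ * Ω z * stepBump (‖z‖ / (D * h) - m) * capPart V h v z

theorem measurable_kern [FiniteDimensional ℝ E] (V : Finset E) (h : ℝ) {Ω : E → ℝ}
    (hΩ : Measurable Ω) (D : ℝ) (m : ℕ) (v : E) : Measurable (kern V h Ω D m v) := by
  have h1 : Measurable stepBump := (stepBump_contDiff (n := 0)).continuous.measurable
  have h2 := measurable_capPart V h v
  unfold kern
  fun_prop

theorem stepBump_ne_zero_bounds {a h D : ℝ} (hD : 0 < D) (hh : 0 < h) {m : ℕ}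
    (hne : stepBump (a / (D * h) - m) ≠ 0) : D * h * m ≤ a ∧ a ≤ D * h * (m + 2) := by
  have hDh : 0 < D * h := by positivity
  constructor
  · by_contra hc
    refine hne (stepBump_of_nonpos ?_)
    rw [sub_nonpos, div_le_iff₀ hDh]
    linarith
  · by_contra hc
    refine hne (stepBump_of_two_le ?_)
    have : (m : ℝ) + 2 ≤ a / (D * h) := by
      rw [le_div_iff₀ hDh]; linarith
    linarith

theorem abs_kern_le {V : Finset E} {h : ℝ} (hh : 0 < h) {Ω : E → ℝ} {M : ℝ}
    (hM : ∀ z, |Ω z| ≤ M) {D : ℝ} (hD : 0 < D) {m : ℕ} (hm : 1 ≤ m) {v : E} (hv : v ∈ V) (z : E) :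
    |kern V h Ω D m v z| ≤ (closedBall (0 : E) (D * h * (m + 2))).indicator
      (fun _ => D⁻¹ * ((D * h) ^ (Module.finrank ℝ E - 1))⁻¹ * M) z := by
  have hM0 : 0 ≤ M := (abs_nonneg _).trans (hM z)
  by_cases hne : stepBump (‖z‖ / (D * h) - m) = 0
  · rw [kern, hne, mul_zero, zero_mul, abs_zero]
    exact Set.indicator_nonneg (fun _ _ => by positivity) _
  · obtain ⟨h1, h2⟩ := stepBump_ne_zero_bounds hD hh hne
    have hm' : (1 : ℝ) ≤ m := by exact_mod_cast hm
    have hDh : 0 < D * h := by positivity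
    have h3 : D * h ≤ ‖z‖ := by nlinarith
    rw [Set.indicator_of_mem (by rw [mem_closedBall, dist_zero_right]; exact h2), kern, abs_mul,
      abs_mul, abs_mul, abs_of_nonneg (stepBump_nonneg _), abs_of_nonneg (capPart_nonneg _ _ _ _),
      abs_of_nonneg (by positivity)]
    have h4 : (‖z‖ ^ (Module.finrank ℝ E - 1))⁻¹ ≤ ((D * h) ^ (Module.finrank ℝ E - 1))⁻¹ := by
      gcongr
    calc _ ≤ D⁻¹ * ((D * h) ^ (Module.finrank ℝ E - 1))⁻¹ * M * 1 * 1 := by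
          gcongr
          · exact capPart_nonneg _ _ _ _
          · exact stepBump_nonneg _
          · exact hM z
          · exact stepBump_le_one _
          · exact capPart_le_one h hv z
      _ = _ := by ring

variable [FiniteDimensional ℝ E]

theorem integrable_kern {V : Finset E} {h : ℝ} (hh : 0 < h) {Ω : E → ℝ} (hΩ : Measurable Ω) {M : ℝ}
    (hM : ∀ z, |Ω z| ≤ M) {D : ℝ} (hD : 0 < D) {m : ℕ} (hm : 1 ≤ m) {v : E} (hv : v ∈ V) :
    Integrable (fun z => (kern V h Ω D m v z : ℂ)) := by
  refine Integrable.mono' (g := (closedBall (0 : E) (D * h * (m + 2))).indicator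
      (fun _ => D⁻¹ * ((D * h) ^ (Module.finrank ℝ E - 1))⁻¹ * M)) ?_ ?_ ?_
  · rw [integrable_indicator_iff measurableSet_closedBall]
    exact integrableOn_const (isCompact_closedBall _ _).measure_lt_top.ne
  · exact (Complex.measurable_ofReal.comp
      (measurable_kern V h hΩ D m v)).aestronglyMeasurable
  · refine Eventually.of_forall fun z => ?_
    rw [Complex.norm_real]
    exact abs_kern_le hh hM hD hm hv z

theorem exists_fourier_kern_bound [Nontrivial E] (N : ℕ) : ∃ C : ℝ, 0 < C ∧
    ∀ (V : Finset E) (h ρ : ℝ) (Ω : E → ℝ) (M ω D : ℝ) (m : ℕ) (v ξ : E),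
      0 < h → h ≤ 1 → 2 * h ≤ ρ → Measurable Ω → (∀ z, |Ω z| ≤ M) →
      (∀ r : ℝ, 0 < r → ∀ z : E, z ≠ 0 → Ω (r • z) = Ω z) →
      (∫ θ : sphere (0 : E) 1, |Ω θ| ∂(volume : Measure E).toSphere) ≤ ω →
      0 < D → 1 ≤ m → v ∈ V →
      ‖𝓕 (fun z => (kern V h Ω D m v z : ℂ)) ξ‖ ≤ C * ω ∧
      (ρ * ‖ξ‖ < |inner ℝ v ξ| →
        ‖𝓕 (fun z => (kern V h Ω D m v z : ℂ)) ξ‖ * (D * h * ρ * ‖ξ‖) ^ N ≤ C * ω) := by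
  obtain ⟨C, hC, hosc⟩ := exists_oscillatory_stepBump_bound N
  refine ⟨2 ^ N * C, by positivity, ?_⟩
  intro V h ρ Ω M ω D m v ξ hh hh1 hρ hΩ hM hhom hω hD hm hv
  have hDh : 0 < D * h := by positivity
  have hρ0 : 0 ≤ ρ := by linarith
  let J : sphere (0 : E) 1 → ℂ := fun θ => ∫ r in Set.Ioi (0 : ℝ),
    Complex.exp (↑(-2 * π * r * inner ℝ (θ : E) ξ) * Complex.I) * (stepBump (r / (D * h) - m) : ℂ)
  have hF : 𝓕 (fun z => (kern V h Ω D m v z : ℂ)) ξ =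
      ∫ θ : sphere (0 : E) 1, (D⁻¹ * Ω θ * capPart V h v θ : ℝ) * J θ
        ∂(volume : Measure E).toSphere := by
    rw [fourier_eq']
    have hint : Integrable (fun z => Complex.exp (↑(-2 * π * inner ℝ z ξ) * Complex.I) •
        (kern V h Ω D m v z : ℂ)) := by
      refine ((integrable_kern hh hΩ hM hD hm hv).bdd_mul (c := 1) ?_ ?_)
      · exact Continuous.aestronglyMeasurable (by fun_prop)
      · exact Eventually.of_forall fun z => by rw [Complex.norm_exp_ofReal_mul_I]
    rw [integral_polar hint]
    congr 1
    ext θ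
    simp only [J]
    rw [← integral_const_mul]
    refine setIntegral_congr_fun measurableSet_Ioi fun r hr => ?_
    have hr0 : (0 : ℝ) < r := hr
    have hθ : ‖(θ : E)‖ = 1 := norm_eq_of_mem_sphere θ
    have hθ0 : (θ : E) ≠ 0 := fun h0 => by rw [h0, norm_zero] at hθ; exact zero_ne_one hθ
    simp only [kern, smul_eq_mul, Complex.real_smul]
    rw [hhom r hr0 θ hθ0, capPart_smul _ _ _ _ hr0, norm_smul, hθ, mul_one, Real.norm_eq_abs,
      abs_of_pos hr0, real_inner_smul_left]
    have hrp : ((r : ℂ) ^ (Module.finrank ℝ E - 1)) ≠ 0 :=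
      pow_ne_zero _ (Complex.ofReal_ne_zero.2 hr0.ne')
    rw [mul_assoc (-2 * π) r]
    push_cast
    field_simp
  have hΩi : Integrable (fun θ : sphere (0 : E) 1 => |Ω θ|) (volume : Measure E).toSphere := by
    refine Integrable.of_bound (C := M) ?_ (Eventually.of_forall fun θ => ?_)
    · exact ((hΩ.comp measurable_subtype_coe).abs).aestronglyMeasurable
    · rw [Real.norm_eq_abs, abs_abs]; exact hM _
  have hbound : ∀ X : ℝ, 0 ≤ X → (∀ θ : sphere (0 : E) 1, capPart V h v θ ≠ 0 →
      ‖J θ‖ * X ≤ D * h * (2 ^ N * C)) →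
      ‖𝓕 (fun z => (kern V h Ω D m v z : ℂ)) ξ‖ * X ≤ 2 ^ N * C * ω := by
    intro X hX hJ
    rw [hF]
    refine (mul_le_mul_of_nonneg_right (norm_integral_le_integral_norm _) hX).trans ?_
    rw [← integral_mul_const]
    calc _ ≤ ∫ θ : sphere (0 : E) 1, |Ω θ| * (2 ^ N * C) ∂(volume : Measure E).toSphere := by
          refine integral_mono_of_nonneg (Eventually.of_forall fun θ => by positivity)
            (hΩi.mul_const _) (Eventually.of_forall fun θ => ?_)
          simp only [norm_mul, Complex.norm_real, Real.norm_eq_abs]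
          rw [abs_of_pos (inv_pos.2 hD), abs_of_nonneg (capPart_nonneg _ _ _ _)]
          by_cases hz : capPart V h v θ = 0
          · rw [hz]; simp; positivity
          · calc D⁻¹ * |Ω θ| * capPart V h v θ * ‖J θ‖ * X
                = D⁻¹ * |Ω θ| * capPart V h v θ * (‖J θ‖ * X) := by ring
              _ ≤ D⁻¹ * |Ω θ| * 1 * (D * h * (2 ^ N * C)) := by
                  refine mul_le_mul ?_ (hJ θ hz) (by positivity) (by positivity)
                  exact mul_le_mul_of_nonneg_left (capPart_le_one h hv _) (by positivity)
              _ = |Ω θ| * (2 ^ N * C) * h := by field_simp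
              _ ≤ |Ω θ| * (2 ^ N * C) * 1 := by gcongr
              _ = _ := mul_one _
      _ = (∫ θ : sphere (0 : E) 1, |Ω θ| ∂(volume : Measure E).toSphere) * (2 ^ N * C) :=
          integral_mul_const _ _
      _ ≤ _ := by rw [mul_comm]; gcongr
  have h2N : (1 : ℝ) ≤ 2 ^ N := one_le_pow₀ (by norm_num)
  constructor
  · have := hbound 1 zero_le_one fun θ _ => by
      rw [mul_one]
      refine ((hosc (D * h) (inner ℝ (θ : E) ξ) m hDh).1).trans ?_
      gcongr
      nlinarith
    rwa [mul_one] at this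
  · intro hvξ
    refine hbound _ (by positivity) fun θ hθc => ?_
    have hθ : ‖(θ : E)‖ = 1 := norm_eq_of_mem_sphere θ
    have hcap : (θ : E) ∈ cap v h := by
      by_contra hc; exact hθc (capPart_eq_zero hc)
    rw [cap, Set.mem_ofPred_eq, hθ, one_smul, mul_one] at hcap
    have h1 : |inner ℝ ((θ : E) - v) ξ| ≤ h * ‖ξ‖ :=
      (abs_real_inner_le_norm _ _).trans (by gcongr)
    rw [inner_sub_left] at h1
    have h2 := abs_sub_abs_le_abs_sub (inner ℝ v ξ) (inner ℝ (θ : E) ξ)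
    rw [abs_sub_comm] at h2
    have h3 : ρ * ‖ξ‖ ≤ 2 * |inner ℝ (θ : E) ξ| := by
      nlinarith [norm_nonneg ξ]
    have h4 : (D * h * ρ * ‖ξ‖) ^ N ≤ 2 ^ N * (D * h * |inner ℝ (θ : E) ξ|) ^ N := by
      rw [← mul_pow]
      refine pow_le_pow_left₀ (by positivity) ?_ _
      nlinarith
    have h5 := (hosc (D * h) (inner ℝ (θ : E) ξ) m hDh).2
    calc ‖J θ‖ * (D * h * ρ * ‖ξ‖) ^ N
        ≤ ‖J θ‖ * (2 ^ N * (D * h * |inner ℝ (θ : E) ξ|) ^ N) := by gcongr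
      _ = 2 ^ N * (‖J θ‖ * (D * h * |inner ℝ (θ : E) ξ|) ^ N) := by ring
      _ ≤ 2 ^ N * (D * h * C) := by gcongr
      _ = _ := by ring

end Kernel

section Atoms
variable {E : Type*} [NormedAddCommGroup E] [InnerProductSpace ℝ E] [FiniteDimensional ℝ E]
  [MeasurableSpace E] [BorelSpace E]

/-- A family of smooth mean zero atoms `b i`, supported in the ball of radius `2 ^ q i` about `y i`,
whose total mass in each ball is controlled by `α`. -/
structure IsAtomFamily {ι : Type*} [Fintype ι] (α : ℝ) (y : ι → E) (q : ι → ℤ) (b : ι → E → ℂ) :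
    Prop where
  contDiff : ∀ i, ContDiff ℝ (⊤ : ℕ∞) (b i)
  support : ∀ i x, x ∉ closedBall (y i) ((2 : ℝ) ^ q i) → b i x = 0
  mean_zero : ∀ i, ∫ x, b i x = 0
  packing : ∀ x : E, ∀ R : ℝ, 0 < R →
    ∑ i with (2 : ℝ) ^ q i ≤ R ∧ ‖y i - x‖ ≤ R, ∫ z, ‖b i z‖ ≤ α * R ^ Module.finrank ℝ E

namespace IsAtomFamily
variable {ι : Type*} [Fintype ι] {α : ℝ} {y : ι → E} {q : ι → ℤ} {b : ι → E → ℂ}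

theorem hasCompactSupport (hb : IsAtomFamily α y q b) (i : ι) : HasCompactSupport (b i) :=
  HasCompactSupport.intro (isCompact_closedBall (y i) ((2 : ℝ) ^ q i)) (hb.support i)

theorem integrable (hb : IsAtomFamily α y q b) (i : ι) : Integrable (b i) :=
  (hb.contDiff i).continuous.integrable_of_hasCompactSupport (hb.hasCompactSupport i)

theorem lintegral_enorm (hb : IsAtomFamily α y q b) (i : ι) :
    ∫⁻ z, ‖b i z‖ₑ = ENNReal.ofReal (∫ z, ‖b i z‖) :=
  (ofReal_integral_norm_eq_lintegral_enorm (hb.integrable i)).symm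

/-- Mass of the atoms of small scale in a tube. -/
theorem sum_tube_le (hb : IsAtomFamily α y q b) (e : E) (he : ‖e‖ = 1) (x₀ : E) {h R : ℝ} (hh : 0 < h)
    (hh1 : h ≤ 1) (hR : 0 < R) (p : ι → Prop) [DecidablePred p]
    (hp : ∀ i, p i → (2 : ℝ) ^ q i ≤ 2 * h * R ∧ ∃ a : ℝ, |a| ≤ R ∧ ‖y i - x₀ - a • e‖ ≤ h * R) :
    ∑ i with p i, ∫⁻ z, ‖b i z‖ₑ ≤
      ENNReal.ofReal (5 / h * (α * (2 * h * R) ^ Module.finrank ℝ E)) := by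
  classical
  set s : Finset ι := Finset.univ.filter (fun i => (2 : ℝ) ^ q i ≤ 2 * h * R) with hs
  set μ : Measure E := ∑ i ∈ s, (∫⁻ z, ‖b i z‖ₑ) • Measure.dirac (y i) with hμ
  have hball : ∀ x, μ (closedBall x (2 * h * R)) ≤
      ENNReal.ofReal (α * (2 * h * R) ^ Module.finrank ℝ E) := by
    intro x
    have hpk := hb.packing x (2 * h * R) (by positivity)
    refine le_trans ?_ (ENNReal.ofReal_le_ofReal hpk)
    rw [ENNReal.ofReal_sum_of_nonneg (fun i _ => integral_nonneg fun _ => norm_nonneg _), hμ,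
      Measure.finsetSum_apply, hs, Finset.sum_filter, Finset.sum_filter]
    refine Finset.sum_le_sum fun i _ => ?_
    by_cases h1 : (2 : ℝ) ^ q i ≤ 2 * h * R
    · by_cases h2 : ‖y i - x‖ ≤ 2 * h * R
      · rw [if_pos h1, if_pos ⟨h1, h2⟩, Measure.smul_apply, Measure.dirac_apply_of_mem
          (by rwa [mem_closedBall, dist_eq_norm]), smul_eq_mul, mul_one, hb.lintegral_enorm]
      · rw [if_pos h1, Measure.smul_apply, Measure.dirac_apply' _ measurableSet_closedBall,
          Set.indicator_of_notMem (by rwa [mem_closedBall, dist_eq_norm])]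
        simp
    · rw [if_neg h1]; exact zero_le
  have htube := measure_tube_le μ e he hh hh1 hR zero_le_one _ x₀ hball
  refine le_trans ?_ (htube.trans (le_of_eq ?_))
  · set T : Set E := {x | ∃ a : ℝ, |a| ≤ 1 * R ∧ ‖x - x₀ - a • e‖ ≤ h * R}
    rw [hμ, Measure.finsetSum_apply, hs, Finset.sum_filter, Finset.sum_filter]
    refine Finset.sum_le_sum fun i _ => ?_
    by_cases h1 : p i
    · obtain ⟨h2, a, ha, h3⟩ := hp i h1
      rw [if_pos h1, if_pos h2, Measure.smul_apply, Measure.dirac_apply_of_mem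
        (show y i ∈ T from ⟨a, by rwa [one_mul], h3⟩), smul_eq_mul, mul_one]
    · rw [if_neg h1]; exact zero_le
  · rw [← ENNReal.ofReal_mul (by positivity)]
    norm_num

end IsAtomFamily

theorem volume_cap_le [Nontrivial E] (e : E) (he : ‖e‖ = 1) {h R : ℝ} (hh : 0 < h) (hh1 : h ≤ 1)
    (hR : 0 < R) :
    volume (cap e h ∩ closedBall 0 R) ≤ ENNReal.ofReal
      (5 / h * ((2 * h * R) ^ Module.finrank ℝ E * volume.real (ball (0 : E) 1))) := by
  have htube := measure_tube_le volume e he hh hh1 hR zero_le_one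
    (volume (closedBall (0 : E) (2 * h * R))) 0
    (fun x => (Measure.addHaar_closedBall_center _ _ _).le)
  refine (measure_mono ?_).trans (htube.trans (le_of_eq ?_))
  · rintro z ⟨hz, hzR⟩
    rw [mem_closedBall, dist_zero_right] at hzR
    refine ⟨‖z‖, by rwa [abs_norm, one_mul], ?_⟩
    rw [sub_zero]
    exact le_trans hz (by gcongr)
  · rw [Measure.addHaar_closedBall _ _ (by positivity), ENNReal.ofReal_mul (by positivity),
      ENNReal.ofReal_mul (by positivity), ofReal_measureReal]
    norm_num

/-- The normalised indicator function of a truncated cone. -/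
def coneKer (v : E) (h Q D : ℝ) : E → ENNReal :=
  (cap v h ∩ closedBall 0 (Q * D)).indicator fun _ => ENNReal.ofReal ((D ^ Module.finrank ℝ E)⁻¹)

theorem measurable_coneKer (v : E) (h Q D : ℝ) : Measurable (coneKer v h Q D) :=
  measurable_const.indicator ((isClosed_cap v h).inter isClosed_closedBall).measurableSet

theorem coneKer_le (v : E) (h Q D : ℝ) (z : E) :
    coneKer v h Q D z ≤ ENNReal.ofReal ((D ^ Module.finrank ℝ E)⁻¹) :=
  Set.indicator_le_self' (fun _ _ => zero_le) z

theorem lintegral_coneKer_le [Nontrivial E] (v : E) (hv : ‖v‖ = 1) {h Q D : ℝ} (hh : 0 < h)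
    (hh1 : h ≤ 1) (hQ : 0 < Q) (hD : 0 < D) :
    ∫⁻ z, coneKer v h Q D z ≤ ENNReal.ofReal
      (5 / h * ((2 * h * Q) ^ Module.finrank ℝ E * volume.real (ball (0 : E) 1))) := by
  unfold coneKer
  rw [lintegral_indicator_const ((isClosed_cap v h).inter isClosed_closedBall).measurableSet]
  refine (mul_le_mul_right (volume_cap_le v hv hh hh1 (by positivity)) _).trans (le_of_eq ?_)
  rw [← ENNReal.ofReal_mul (by positivity), ← mul_assoc (2 * h) Q D, mul_pow _ D]
  congr 1
  field_simp

/-- If two truncated cones with vertices `w`, `w'` meet then `w'` is in a tube about `w`. -/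
theorem exists_tube_of_mem_cap {v x w w' : E} {h R R' : ℝ} (hh : 0 ≤ h) (hR' : R' ≤ R)
    (h1 : x - w ∈ cap v h ∩ closedBall 0 R) (h2 : x - w' ∈ cap v h ∩ closedBall 0 R') :
    ∃ a : ℝ, |a| ≤ R ∧ ‖w' - w - a • v‖ ≤ 2 * h * R := by
  obtain ⟨hc1, hb1⟩ := h1
  obtain ⟨hc2, hb2⟩ := h2
  rw [mem_closedBall, dist_zero_right] at hb1 hb2
  have hn1 := norm_nonneg (x - w)
  have hn2 := norm_nonneg (x - w')
  refine ⟨‖x - w‖ - ‖x - w'‖, abs_le.2 ⟨by linarith, by linarith⟩, ?_⟩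
  have : w' - w - (‖x - w‖ - ‖x - w'‖) • v =
      ((x - w) - ‖x - w‖ • v) - ((x - w') - ‖x - w'‖ • v) := by
    rw [sub_smul]; abel
  rw [this]
  refine (norm_sub_le _ _).trans ?_
  have := mul_le_mul_of_nonneg_left hb1 hh
  have := mul_le_mul_of_nonneg_left (hb2.trans hR') hh
  rw [cap, Set.mem_ofPred_eq] at hc1 hc2
  linarith

theorem sq_sum_le_two_mul {ι : Type*} [Fintype ι] (q : ι → ℤ) (a : ι → ENNReal) :
    (∑ i, a i) ^ 2 ≤ 2 * ∑ i, ∑ i' with q i' ≤ q i, a i * a i' := by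
  have h1 : ∑ i, ∑ i' with q i' ≤ q i, a i * a i' = ∑ i, ∑ i' with q i ≤ q i', a i * a i' := by
    simp_rw [Finset.sum_filter]
    rw [Finset.sum_comm]
    simp_rw [mul_comm]
  rw [two_mul]
  nth_rewrite 2 [h1]
  rw [sq, Finset.sum_mul_sum, ← Finset.sum_add_distrib]
  refine Finset.sum_le_sum fun i _ => ?_
  rw [Finset.sum_filter, Finset.sum_filter, ← Finset.sum_add_distrib]
  refine Finset.sum_le_sum fun i' _ => ?_
  rcases le_total (q i') (q i) with h | h
  · rw [if_pos h]; exact le_self_add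
  · rw [if_pos h]; exact le_add_self

theorem IsAtomFamily.lintegral_sq_coneKer_le [Nontrivial E] {ι : Type*} [Fintype ι] {α : ℝ}
    {y : ι → E} {q : ι → ℤ} {b : ι → E → ℂ} (hb : IsAtomFamily α y q b)
    (v : E) (hv : ‖v‖ = 1) {h Q : ℝ} (hh : 0 < h) (hh1 : h ≤ 1) (hQ : 1 ≤ Q) (s : ℤ)
    (hs : (2 : ℝ) ^ (-s) ≤ h) :
    ∫⁻ x, (∑ i, ∫⁻ z, coneKer v h Q ((2 : ℝ) ^ (q i + s)) (x - z) * ‖b i z‖ₑ) ^ 2 ≤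
      ENNReal.ofReal (2 * (5 / h * (2 * h * Q) ^ Module.finrank ℝ E) ^ 2 *
        3 ^ Module.finrank ℝ E * volume.real (ball (0 : E) 1) * α * ∑ i, ∫ z, ‖b i z‖) := by
  classical
  set d := Module.finrank ℝ E with hd
  set D : ι → ℝ := fun i => (2 : ℝ) ^ (q i + s) with hD
  have hD0 : ∀ i, 0 < D i := fun i => by simp only [hD]; positivity
  set G : ι → E → ENNReal := fun i x => ∫⁻ z, coneKer v h Q (D i) (x - z) * ‖b i z‖ₑ with hG
  have hbm : ∀ i, Measurable fun z => ‖b i z‖ₑ := fun i =>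
    (hb.contDiff i).continuous.enorm.measurable
  have hkm : ∀ i, Measurable (coneKer v h Q (D i)) := fun i => measurable_coneKer _ _ _ _
  have hGm2 : ∀ i, Measurable fun p : E × E => coneKer v h Q (D i) (p.1 - p.2) * ‖b i p.2‖ₑ :=
    fun i => ((hkm i).comp (measurable_fst.sub measurable_snd)).mul ((hbm i).comp measurable_snd)
  have hGm : ∀ i, Measurable (G i) := fun i => (hGm2 i).lintegral_prod_right'
  set c : ℝ := 5 / h * ((2 * h * Q) ^ d * volume.real (ball (0 : E) 1)) with hc
  have hGint : ∀ i, ∫⁻ x, G i x ≤ ENNReal.ofReal c * ∫⁻ z, ‖b i z‖ₑ := by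
    intro i
    simp only [hG]
    rw [lintegral_lintegral_swap (hGm2 i).aemeasurable]
    rw [← lintegral_const_mul _ (hbm i)]
    refine lintegral_mono fun z => ?_
    rw [lintegral_mul_const _ (by exact (hkm i).comp (measurable_id.sub_const z))]
    gcongr
    rw [lintegral_sub_right_eq_self (fun x => coneKer v h Q (D i) x) z]
    exact lintegral_coneKer_le v hv hh hh1 (by linarith) (hD0 i)
  have hpair : ∀ i, ∑ i' with q i' ≤ q i, ∫⁻ x, G i x * G i' x ≤
      (∫⁻ z, ‖b i z‖ₑ) * (ENNReal.ofReal ((D i ^ d)⁻¹) * (ENNReal.ofReal c *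
        ENNReal.ofReal (5 / h * (α * (2 * h * (3 * (Q * D i))) ^ d)))) := by
    intro i
    have h1 : ∀ i', ∫⁻ x, G i x * G i' x =
        ∫⁻ z, ‖b i z‖ₑ * ∫⁻ x, coneKer v h Q (D i) (x - z) * G i' x := by
      intro i'
      have : ∀ x, G i x * G i' x =
          ∫⁻ z, ‖b i z‖ₑ * (coneKer v h Q (D i) (x - z) * G i' x) := by
        intro x
        simp only [hG]
        rw [← lintegral_mul_const _ (by exact (hGm2 i).comp measurable_prodMk_left)]
        refine lintegral_congr fun z => by ring
      simp_rw [this]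
      rw [lintegral_lintegral_swap]
      · refine lintegral_congr fun z => ?_
        rw [lintegral_const_mul]
        exact ((hkm i).comp (measurable_id.sub_const z)).mul (hGm i')
      · refine Measurable.aemeasurable ?_
        exact ((hbm i).comp measurable_snd).mul
          (((hkm i).comp (measurable_fst.sub measurable_snd)).mul ((hGm i').comp measurable_fst))
    simp_rw [h1]
    rw [← lintegral_finsetSum]
    swap
    · intro i' _
      refine (hbm i).mul ?_
      refine Measurable.lintegral_prod_left' (f := fun p : E × E =>
        coneKer v h Q (D i) (p.1 - p.2) * G i' p.1) ?_
      exact ((hkm i).comp (measurable_fst.sub measurable_snd)).mul ((hGm i').comp measurable_fst)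
    rw [← lintegral_mul_const _ (hbm i)]
    refine lintegral_mono fun z => ?_
    rw [← Finset.mul_sum]
    refine mul_le_mul_right ?_ _
    -- only the atoms near the tube through `z` contribute
    let p : ι → Prop := fun i' => q i' ≤ q i ∧
      ∃ a : ℝ, |a| ≤ 3 * (Q * D i) ∧ ‖y i' - z - a • v‖ ≤ h * (3 * (Q * D i))
    have hqD : ∀ i', q i' ≤ q i → (2 : ℝ) ^ q i' ≤ h * D i := by
      intro i' hi'
      calc (2 : ℝ) ^ q i' ≤ 2 ^ q i := zpow_le_zpow_right₀ (by norm_num) hi'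
        _ = 2 ^ (-s) * D i := by
          simp only [hD]; rw [← zpow_add₀ (by norm_num)]; congr 1; ring
        _ ≤ h * D i := by gcongr
    have hterm : ∀ i', q i' ≤ q i → ∫⁻ x, coneKer v h Q (D i) (x - z) * G i' x ≤
        if p i' then ENNReal.ofReal ((D i ^ d)⁻¹) * (ENNReal.ofReal c * ∫⁻ z, ‖b i' z‖ₑ) else 0 := by
      intro i' hi'
      split_ifs with hpi
      · calc _ ≤ ∫⁻ x, ENNReal.ofReal ((D i ^ d)⁻¹) * G i' x :=
              lintegral_mono fun x => mul_le_mul_left (coneKer_le _ _ _ _ _) _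
          _ = ENNReal.ofReal ((D i ^ d)⁻¹) * ∫⁻ x, G i' x := lintegral_const_mul _ (hGm i')
          _ ≤ _ := by gcongr; exact hGint i'
      · rw [nonpos_iff_eq_zero, lintegral_eq_zero_iff]
        swap
        · exact ((hkm i).comp (measurable_id.sub_const z)).mul (hGm i')
        refine Eventually.of_forall fun x => ?_
        simp only [Pi.zero_apply, mul_eq_zero]
        by_contra! hne
        refine hpi ⟨hi', ?_⟩
        have hz : x - z ∈ cap v h ∩ closedBall 0 (Q * D i) := by
          by_contra hz; exact hne.1 (Set.indicator_of_notMem hz _)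
        have : ∃ w, coneKer v h Q (D i') (x - w) * ‖b i' w‖ₑ ≠ 0 := by
          by_contra! hall
          exact hne.2 (by simp only [hG, hall, lintegral_zero])
        obtain ⟨w, hw⟩ := this
        have hw1 : x - w ∈ cap v h ∩ closedBall 0 (Q * D i') := by
          by_contra hz; exact hw (by rw [coneKer, Set.indicator_of_notMem hz, zero_mul])
        have hw2 : w ∈ closedBall (y i') ((2 : ℝ) ^ q i') := by
          by_contra hz; exact hw (by rw [hb.support i' w hz]; simp)
        have hDD : Q * D i' ≤ Q * D i := by
          simp only [hD]; gcongr; norm_num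
        obtain ⟨a, ha, hwa⟩ := exists_tube_of_mem_cap hh.le hDD hz hw1
        have hQD : 0 < Q * D i := mul_pos (by linarith) (hD0 i)
        refine ⟨a, by linarith, ?_⟩
        rw [mem_closedBall, dist_eq_norm] at hw2
        have : y i' - z - a • v = (w - z - a • v) - (w - y i') := by abel
        rw [this]
        refine (norm_sub_le _ _).trans ?_
        have := hqD i' hi'
        have : h * D i ≤ h * (Q * D i) := by
          gcongr; nlinarith [hD0 i]
        linarith
    calc _ ≤ ∑ i' with q i' ≤ q i, if p i' then
            ENNReal.ofReal ((D i ^ d)⁻¹) * (ENNReal.ofReal c * ∫⁻ z, ‖b i' z‖ₑ) else 0 :=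
          Finset.sum_le_sum fun i' hi' => hterm i' (Finset.mem_filter.1 hi').2
      _ ≤ ∑ i', if p i' then
            ENNReal.ofReal ((D i ^ d)⁻¹) * (ENNReal.ofReal c * ∫⁻ z, ‖b i' z‖ₑ) else 0 :=
          Finset.sum_le_sum_of_subset (Finset.filter_subset _ _)
      _ = ENNReal.ofReal ((D i ^ d)⁻¹) * (ENNReal.ofReal c *
            ∑ i' with p i', ∫⁻ z, ‖b i' z‖ₑ) := by
          rw [← Finset.sum_filter, Finset.mul_sum, Finset.mul_sum]
      _ ≤ _ := by
          gcongr
          refine hb.sum_tube_le v hv z hh hh1 (mul_pos (by norm_num) (mul_pos (by linarith) (hD0 i)))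
            p fun i' hi' => ⟨?_, hi'.2⟩
          refine (hqD i' hi'.1).trans ?_
          nlinarith [mul_pos hh (hD0 i), hD0 i, mul_nonneg (mul_pos hh (hD0 i)).le (sub_nonneg.2 hQ)]
  calc ∫⁻ x, (∑ i, G i x) ^ 2
      ≤ ∫⁻ x, 2 * ∑ i, ∑ i' with q i' ≤ q i, G i x * G i' x :=
        lintegral_mono fun x => sq_sum_le_two_mul q _
    _ = 2 * ∑ i, ∑ i' with q i' ≤ q i, ∫⁻ x, G i x * G i' x := by
        rw [lintegral_const_mul]
        · rw [lintegral_finsetSum]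
          · congr 2; ext i
            exact lintegral_finsetSum _ fun i' _ => (hGm i).mul (hGm i')
          · exact fun i _ => Finset.measurable_fun_sum _ fun i' _ => (hGm i).mul (hGm i')
        · exact Finset.measurable_fun_sum _ fun i _ =>
            Finset.measurable_fun_sum _ fun i' _ => (hGm i).mul (hGm i')
    _ ≤ 2 * ∑ i, (∫⁻ z, ‖b i z‖ₑ) * (ENNReal.ofReal ((D i ^ d)⁻¹) * (ENNReal.ofReal c *
        ENNReal.ofReal (5 / h * (α * (2 * h * (3 * (Q * D i))) ^ d)))) := by
        gcongr with i; exact hpair i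
    _ = 2 * ∑ i, ENNReal.ofReal (∫ z, ‖b i z‖) * ENNReal.ofReal
          (c * (5 / h * (α * (2 * h * (3 * Q)) ^ d))) := by
        congr 2; ext i
        rw [hb.lintegral_enorm]
        congr 1
        have := hD0 i
        rw [← ENNReal.ofReal_mul (by positivity), ← ENNReal.ofReal_mul (by positivity)]
        congr 1
        have : 2 * h * (3 * (Q * D i)) = (2 * h * (3 * Q)) * D i := by ring
        rw [this, mul_pow _ (D i)]
        field_simp
    _ = _ := by
        rw [← Finset.sum_mul, ← ENNReal.ofReal_sum_of_nonneg
          (fun i _ => integral_nonneg fun _ => norm_nonneg _), ← ENNReal.ofReal_mul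
          (Finset.sum_nonneg fun i _ => integral_nonneg fun _ => norm_nonneg _)]
        rw [show (2 : ENNReal) = ENNReal.ofReal 2 by simp, ← ENNReal.ofReal_mul (by norm_num)]
        congr 1
        have : 2 * h * (3 * Q) = 3 * (2 * h * Q) := by ring
        rw [this, mul_pow 3, hc]
        ring

end Atoms

section LowPass
open FourierTransform Real Convolution
variable {E : Type*} [NormedAddCommGroup E] [InnerProductSpace ℝ E] [FiniteDimensional ℝ E]
  [MeasurableSpace E] [BorelSpace E]

theorem lintegral_fourier_sq {f : E → ℂ} (hf : ContDiff ℝ (⊤ : ℕ∞) f) (hfs : HasCompactSupport f) :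
    ∫⁻ ξ, ‖𝓕 f ξ‖ₑ ^ 2 = ∫⁻ x, ‖f x‖ₑ ^ 2 := by
  let F : SchwartzMap E ℂ := hfs.toSchwartzMap hf
  have h := SchwartzMap.integral_norm_sq_fourier F
  have h1 : ∀ G : SchwartzMap E ℂ, ENNReal.ofReal (∫ x, ‖G x‖ ^ 2) = ∫⁻ x, ‖G x‖ₑ ^ 2 := by
    intro G
    rw [ofReal_integral_eq_lintegral_ofReal]
    · refine lintegral_congr fun x => ?_
      rw [ENNReal.ofReal_pow (norm_nonneg _), ofReal_norm]
    · have := (G.memLp 2 volume).integrable_norm_pow (by norm_num)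
      simpa using this
    · exact Eventually.of_forall fun x => by positivity
  have h2 := congrArg ENNReal.ofReal h
  rw [h1, h1] at h2
  exact h2

/-- Convolution of complex-valued functions. -/
def conv (f g : E → ℂ) : E → ℂ := f ⋆[ContinuousLinearMap.mul ℂ ℂ, volume] g

theorem conv_apply (f g : E → ℂ) (x : E) : conv f g x = ∫ z, f (x - z) * g z := by
  rw [conv, convolution_eq_swap]
  rfl

theorem fourier_conv {f g : E → ℂ} (hf : Integrable f) (hg : Integrable g) (ξ : E) :
    𝓕 (conv f g) ξ = 𝓕 f ξ * 𝓕 g ξ :=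
  fourier_mul_convolution_eq hf hg ξ

theorem contDiff_conv {f g : E → ℂ} (hf : LocallyIntegrable f) (hg : ContDiff ℝ (⊤ : ℕ∞) g)
    (hgc : HasCompactSupport g) : ContDiff ℝ (⊤ : ℕ∞) (conv f g) :=
  hgc.contDiff_convolution_right (ContinuousLinearMap.mul ℝ ℂ) hf hg

theorem hasCompactSupport_conv {f g : E → ℂ} (hf : HasCompactSupport f)
    (hg : HasCompactSupport g) : HasCompactSupport (conv f g) :=
  HasCompactSupport.convolution _ hf hg

theorem enorm_conv_le (f g : E → ℂ) (x : E) :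
    ‖conv f g x‖ₑ ≤ ∫⁻ z, ‖f (x - z)‖ₑ * ‖g z‖ₑ := by
  rw [conv_apply]
  refine (enorm_integral_le_lintegral_enorm _).trans (le_of_eq ?_)
  refine lintegral_congr fun z => ?_
  rw [enorm_mul]

theorem lintegral_enorm_conv_le {f g : E → ℂ} (hf : Measurable f) (hg : Measurable g) :
    ∫⁻ x, ‖conv f g x‖ₑ ≤ (∫⁻ x, ‖f x‖ₑ) * ∫⁻ x, ‖g x‖ₑ := by
  have hm : Measurable fun p : E × E => ‖f (p.1 - p.2)‖ₑ * ‖g p.2‖ₑ :=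
    (hf.enorm.comp (measurable_fst.sub measurable_snd)).mul (hg.enorm.comp measurable_snd)
  refine (lintegral_mono fun x => enorm_conv_le f g x).trans (le_of_eq ?_)
  rw [lintegral_lintegral_swap hm.aemeasurable, ← lintegral_const_mul _ hg.enorm]
  refine lintegral_congr fun z => ?_
  rw [lintegral_mul_const _ (by exact hf.enorm.comp (measurable_id.sub_const z)),
    lintegral_sub_right_eq_self (fun x => ‖f x‖ₑ) z]

/-- Smooth approximate identities whose Fourier transform is bounded below on the dual ball. -/
theorem exists_lowpass (E : Type*) [NormedAddCommGroup E] [InnerProductSpace ℝ E]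
    [FiniteDimensional ℝ E] [MeasurableSpace E] [BorelSpace E] :
    ∃ C : ℝ, 0 < C ∧ ∀ τ : ℝ, 0 < τ → ∃ ψ : E → ℂ,
      ContDiff ℝ (⊤ : ℕ∞) ψ ∧ (∀ x, x ∉ closedBall 0 τ → ψ x = 0) ∧
      (∫ x, ‖ψ x‖) = 1 ∧
      (∀ ξ, τ * ‖ξ‖ ≤ 1 → 1 / 2 ≤ ‖𝓕 ψ ξ‖) ∧
      (∀ x, ‖ψ x‖ ≤ C * (τ ^ Module.finrank ℝ E)⁻¹) ∧
      (∀ x x', ‖ψ x - ψ x'‖ ≤ C * (τ ^ Module.finrank ℝ E)⁻¹ * (‖x - x'‖ / τ)) := by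
  set d := Module.finrank ℝ E with hd
  let φ : ContDiffBump (0 : E) := ⟨1 / (8 * π), 1 / (4 * π), by positivity, by gcongr; norm_num⟩
  let ψ₁ : E → ℝ := φ.normed volume
  have hs1 : ContDiff ℝ (⊤ : ℕ∞) ψ₁ := φ.contDiff_normed
  have hc1 : HasCompactSupport ψ₁ := φ.hasCompactSupport_normed
  obtain ⟨L, hL⟩ := hs1.lipschitzWith_of_hasCompactSupport hc1 (by simp)
  obtain ⟨B, hB⟩ := hs1.continuous.bounded_above_of_compact_support hc1
  have h0 : ∀ x, 0 ≤ ψ₁ x := fun x => φ.nonneg_normed x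
  have hz : ∀ x, x ∉ ball (0 : E) (1 / (4 * π)) → ψ₁ x = 0 := by
    intro x hx
    have := φ.support_normed_eq (μ := volume)
    by_contra hne
    exact hx (this ▸ (Function.mem_support.2 hne))
  refine ⟨max 1 (max B L), by positivity, fun τ hτ => ?_⟩
  let g : E → ℝ := fun x => (τ ^ d)⁻¹ * ψ₁ (τ⁻¹ • x)
  have hg0 : ∀ x, 0 ≤ g x := fun x => mul_nonneg (by positivity) (h0 _)
  have hgs : ContDiff ℝ (⊤ : ℕ∞) g := contDiff_const.mul (hs1.comp (contDiff_const_smul _))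
  have hgz : ∀ x, x ∉ closedBall (0 : E) (τ / (4 * π)) → g x = 0 := by
    intro x hx
    simp only [g]
    rw [hz, mul_zero]
    intro hx'
    refine hx ?_
    rw [mem_ball, dist_zero_right, norm_smul, norm_inv, Real.norm_eq_abs, abs_of_pos hτ] at hx'
    rw [mem_closedBall, dist_zero_right]
    rw [inv_mul_lt_iff₀ hτ] at hx'
    calc ‖x‖ ≤ _ := hx'.le
      _ = _ := by ring
  have hgc : HasCompactSupport g := HasCompactSupport.intro (isCompact_closedBall _ _) hgz
  have hgi : Integrable g := hgs.continuous.integrable_of_hasCompactSupport hgc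
  have hg1 : ∫ x, g x = 1 := by
    simp only [g]
    rw [integral_const_mul, Measure.integral_comp_inv_smul, φ.integral_normed, abs_of_pos
      (by positivity), ← hd]
    simp; field_simp
  have hτ4 : τ / (4 * π) ≤ τ := div_le_self hτ.le (by nlinarith [Real.pi_gt_three])
  have hnorm : ∀ x, ‖(g x : ℂ)‖ = g x := fun x => by
    rw [Complex.norm_real, Real.norm_eq_abs, abs_of_nonneg (hg0 x)]
  refine ⟨fun x => (g x : ℂ), Complex.ofRealCLM.contDiff.comp hgs, ?_, ?_, ?_, ?_, ?_⟩
  · intro x hx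
    have := hgz x fun hx' => hx (closedBall_subset_closedBall hτ4 hx')
    simp [this]
  · simp_rw [hnorm]; exact hg1
  · intro ξ hξ
    have hgic : Integrable fun x => (g x : ℂ) := hgi.ofReal
    have hei : Integrable fun x => Complex.exp (↑(-2 * π * inner ℝ x ξ) * Complex.I) •
        (g x : ℂ) := by
      refine hgic.bdd_mul (c := 1) ?_ ?_
      · exact Continuous.aestronglyMeasurable (by fun_prop)
      · exact Eventually.of_forall fun z => by rw [Complex.norm_exp_ofReal_mul_I]
    have h1 : ‖𝓕 (fun x => (g x : ℂ)) ξ - 1‖ ≤ 1 / 2 := by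
      have e1 : (1 : ℂ) = ∫ x, (g x : ℂ) := by rw [integral_complex_ofReal, hg1]; simp
      rw [fourier_eq', e1, ← integral_sub hei hgic]
      refine (norm_integral_le_integral_norm _).trans ?_
      calc _ ≤ ∫ x, 1 / 2 * g x := by
            refine integral_mono (hei.sub hgic).norm (hgi.const_mul _) fun x => ?_
            by_cases hx : x ∈ closedBall (0 : E) (τ / (4 * π))
            · rw [mem_closedBall, dist_zero_right] at hx
              simp only [smul_eq_mul]
              rw [← sub_one_mul, norm_mul, hnorm]
              refine mul_le_mul_of_nonneg_right ?_ (hg0 x)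
              have h2 := Real.norm_exp_I_mul_ofReal_sub_one_le (x := -2 * π * inner ℝ x ξ)
              rw [mul_comm Complex.I] at h2
              refine h2.trans ?_
              rw [Real.norm_eq_abs, abs_mul, abs_mul, abs_of_pos Real.pi_pos]
              have h3 := abs_real_inner_le_norm x ξ
              calc |(-2 : ℝ)| * π * |inner ℝ x ξ| ≤ 2 * π * (‖x‖ * ‖ξ‖) := by
                    rw [abs_neg, abs_two]; gcongr
                _ ≤ 2 * π * (τ / (4 * π) * ‖ξ‖) := by gcongr
                _ = (τ * ‖ξ‖) / 2 := by field_simp; norm_num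
                _ ≤ 1 / 2 := by gcongr
            · simp [hgz x hx]
        _ = 1 / 2 := by rw [integral_const_mul, hg1, mul_one]
    have h2 := norm_sub_norm_le (1 : ℂ) (𝓕 (fun x => (g x : ℂ)) ξ)
    rw [norm_sub_rev, norm_one] at h2
    linarith
  · intro x
    rw [hnorm]
    simp only [g]
    rw [mul_comm]
    gcongr
    exact ((le_abs_self _).trans (hB _)).trans ((le_max_left _ _).trans (le_max_right _ _))
  · intro x x'
    rw [← Complex.ofReal_sub, Complex.norm_real, Real.norm_eq_abs]
    simp only [g]
    rw [← mul_sub, abs_mul, abs_of_pos (by positivity)]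
    have h1 := hL.dist_le_mul (τ⁻¹ • x) (τ⁻¹ • x')
    rw [Real.dist_eq, dist_eq_norm, ← smul_sub, norm_smul, norm_inv, Real.norm_eq_abs,
      abs_of_pos hτ] at h1
    calc (τ ^ d)⁻¹ * |ψ₁ (τ⁻¹ • x) - ψ₁ (τ⁻¹ • x')|
        ≤ (τ ^ d)⁻¹ * (L * (τ⁻¹ * ‖x - x'‖)) := by gcongr
      _ ≤ (τ ^ d)⁻¹ * (max 1 (max B L) * (τ⁻¹ * ‖x - x'‖)) := by
          gcongr; exact (le_max_right _ _).trans (le_max_right _ _)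
      _ = _ := by ring

/-- The convolution of atoms of a given scale with an approximate identity. -/
theorem IsAtomFamily.exists_lowpass_bound (E : Type*) [NormedAddCommGroup E]
    [InnerProductSpace ℝ E] [FiniteDimensional ℝ E] [MeasurableSpace E] [BorelSpace E] :
    ∃ C : ℝ, 0 < C ∧ ∀ (ι : Type) [Fintype ι] (α : ℝ) (y : ι → E) (q : ι → ℤ) (b : ι → E → ℂ),
      IsAtomFamily α y q b → 0 ≤ α → ∀ (q₀ : ℤ) (I : Finset ι), (∀ i ∈ I, q i = q₀) →
      ∀ (c : ι → ℂ), (∀ i, ‖c i‖ ≤ 1) → ∀ τ : ℝ, 0 < τ →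
      ∫⁻ ξ in {ξ : E | τ * ‖ξ‖ ≤ 1}, ‖𝓕 (fun x => ∑ i ∈ I, c i * b i x) ξ‖ₑ ^ 2 ≤
        ENNReal.ofReal (C * α * ((τ / 2 ^ q₀)⁻¹ + ((τ / 2 ^ q₀) ^ Module.finrank ℝ E)⁻¹) *
          ∑ i ∈ I, ∫ z, ‖b i z‖) := by
  obtain ⟨C, hC, hψ⟩ := exists_lowpass E
  refine ⟨4 * (C * 2 ^ Module.finrank ℝ E), by positivity, ?_⟩
  intro ι _ α y q b hb hα q₀ I hI c hc τ hτ
  obtain ⟨ψ, hψs, hψz, hψ1, hψF, hψB, hψL⟩ := hψ τ hτ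
  set d := Module.finrank ℝ E with hd
  set r : ℝ := 2 ^ q₀ with hr
  have hr0 : 0 < r := by positivity
  set B : E → ℂ := fun x => ∑ i ∈ I, c i * b i x with hB
  have hBs : ContDiff ℝ (⊤ : ℕ∞) B :=
    ContDiff.sum fun i _ => contDiff_const.mul (hb.contDiff i)
  have hBc : HasCompactSupport B := by
    refine HasCompactSupport.intro (K := ⋃ i ∈ I, closedBall (y i) ((2 : ℝ) ^ q i))
      (I.isCompact_biUnion fun i _ => isCompact_closedBall _ _) fun x hx => ?_
    refine Finset.sum_eq_zero fun i hi => ?_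
    rw [hb.support i x fun h => hx (Set.mem_biUnion hi h), mul_zero]
  have hBi : Integrable B := hBs.continuous.integrable_of_hasCompactSupport hBc
  have hψc : HasCompactSupport ψ := HasCompactSupport.intro (isCompact_closedBall _ _) hψz
  have hψi : Integrable ψ := hψs.continuous.integrable_of_hasCompactSupport hψc
  set Λ : ℝ := (τ / r)⁻¹ + ((τ / r) ^ d)⁻¹ with hΛ
  have hsup : ∀ x, ‖conv ψ B x‖ ≤ C * 2 ^ d * α * Λ := by
    intro x
    have hint : ∀ i, Integrable fun z => ψ (x - z) * b i z := fun i =>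
      ((hψs.continuous.comp (by fun_prop)).mul (hb.contDiff i).continuous).integrable_of_hasCompactSupport
        ((hb.hasCompactSupport i).mul_left)
    have h1 : conv ψ B x = ∑ i ∈ I, c i * ∫ z, ψ (x - z) * b i z := by
      rw [conv_apply]
      simp_rw [hB, Finset.mul_sum, mul_left_comm _ (c _)]
      rw [integral_finsetSum _ fun i _ => (hint i).const_mul _]
      simp_rw [integral_const_mul]
    have hzero : ∀ i ∈ I, ¬ ‖y i - x‖ ≤ τ + r → ∫ z, ψ (x - z) * b i z = 0 := by
      intro i hi hx
      have : ∀ z, ψ (x - z) * b i z = 0 := by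
        intro z
        by_contra hne
        have h2 : x - z ∈ closedBall (0 : E) τ := by
          by_contra h; exact hne (by rw [hψz _ h, zero_mul])
        have h3 : z ∈ closedBall (y i) ((2 : ℝ) ^ q i) := by
          by_contra h; exact hne (by rw [hb.support i _ h, mul_zero])
        rw [hI i hi, mem_closedBall, dist_eq_norm] at h3
        rw [mem_closedBall, dist_zero_right] at h2
        refine hx ?_
        have : y i - x = -(x - z) - (z - y i) := by abel
        rw [this]
        refine (norm_sub_le _ _).trans ?_
        rw [norm_neg]
        linarith
      simp [this]
    have hb1 : ∀ i, ‖∫ z, ψ (x - z) * b i z‖ ≤ C * (τ ^ d)⁻¹ * ∫ z, ‖b i z‖ := by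
      intro i
      refine (norm_integral_le_integral_norm _).trans ?_
      rw [← integral_const_mul]
      refine integral_mono (hint i).norm ((hb.integrable i).norm.const_mul _) fun z => ?_
      rw [norm_mul]
      exact mul_le_mul_of_nonneg_right (hψB _) (norm_nonneg _)
    have hb2 : ∀ i ∈ I, ‖∫ z, ψ (x - z) * b i z‖ ≤ C * (τ ^ d)⁻¹ * (r / τ) * ∫ z, ‖b i z‖ := by
      intro i hi
      have e1 : ∫ z, ψ (x - z) * b i z = ∫ z, (ψ (x - z) - ψ (x - y i)) * b i z := by
        simp_rw [sub_mul]
        rw [integral_sub (hint i) ((hb.integrable i).const_mul _), integral_const_mul,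
          hb.mean_zero i, mul_zero, sub_zero]
      rw [e1]
      refine (norm_integral_le_integral_norm _).trans ?_
      rw [← integral_const_mul]
      refine integral_mono_of_nonneg (Eventually.of_forall fun z => norm_nonneg _)
        ((hb.integrable i).norm.const_mul _) (Eventually.of_forall fun z => ?_)
      simp only [norm_mul]
      by_cases hz : z ∈ closedBall (y i) ((2 : ℝ) ^ q i)
      · refine mul_le_mul_of_nonneg_right ((hψL _ _).trans ?_) (norm_nonneg _)
        rw [hI i hi, mem_closedBall, dist_eq_norm] at hz
        rw [sub_sub_sub_cancel_left, norm_sub_rev]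
        gcongr
      · rw [hb.support i z hz, norm_zero, mul_zero, mul_zero]
    have hsum : ∀ a : ℝ, 0 ≤ a → (∀ i ∈ I, ‖∫ z, ψ (x - z) * b i z‖ ≤ a * ∫ z, ‖b i z‖) →
        ‖conv ψ B x‖ ≤ a * (α * (τ + r) ^ d) := by
      intro a ha hab
      rw [h1]
      refine (norm_sum_le _ _).trans ?_
      calc ∑ i ∈ I, ‖c i * ∫ z, ψ (x - z) * b i z‖
          ≤ ∑ i ∈ I, if ((2 : ℝ) ^ q i ≤ τ + r ∧ ‖y i - x‖ ≤ τ + r) then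
              a * ∫ z, ‖b i z‖ else 0 := by
            refine Finset.sum_le_sum fun i hi => ?_
            rw [norm_mul]
            by_cases hx : ‖y i - x‖ ≤ τ + r
            · rw [if_pos ⟨by rw [hI i hi]; linarith, hx⟩]
              calc _ ≤ 1 * ‖∫ z, ψ (x - z) * b i z‖ := by gcongr; exact hc i
                _ ≤ _ := by rw [one_mul]; exact hab i hi
            · rw [hzero i hi hx, norm_zero, mul_zero, if_neg fun h => hx h.2]
        _ ≤ ∑ i, if ((2 : ℝ) ^ q i ≤ τ + r ∧ ‖y i - x‖ ≤ τ + r) then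
              a * ∫ z, ‖b i z‖ else 0 := by
            refine Finset.sum_le_sum_of_subset_of_nonneg (Finset.subset_univ _) fun i _ _ => ?_
            split_ifs
            · positivity
            · exact le_rfl
        _ = a * ∑ i with (2 : ℝ) ^ q i ≤ τ + r ∧ ‖y i - x‖ ≤ τ + r, ∫ z, ‖b i z‖ := by
            rw [← Finset.sum_filter, Finset.mul_sum]
        _ ≤ _ := by
            gcongr
            exact hb.packing x (τ + r) (by positivity)
    rcases le_total r τ with hrτ | hrτ
    · refine (hsum _ (by positivity) hb2).trans ?_
      have h2 : (τ + r) ^ d ≤ 2 ^ d * τ ^ d := by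
        rw [← mul_pow]; gcongr; linarith
      calc C * (τ ^ d)⁻¹ * (r / τ) * (α * (τ + r) ^ d)
          ≤ C * (τ ^ d)⁻¹ * (r / τ) * (α * (2 ^ d * τ ^ d)) := by gcongr
        _ = C * 2 ^ d * α * (τ / r)⁻¹ := by field_simp
        _ ≤ _ := by gcongr; rw [hΛ]; exact le_add_of_nonneg_right (by positivity)
    · refine (hsum _ (by positivity) fun i _ => hb1 i).trans ?_
      have h2 : (τ + r) ^ d ≤ 2 ^ d * r ^ d := by
        rw [← mul_pow]; gcongr; linarith
      calc C * (τ ^ d)⁻¹ * (α * (τ + r) ^ d)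
          ≤ C * (τ ^ d)⁻¹ * (α * (2 ^ d * r ^ d)) := by gcongr
        _ = C * 2 ^ d * α * ((τ / r) ^ d)⁻¹ := by rw [div_pow]; field_simp
        _ ≤ _ := by gcongr; rw [hΛ]; exact le_add_of_nonneg_left (by positivity)
  set M : ℝ := C * 2 ^ d * α * Λ with hM
  have hM0 : 0 ≤ M := by positivity
  have hB1 : ∫⁻ x, ‖B x‖ₑ ≤ ENNReal.ofReal (∑ i ∈ I, ∫ z, ‖b i z‖) := by
    rw [ENNReal.ofReal_sum_of_nonneg fun i _ => integral_nonneg fun _ => norm_nonneg _]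
    simp_rw [← hb.lintegral_enorm]
    rw [← lintegral_finsetSum _ fun i _ => (hb.contDiff i).continuous.enorm.measurable]
    refine lintegral_mono fun x => (enorm_sum_le _ _).trans (Finset.sum_le_sum fun i _ => ?_)
    rw [enorm_mul]
    refine mul_le_of_le_one_left' ?_
    rw [← ofReal_norm]
    exact ENNReal.ofReal_le_one.2 (hc i)
  have hψ1' : ∫⁻ x, ‖ψ x‖ₑ = 1 := by
    rw [← ofReal_integral_norm_eq_lintegral_enorm hψi, hψ1, ENNReal.ofReal_one]
  calc ∫⁻ ξ in {ξ : E | τ * ‖ξ‖ ≤ 1}, ‖𝓕 B ξ‖ₑ ^ 2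
      ≤ ∫⁻ ξ in {ξ : E | τ * ‖ξ‖ ≤ 1}, 4 * ‖𝓕 (conv ψ B) ξ‖ₑ ^ 2 := by
        refine setLIntegral_mono' (measurableSet_le (by fun_prop) measurable_const) fun ξ hξ => ?_
        rw [fourier_conv hψi hBi, enorm_mul, mul_pow, ← mul_assoc]
        refine le_mul_of_one_le_left' ?_
        have h3 := hψF ξ hξ
        rw [← ofReal_norm, ← ENNReal.ofReal_pow (norm_nonneg _),
          show (4 : ENNReal) = ENNReal.ofReal 4 by simp, ← ENNReal.ofReal_mul (by norm_num),
          ENNReal.one_le_ofReal]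
        nlinarith
    _ ≤ ∫⁻ ξ, 4 * ‖𝓕 (conv ψ B) ξ‖ₑ ^ 2 := setLIntegral_le_lintegral _ _
    _ = 4 * ∫⁻ x, ‖conv ψ B x‖ₑ ^ 2 := by
        rw [lintegral_const_mul' _ _ (by simp), lintegral_fourier_sq
          (contDiff_conv hψi.locallyIntegrable hBs hBc) (hasCompactSupport_conv hψc hBc)]
    _ ≤ 4 * ∫⁻ x, ENNReal.ofReal M * ‖conv ψ B x‖ₑ := by
        gcongr with x
        rw [sq]
        gcongr
        rw [← ofReal_norm]
        exact ENNReal.ofReal_le_ofReal (hsup x)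
    _ = 4 * (ENNReal.ofReal M * ∫⁻ x, ‖conv ψ B x‖ₑ) := by
        rw [lintegral_const_mul' _ _ (by simp)]
    _ ≤ 4 * (ENNReal.ofReal M * (1 * ENNReal.ofReal (∑ i ∈ I, ∫ z, ‖b i z‖))) := by
        gcongr
        refine (lintegral_enorm_conv_le hψs.continuous.measurable hBs.continuous.measurable).trans ?_
        rw [hψ1']
        gcongr
    _ = _ := by
        rw [one_mul, show (4 : ENNReal) = ENNReal.ofReal 4 by simp, ← ENNReal.ofReal_mul hM0,
          ← ENNReal.ofReal_mul (by norm_num)]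
        congr 1
        rw [hM]; ring

end LowPass

section Dyadic

/-- The weights in the almost orthogonality argument. -/
def dyadicWeight (N : ℕ) (k : ℤ) : ℝ := (3 / 2) ^ k.natAbs * min 1 (4 ^ (k * N))

theorem dyadicWeight_nonneg (N : ℕ) (k : ℤ) : 0 ≤ dyadicWeight N k := by
  unfold dyadicWeight; positivity

theorem summable_pow_natAbs {r : ℝ} (h0 : 0 ≤ r) (h1 : r < 1) :
    Summable fun k : ℤ => r ^ k.natAbs := by
  apply Summable.of_nat_of_neg <;> simpa using summable_geometric_of_lt_one h0 h1

theorem dyadicWeight_mul_le {N : ℕ} (hN : 1 ≤ N) {X : ℝ} (hX : 1 ≤ X) (k : ℤ) :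
    dyadicWeight N k * ((2 ^ k * X)⁻¹ + ((2 ^ k * X) ^ N)⁻¹) ≤ 2 * X⁻¹ * (3 / 4) ^ k.natAbs := by
  have hX0 : 0 < X := by linarith
  have hXN : (X ^ N)⁻¹ ≤ X⁻¹ := by
    gcongr
    exact le_self_pow₀ hX (by omega)
  unfold dyadicWeight
  obtain ⟨n, rfl | rfl⟩ := k.eq_nat_or_neg
  · have h1 : min (1 : ℝ) (4 ^ ((n : ℤ) * N)) ≤ 1 := min_le_left _ _
    have h2 : (((2 : ℝ) ^ n) ^ N)⁻¹ ≤ (2 ^ n)⁻¹ := by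
      gcongr
      exact le_self_pow₀ (one_le_pow₀ (by norm_num)) (by omega)
    rw [Int.natAbs_natCast, zpow_natCast, mul_pow, mul_inv, mul_inv]
    calc (3 / 2 : ℝ) ^ n * min 1 (4 ^ ((n : ℤ) * N)) * ((2 ^ n)⁻¹ * X⁻¹ + ((2 ^ n) ^ N)⁻¹ * (X ^ N)⁻¹)
        ≤ (3 / 2 : ℝ) ^ n * 1 * ((2 ^ n)⁻¹ * X⁻¹ + (2 ^ n)⁻¹ * X⁻¹) := by gcongr
      _ = 2 * X⁻¹ * ((3 / 2) ^ n * (2 ^ n)⁻¹) := by ring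
      _ = 2 * X⁻¹ * (3 / 4) ^ n := by
          rw [← inv_pow, ← mul_pow]; norm_num
  · have h1 : min (1 : ℝ) (4 ^ (-(n : ℤ) * N)) ≤ ((2 ^ n) ^ N)⁻¹ * ((2 ^ n) ^ N)⁻¹ := by
      refine (min_le_right _ _).trans (le_of_eq ?_)
      rw [← mul_inv, ← mul_pow, ← mul_pow, neg_mul, zpow_neg, zpow_mul, zpow_natCast, zpow_natCast]
      norm_num
    have h2 : ((2 : ℝ) ^ n) ≤ (2 ^ n) ^ N :=
      le_self_pow₀ (one_le_pow₀ (by norm_num)) (by omega)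
    have h3 : (((2 : ℝ) ^ n) ^ N)⁻¹ ≤ (2 ^ n)⁻¹ := by gcongr
    rw [Int.natAbs_neg, Int.natAbs_natCast, zpow_neg, zpow_natCast, mul_pow, mul_inv, mul_inv,
      inv_inv, inv_pow, inv_inv]
    calc (3 / 2 : ℝ) ^ n * min 1 (4 ^ (-(n : ℤ) * N)) * (2 ^ n * X⁻¹ + (2 ^ n) ^ N * (X ^ N)⁻¹)
        ≤ (3 / 2 : ℝ) ^ n * (((2 ^ n) ^ N)⁻¹ * ((2 ^ n) ^ N)⁻¹) *
          ((2 ^ n) ^ N * X⁻¹ + (2 ^ n) ^ N * X⁻¹) := by gcongr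
      _ = 2 * X⁻¹ * ((3 / 2) ^ n * ((2 ^ n) ^ N)⁻¹) := by field_simp; norm_num
      _ ≤ 2 * X⁻¹ * ((3 / 2) ^ n * (2 ^ n)⁻¹) := by gcongr
      _ = 2 * X⁻¹ * (3 / 4) ^ n := by
          rw [← inv_pow, ← mul_pow]; norm_num

/-- A sum over dyadic scales of factors decaying away from one scale is almost orthogonal. -/
theorem exists_sq_sum_dyadic_le (N : ℕ) {x : ℝ} (hx : 0 < x) :
    ∃ k₀ : ℤ, 2 ^ k₀ * x ≤ 1 ∧ ∀ (J : Finset ℤ) (C : ℝ) (κ B : ℤ → ℝ), 0 ≤ C →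
      (∀ j, 0 ≤ κ j) → (∀ j, κ j ≤ C) → (∀ j, κ j * (2 ^ j * x) ^ N ≤ C) →
      (∑ j ∈ J, κ j * B j) ^ 2 ≤ (∑' k : ℤ, (2 / 3 : ℝ) ^ k.natAbs) * (C ^ 2 * 4 ^ N) *
        ∑ j ∈ J, dyadicWeight N (k₀ - j) * B j ^ 2 := by
  obtain ⟨n, hn1, hn2⟩ := exists_mem_Ico_zpow hx (one_lt_two : (1 : ℝ) < 2)
  have hk1 : (2 : ℝ) ^ (-n - 1) * x ≤ 1 := by
    calc (2 : ℝ) ^ (-n - 1) * x ≤ 2 ^ (-n - 1) * 2 ^ (n + 1) := by gcongr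
      _ = 1 := by rw [← zpow_add₀ (by norm_num)]; simp
  have hk2 : 1 ≤ 2 * ((2 : ℝ) ^ (-n - 1) * x) := by
    calc (1 : ℝ) = 2 * (2 ^ (-n - 1) * 2 ^ n) := by
          rw [← zpow_add₀ (by norm_num), show -n - 1 + n = -1 by ring]; norm_num
      _ ≤ _ := by gcongr
  refine ⟨-n - 1, hk1, ?_⟩
  intro J C κ B hC hκ0 hκ1 hκN
  set k₀ := -n - 1
  have hκ : ∀ j, κ j ^ 2 ≤ C ^ 2 * 4 ^ N * min 1 (4 ^ ((k₀ - j) * N)) := by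
    intro j
    have h4 : (1 : ℝ) ≤ 4 ^ N := one_le_pow₀ (by norm_num)
    rcases min_cases (1 : ℝ) (4 ^ ((k₀ - j) * N)) with ⟨h, -⟩ | ⟨h, -⟩
    · rw [h, mul_one]
      calc κ j ^ 2 ≤ C ^ 2 := by have := hκ0 j; have := hκ1 j; gcongr
        _ ≤ C ^ 2 * 4 ^ N := le_mul_of_one_le_right (by positivity) h4
    · rw [h]
      have h5 : (1 : ℝ) ≤ 2 * (2 ^ (k₀ - j) * (2 ^ j * x)) := by
        rw [← mul_assoc (2 ^ (k₀ - j)), ← zpow_add₀ (by norm_num)]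
        simpa using hk2
      have h6 : κ j ≤ C * 2 ^ N * (2 ^ (k₀ - j)) ^ N := by
        calc κ j = κ j * 1 ^ N := by simp
          _ ≤ κ j * (2 * (2 ^ (k₀ - j) * (2 ^ j * x))) ^ N := by
            have := hκ0 j
            gcongr
          _ = κ j * (2 ^ j * x) ^ N * (2 ^ N * (2 ^ (k₀ - j)) ^ N) := by ring
          _ ≤ C * (2 ^ N * (2 ^ (k₀ - j)) ^ N) := by gcongr; exact hκN j
          _ = _ := by ring
      have h7 : ((4 : ℝ) ^ ((k₀ - j) * N)) = ((2 ^ (k₀ - j)) ^ N) ^ 2 := by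
        rw [show (4 : ℝ) = 2 ^ (2 : ℤ) by norm_num]
        simp only [← zpow_natCast, ← zpow_mul]
        congr 1
        push_cast
        ring
      calc κ j ^ 2 ≤ (C * 2 ^ N * (2 ^ (k₀ - j)) ^ N) ^ 2 := by have := hκ0 j; gcongr
        _ = C ^ 2 * (2 ^ N) ^ 2 * ((2 ^ (k₀ - j)) ^ N) ^ 2 := by ring
        _ = _ := by rw [h7, ← pow_mul, mul_comm N, pow_mul]; norm_num
  have hcs := Finset.sum_sq_le_sum_mul_sum_of_sq_le_mul J (r := fun j => κ j * B j)
    (f := fun j => (2 / 3 : ℝ) ^ (k₀ - j).natAbs)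
    (g := fun j => (3 / 2 : ℝ) ^ (k₀ - j).natAbs * (κ j ^ 2 * B j ^ 2))
    (fun j _ => by positivity) (fun j _ => by positivity) (fun j _ => by
      rw [← mul_assoc, ← mul_pow]; norm_num [mul_pow])
  refine hcs.trans ?_
  have hW : ∑ j ∈ J, (2 / 3 : ℝ) ^ (k₀ - j).natAbs ≤ ∑' k : ℤ, (2 / 3 : ℝ) ^ k.natAbs := by
    have hs := summable_pow_natAbs (r := 2 / 3) (by norm_num) (by norm_num)
    have : ∑ j ∈ J, (2 / 3 : ℝ) ^ (k₀ - j).natAbs =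
        ∑ k ∈ J.map (Equiv.subLeft k₀).toEmbedding, (2 / 3 : ℝ) ^ k.natAbs := by
      rw [Finset.sum_map]; rfl
    rw [this]
    exact hs.sum_le_tsum _ fun k _ => by positivity
  rw [mul_assoc]
  refine mul_le_mul hW ?_ (Finset.sum_nonneg fun j _ => by positivity)
    (tsum_nonneg fun k => by positivity)
  rw [Finset.mul_sum]
  refine Finset.sum_le_sum fun j _ => ?_
  unfold dyadicWeight
  calc (3 / 2 : ℝ) ^ (k₀ - j).natAbs * (κ j ^ 2 * B j ^ 2)
      ≤ (3 / 2 : ℝ) ^ (k₀ - j).natAbs *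
        (C ^ 2 * 4 ^ N * min 1 (4 ^ ((k₀ - j) * N)) * B j ^ 2) := by gcongr; exact hκ j
    _ = _ := by ring

theorem enorm_sum_sq_le {ι F : Type*} [SeminormedAddCommGroup F] (s : Finset ι) (f : ι → F) :
    ‖∑ i ∈ s, f i‖ₑ ^ 2 ≤ s.card * ∑ i ∈ s, ‖f i‖ₑ ^ 2 := by
  have h1 : ‖∑ i ∈ s, f i‖₊ ^ 2 ≤ s.card * ∑ i ∈ s, ‖f i‖₊ ^ 2 :=
    (pow_le_pow_left₀ zero_le (nnnorm_sum_le _ _) 2).trans sq_sum_le_card_mul_sum_sq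
  simp only [enorm_eq_nnnorm]
  exact_mod_cast h1

end Dyadic

section LTwo
open FourierTransform Real
variable {E : Type*} [NormedAddCommGroup E] [InnerProductSpace ℝ E] [FiniteDimensional ℝ E]
  [MeasurableSpace E] [BorelSpace E]

theorem continuous_fourier_of_contDiff {f : E → ℂ} (hf : ContDiff ℝ (⊤ : ℕ∞) f)
    (hfs : HasCompactSupport f) : Continuous (𝓕 f) :=
  (𝓕 (hfs.toSchwartzMap hf) : SchwartzMap E ℂ).continuous

theorem fourier_sum_mul {ι : Type*} (I : Finset ι) (c : ι → ℂ) {f : ι → E → ℂ}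
    (hf : ∀ i ∈ I, Integrable (f i)) (ξ : E) :
    𝓕 (fun x => ∑ i ∈ I, c i * f i x) ξ = ∑ i ∈ I, c i * 𝓕 (f i) ξ := by
  simp only [fourier_eq', smul_eq_mul, Finset.mul_sum]
  rw [integral_finsetSum]
  · refine Finset.sum_congr rfl fun i _ => ?_
    rw [← integral_const_mul]
    congr 1; ext x; ring
  · intro i hi
    refine (((hf i hi).const_mul (c i)).bdd_mul (c := 1) ?_ ?_)
    · exact Continuous.aestronglyMeasurable (by fun_prop)
    · exact Eventually.of_forall fun z => by rw [Complex.norm_exp_ofReal_mul_I]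

/-- The frequencies at which an elementary kernel oscillates. -/
theorem IsAtomFamily.exists_bad_bound (E : Type*) [NormedAddCommGroup E]
    [InnerProductSpace ℝ E] [FiniteDimensional ℝ E] [MeasurableSpace E] [BorelSpace E]
    [Nontrivial E] :
    ∃ C : ℝ, 0 < C ∧ ∀ (ι : Type) [Fintype ι] (α : ℝ) (y : ι → E) (q : ι → ℤ) (b : ι → E → ℂ),
      IsAtomFamily α y q b → 0 ≤ α →
      ∀ (V : Finset E) (h ρ : ℝ) (Ω : E → ℝ) (M ω : ℝ) (s : ℤ) (m : ℕ) (v : E),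
      0 < h → h ≤ 1 → 2 * h ≤ ρ → 1 ≤ 2 ^ s * h * ρ → Measurable Ω → (∀ z, |Ω z| ≤ M) →
      (∀ r : ℝ, 0 < r → ∀ z : E, z ≠ 0 → Ω (r • z) = Ω z) →
      (∫ θ : sphere (0 : E) 1, |Ω θ| ∂(volume : Measure E).toSphere) ≤ ω →
      1 ≤ m → v ∈ V → ∀ c : ι → ℂ, (∀ i, ‖c i‖ ≤ 1) →
      ∫⁻ ξ in {ξ | ρ * ‖ξ‖ < |inner ℝ v ξ|},
        ‖∑ i, c i * (𝓕 (fun z => (kern V h Ω (2 ^ (q i + s)) m v z : ℂ)) ξ * 𝓕 (b i) ξ)‖ₑ ^ 2 ≤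
        ENNReal.ofReal (C * ω ^ 2 * (2 ^ s * h * ρ)⁻¹ * α * ∑ i, ∫ z, ‖b i z‖) := by
  classical
  set d := Module.finrank ℝ E with hd
  have hd1 : 1 ≤ d := Module.finrank_pos
  obtain ⟨C₁, hC₁, hK⟩ := exists_fourier_kern_bound (E := E) d
  obtain ⟨C₂, hC₂, hL⟩ := IsAtomFamily.exists_lowpass_bound E
  set W : ℝ := ∑' k : ℤ, (2 / 3 : ℝ) ^ k.natAbs with hW
  set W' : ℝ := ∑' k : ℤ, (3 / 4 : ℝ) ^ k.natAbs with hW'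
  have hs' := summable_pow_natAbs (r := 3 / 4) (by norm_num) (by norm_num)
  have hWp : 0 < W := (summable_pow_natAbs (r := 2 / 3) (by norm_num) (by norm_num)).tsum_pos
    (fun k => by positivity) 0 (by simp)
  have hW'p : 0 < W' := hs'.tsum_pos (fun k => by positivity) 0 (by simp)
  refine ⟨W * (C₁ ^ 2 * 4 ^ d) * (C₂ * 2 * W'), by positivity, ?_⟩
  intro ι _ α y q b hb hα V h ρ Ω M ω s m v hh hh1 hρ hX hΩ hM hhom hω hm hv c hc
  have hω0 : 0 ≤ ω := le_trans (integral_nonneg fun θ => abs_nonneg _) hω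
  set X : ℝ := 2 ^ s * h * ρ with hXdef
  have hX0 : 0 < X := by linarith
  let k : ℤ → E → ℂ := fun j => 𝓕 (fun z => (kern V h Ω (2 ^ (j + s)) m v z : ℂ))
  let J : Finset ℤ := Finset.univ.image q
  let I : ℤ → Finset ι := fun j => Finset.univ.filter fun i => q i = j
  let B : ℤ → E → ℂ := fun j x => ∑ i ∈ I j, c i * b i x
  let S : ℤ → ℝ := fun j => ∑ i ∈ I j, ∫ z, ‖b i z‖
  have hBcont : ∀ j, Continuous (𝓕 (B j)) := by
    intro j
    refine continuous_fourier_of_contDiff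
      (ContDiff.sum fun i _ => contDiff_const.mul (hb.contDiff i)) ?_
    refine HasCompactSupport.intro (K := ⋃ i ∈ I j, closedBall (y i) ((2 : ℝ) ^ q i))
      ((I j).isCompact_biUnion fun i _ => isCompact_closedBall _ _) fun x hx => ?_
    refine Finset.sum_eq_zero fun i hi => ?_
    rw [hb.support i x fun h => hx (Set.mem_biUnion hi h), mul_zero]
  have hsum : ∀ ξ, ∑ i, c i * (k (q i) ξ * 𝓕 (b i) ξ) = ∑ j ∈ J, k j ξ * 𝓕 (B j) ξ := by
    intro ξ
    rw [← Finset.sum_fiberwise_of_maps_to (t := J) (g := q)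
      (fun i hi => Finset.mem_image_of_mem q hi)]
    refine Finset.sum_congr rfl fun j _ => ?_
    rw [fourier_sum_mul _ _ (fun i _ => hb.integrable i), Finset.mul_sum]
    refine Finset.sum_congr rfl fun i hi => ?_
    rw [(Finset.mem_filter.1 hi).2]
    ring
  set A : ℝ := W * ((C₁ * ω) ^ 2 * 4 ^ d) with hA
  have hA0 : 0 ≤ A := by positivity
  let T : ℤ → ℤ → Set E := fun j l => {ξ : E | 2 ^ l * (2 ^ j * X) * ‖ξ‖ ≤ 1}
  have hTm : ∀ j l, MeasurableSet (T j l) := fun j l =>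
    measurableSet_le (by fun_prop) measurable_const
  have hpt : ∀ ξ ∈ {ξ : E | ρ * ‖ξ‖ < |inner ℝ v ξ|},
      ‖∑ i, c i * (k (q i) ξ * 𝓕 (b i) ξ)‖ₑ ^ 2 ≤
      ENNReal.ofReal A * ∑ j ∈ J, ∑' l : ℤ, ENNReal.ofReal (dyadicWeight d l) *
        (T j l).indicator (fun ξ => ‖𝓕 (B j) ξ‖ₑ ^ 2) ξ := by
    intro ξ hξ
    rw [Set.mem_ofPred_eq] at hξ
    have hξ0 : ξ ≠ 0 := by rintro rfl; simp at hξ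
    have hx : 0 < X * ‖ξ‖ := mul_pos hX0 (norm_pos_iff.2 hξ0)
    obtain ⟨k₀, hk₀, hcs⟩ := exists_sq_sum_dyadic_le d hx
    have hkb : ∀ j, ‖k j ξ‖ ≤ C₁ * ω ∧ ‖k j ξ‖ * (2 ^ j * (X * ‖ξ‖)) ^ d ≤ C₁ * ω := by
      intro j
      obtain ⟨h1, h2⟩ := hK V h ρ Ω M ω (2 ^ (j + s)) m v ξ hh hh1 hρ hΩ hM hhom hω
        (by positivity) hm hv
      refine ⟨h1, ?_⟩
      have h3 := h2 hξ
      have : (2 : ℝ) ^ (j + s) * h * ρ * ‖ξ‖ = 2 ^ j * (X * ‖ξ‖) := by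
        rw [zpow_add₀ (by norm_num), hXdef]; ring
      rwa [this] at h3
    have h4 := hcs J (C₁ * ω) (fun j => ‖k j ξ‖) (fun j => ‖𝓕 (B j) ξ‖) (by positivity)
      (fun j => norm_nonneg _) (fun j => (hkb j).1) (fun j => (hkb j).2)
    have h5 : ‖∑ i, c i * (k (q i) ξ * 𝓕 (b i) ξ)‖ ^ 2 ≤
        A * ∑ j ∈ J, dyadicWeight d (k₀ - j) * ‖𝓕 (B j) ξ‖ ^ 2 := by
      refine le_trans ?_ h4
      rw [hsum]
      gcongr
      refine (norm_sum_le _ _).trans (Finset.sum_le_sum fun j _ => ?_)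
      rw [norm_mul]
    rw [← ofReal_norm, ← ENNReal.ofReal_pow (norm_nonneg _)]
    refine (ENNReal.ofReal_le_ofReal h5).trans ?_
    have hw0 := dyadicWeight_nonneg d
    rw [ENNReal.ofReal_mul hA0, ENNReal.ofReal_sum_of_nonneg
      fun j _ => mul_nonneg (hw0 _) (by positivity)]
    gcongr with j hj
    refine le_trans (le_of_eq ?_) (ENNReal.le_tsum (k₀ - j))
    rw [Set.indicator_of_mem, ENNReal.ofReal_mul (hw0 _), ENNReal.ofReal_pow (norm_nonneg _),
      ofReal_norm]
    show 2 ^ (k₀ - j) * (2 ^ j * X) * ‖ξ‖ ≤ 1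
    rw [← mul_assoc, ← zpow_add₀ (by norm_num), sub_add_cancel, mul_assoc]
    exact hk₀
  have hS0 : ∀ j, 0 ≤ S j := fun j => Finset.sum_nonneg fun i _ => integral_nonneg fun _ =>
    norm_nonneg _
  have hmeasI : ∀ j l, Measurable fun ξ => (T j l).indicator (fun ξ => ‖𝓕 (B j) ξ‖ₑ ^ 2) ξ :=
    fun j l => ((hBcont j).enorm.measurable.pow_const 2).indicator (hTm j l)
  have hmeasT : ∀ j, Measurable fun ξ => ∑' l : ℤ, ENNReal.ofReal (dyadicWeight d l) *
        (T j l).indicator (fun ξ => ‖𝓕 (B j) ξ‖ₑ ^ 2) ξ :=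
    fun j => Measurable.tsum fun l => (hmeasI j l).const_mul _
  have hscale : ∀ j, ∫⁻ ξ, ∑' l : ℤ, ENNReal.ofReal (dyadicWeight d l) *
        (T j l).indicator (fun ξ => ‖𝓕 (B j) ξ‖ₑ ^ 2) ξ ≤
      ENNReal.ofReal (C₂ * 2 * W' * X⁻¹ * α * S j) := by
    intro j
    rw [lintegral_tsum fun l => ((hmeasI j l).const_mul _).aemeasurable]
    have hterm : ∀ l : ℤ, ∫⁻ ξ, ENNReal.ofReal (dyadicWeight d l) *
        (T j l).indicator (fun ξ => ‖𝓕 (B j) ξ‖ₑ ^ 2) ξ ≤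
        ENNReal.ofReal (C₂ * 2 * X⁻¹ * α * S j * (3 / 4) ^ l.natAbs) := by
      intro l
      rw [lintegral_const_mul _ (hmeasI j l), lintegral_indicator (hTm j l)]
      have h1 := hL ι α y q b hb hα j (I j) (fun i hi => (Finset.mem_filter.1 hi).2) c hc
        (2 ^ l * (2 ^ j * X)) (by positivity)
      refine (mul_le_mul_right h1 _).trans ?_
      rw [← ENNReal.ofReal_mul (dyadicWeight_nonneg _ _)]
      refine ENNReal.ofReal_le_ofReal ?_
      have h2 : (2 : ℝ) ^ l * (2 ^ j * X) / 2 ^ j = 2 ^ l * X := by field_simp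
      rw [h2]
      calc dyadicWeight d l * (C₂ * α * ((2 ^ l * X)⁻¹ + ((2 ^ l * X) ^ d)⁻¹) * S j)
          = C₂ * α * (dyadicWeight d l * ((2 ^ l * X)⁻¹ + ((2 ^ l * X) ^ d)⁻¹)) * S j := by ring
        _ ≤ C₂ * α * (2 * X⁻¹ * (3 / 4) ^ l.natAbs) * S j := by
            refine mul_le_mul_of_nonneg_right (mul_le_mul_of_nonneg_left ?_ (by positivity)) (hS0 j)
            exact dyadicWeight_mul_le hd1 hX l
        _ = _ := by ring
    refine (ENNReal.tsum_le_tsum hterm).trans ?_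
    rw [← ENNReal.ofReal_tsum_of_nonneg (fun l => by have := hS0 j; positivity)
      (hs'.mul_left _), tsum_mul_left]
    refine ENNReal.ofReal_le_ofReal (le_of_eq ?_)
    rw [← hW']; ring
  calc _ ≤ ∫⁻ ξ in {ξ : E | ρ * ‖ξ‖ < |inner ℝ v ξ|},
        ENNReal.ofReal A * ∑ j ∈ J, ∑' l : ℤ, ENNReal.ofReal (dyadicWeight d l) *
        (T j l).indicator (fun ξ => ‖𝓕 (B j) ξ‖ₑ ^ 2) ξ :=
      setLIntegral_mono' (measurableSet_lt (by fun_prop) (by fun_prop)) hpt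
    _ ≤ ∫⁻ ξ, ENNReal.ofReal A * ∑ j ∈ J, ∑' l : ℤ, ENNReal.ofReal (dyadicWeight d l) *
        (T j l).indicator (fun ξ => ‖𝓕 (B j) ξ‖ₑ ^ 2) ξ := setLIntegral_le_lintegral _ _
    _ = ENNReal.ofReal A * ∑ j ∈ J, ∫⁻ ξ, ∑' l : ℤ, ENNReal.ofReal (dyadicWeight d l) *
        (T j l).indicator (fun ξ => ‖𝓕 (B j) ξ‖ₑ ^ 2) ξ := by
      rw [lintegral_const_mul' _ _ (by simp), lintegral_finsetSum _ fun j _ => hmeasT j]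
    _ ≤ ENNReal.ofReal A * ∑ j ∈ J, ENNReal.ofReal (C₂ * 2 * W' * X⁻¹ * α * S j) := by
      gcongr with j; exact hscale j
    _ = _ := by
      rw [← ENNReal.ofReal_sum_of_nonneg (fun j _ => by have := hS0 j; positivity),
        ← ENNReal.ofReal_mul hA0, ← Finset.mul_sum]
      have : ∑ j ∈ J, S j = ∑ i, ∫ z, ‖b i z‖ :=
        Finset.sum_fiberwise_of_maps_to (fun i hi => Finset.mem_image_of_mem q hi) _
      rw [this, hA]
      congr 1
      ring

end LTwo

section Directions
open FourierTransform Real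
variable {E : Type*} [NormedAddCommGroup E] [InnerProductSpace ℝ E] [FiniteDimensional ℝ E]
  [MeasurableSpace E] [BorelSpace E] [Nontrivial E]

theorem sum_enorm_kern_le {V : Finset E} {h Q : ℝ} (hh : 0 < h) {Ω : E → ℝ} {M : ℝ}
    (hM : ∀ z, |Ω z| ≤ M) {D : ℝ} (hD : 0 < D) {m₀ m₁ : ℕ} (hm : m₀ ≤ m₁) (hm₀ : 1 ≤ 4 * h * m₀)
    (hm₁ : h * (m₁ + 1) ≤ Q) {v : E} (hv : v ∈ V) (z : E) :
    ∑ m ∈ Finset.Ico m₀ m₁, ‖(kern V h Ω D m v z : ℂ)‖ₑ ≤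
      ENNReal.ofReal (4 ^ Module.finrank ℝ E * M) * coneKer v h Q D z := by
  set d := Module.finrank ℝ E with hd
  have hM0 : 0 ≤ M := (abs_nonneg _).trans (hM z)
  by_cases hz : z ∈ cap v h
  swap
  · refine (Finset.sum_eq_zero fun m _ => ?_).le.trans zero_le
    simp [kern, capPart_eq_zero hz]
  by_cases hex : ∃ m ∈ Finset.Ico m₀ m₁, stepBump (‖z‖ / (D * h) - m) ≠ 0
  swap
  · push Not at hex
    refine (Finset.sum_eq_zero fun m hm => ?_).le.trans zero_le
    simp [kern, hex m hm]
  obtain ⟨m, hm', hne⟩ := hex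
  obtain ⟨h1, h2⟩ := stepBump_ne_zero_bounds hD hh hne
  rw [Finset.mem_Ico] at hm'
  have hm0 : (m₀ : ℝ) ≤ m := by exact_mod_cast hm'.1
  have hm1 : (m : ℝ) + 1 ≤ m₁ := by exact_mod_cast hm'.2
  have hDh : 0 < D * h := by positivity
  have hzl : D / 4 ≤ ‖z‖ := by
    have : D * h * m₀ ≤ D * h * m := by gcongr
    nlinarith
  have hzu : ‖z‖ ≤ Q * D := by
    have : D * h * (m + 2) ≤ D * h * (m₁ + 1) := by
      apply mul_le_mul_of_nonneg_left _ hDh.le; linarith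
    nlinarith
  have hzc : z ∈ cap v h ∩ closedBall 0 (Q * D) := ⟨hz, by rwa [mem_closedBall, dist_zero_right]⟩
  rw [coneKer, Set.indicator_of_mem hzc, ← ENNReal.ofReal_mul (by positivity)]
  have hterm : ∀ m ∈ Finset.Ico m₀ m₁, ‖(kern V h Ω D m v z : ℂ)‖ₑ ≤
      ENNReal.ofReal (4 ^ d * M * (D ^ d)⁻¹ * stepBump (‖z‖ / (D * h) - m)) := by
    intro m _
    rw [← ofReal_norm, Complex.norm_real]
    refine ENNReal.ofReal_le_ofReal ?_
    rw [kern, Real.norm_eq_abs, abs_mul, abs_mul, abs_mul, abs_of_nonneg (stepBump_nonneg _),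
      abs_of_nonneg (capPart_nonneg _ _ _ _), abs_of_nonneg (by positivity)]
    have h4 : (‖z‖ ^ (d - 1))⁻¹ ≤ ((D / 4) ^ (d - 1))⁻¹ := by gcongr
    have hd1 : 1 ≤ d := Module.finrank_pos
    have h5 : D⁻¹ * ((D / 4) ^ (d - 1))⁻¹ ≤ 4 ^ d * (D ^ d)⁻¹ := by
      obtain ⟨k, hk⟩ : ∃ k, d = k + 1 := ⟨d - 1, by omega⟩
      rw [hk, Nat.add_sub_cancel, div_pow, inv_div, pow_succ, pow_succ, mul_inv]
      have : 0 ≤ 4 ^ k * (D ^ k)⁻¹ * D⁻¹ := by positivity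
      calc D⁻¹ * (4 ^ k / D ^ k) = 4 ^ k * (D ^ k)⁻¹ * D⁻¹ := by ring
        _ ≤ 4 * (4 ^ k * (D ^ k)⁻¹ * D⁻¹) := by linarith
        _ = _ := by ring
    calc _ ≤ 4 ^ d * (D ^ d)⁻¹ * M * stepBump (‖z‖ / (D * h) - m) * 1 := by
          refine mul_le_mul (mul_le_mul_of_nonneg_right ?_ (stepBump_nonneg _))
            (capPart_le_one h hv z) (capPart_nonneg _ _ _ _)
            (mul_nonneg (by positivity) (stepBump_nonneg _))
          refine mul_le_mul ?_ (hM z) (abs_nonneg _) (by positivity)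
          exact (mul_le_mul_of_nonneg_left h4 (by positivity)).trans h5
      _ = _ := by ring
  refine (Finset.sum_le_sum hterm).trans ?_
  rw [← ENNReal.ofReal_sum_of_nonneg fun m _ => mul_nonneg (by positivity) (stepBump_nonneg _),
    ← Finset.mul_sum]
  refine ENNReal.ofReal_le_ofReal ?_
  exact mul_le_of_le_one_right (by positivity) (sum_stepBump_le_one hm _)

/-- The part of the approximating operator in the direction `v`, applied to the atoms `b i`. -/
def dirPart {ι : Type*} [Fintype ι] (q : ι → ℤ) (b : ι → E → ℂ) (V : Finset E) (h : ℝ) (Ω : E → ℝ)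
    (s : ℤ) (I : Finset ℕ) (c : ι → ℕ → E → ℂ) (v x : E) : ℂ :=
  ∑ p ∈ Finset.univ ×ˢ I, c p.1 p.2 v *
    conv (fun z => (kern V h Ω (2 ^ (q p.1 + s)) p.2 v z : ℂ)) (b p.1) x

section
variable {ι : Type*} [Fintype ι] {α : ℝ} {y : ι → E} {q : ι → ℤ} {b : ι → E → ℂ} {V : Finset E}
  {h : ℝ} {Ω : E → ℝ} {M : ℝ} {v : E} {I : Finset ℕ}

theorem hasCompactSupport_kern (hh : 0 < h)
    (hM : ∀ z, |Ω z| ≤ M) {D : ℝ} (hD : 0 < D) {m : ℕ} (hm : 1 ≤ m) (hv : v ∈ V) :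
    HasCompactSupport (fun z => (kern V h Ω D m v z : ℂ)) := by
  refine HasCompactSupport.intro (isCompact_closedBall (0 : E) (D * h * (m + 2))) fun z hz => ?_
  have := abs_kern_le hh hM hD hm hv z
  rw [Set.indicator_of_notMem hz] at this
  simpa using this

theorem hasCompactSupport_finset_sum {X κ : Type*} [TopologicalSpace X] [R1Space X] (s : Finset κ)
    {f : κ → X → ℂ}
    (hf : ∀ i ∈ s, HasCompactSupport (f i)) : HasCompactSupport fun x => ∑ i ∈ s, f i x := by
  classical
  induction s using Finset.induction_on with
  | empty => simp only [Finset.sum_empty]; exact HasCompactSupport.zero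
  | insert a s ha ih =>
    simp only [Finset.sum_insert ha]
    exact (hf a (Finset.mem_insert_self _ _)).add
      (ih fun i hi => hf i (Finset.mem_insert_of_mem hi))

theorem IsAtomFamily.conv_kern (hb : IsAtomFamily α y q b) (hh : 0 < h) (hΩ : Measurable Ω)
    (hM : ∀ z, |Ω z| ≤ M) (hv : v ∈ V) {m : ℕ} (hm : 1 ≤ m) (s : ℤ) (i : ι) :
    ContDiff ℝ (⊤ : ℕ∞) (conv (fun z => (kern V h Ω (2 ^ (q i + s)) m v z : ℂ)) (b i)) ∧
    HasCompactSupport (conv (fun z => (kern V h Ω (2 ^ (q i + s)) m v z : ℂ)) (b i)) :=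
  ⟨contDiff_conv (integrable_kern hh hΩ hM (by positivity) hm hv).locallyIntegrable
    (hb.contDiff i) (hb.hasCompactSupport i),
   hasCompactSupport_conv (hasCompactSupport_kern hh hM (by positivity) hm hv)
    (hb.hasCompactSupport i)⟩

theorem IsAtomFamily.dirPart_smooth (hb : IsAtomFamily α y q b) (hh : 0 < h) (hΩ : Measurable Ω)
    (hM : ∀ z, |Ω z| ≤ M) (hv : v ∈ V) (hI : ∀ m ∈ I, 1 ≤ m) (s : ℤ) (c : ι → ℕ → E → ℂ) :
    ContDiff ℝ (⊤ : ℕ∞) (dirPart q b V h Ω s I c v) ∧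
    HasCompactSupport (dirPart q b V h Ω s I c v) := by
  have hp : ∀ p ∈ Finset.univ ×ˢ I, _ := fun (p : ι × ℕ) hp =>
    hb.conv_kern hh hΩ hM hv (hI p.2 (Finset.mem_product.1 hp).2) s p.1
  constructor
  · exact ContDiff.sum fun p hp' => contDiff_const.mul (hp p hp').1
  · exact hasCompactSupport_finset_sum _ fun p hp' => (hp p hp').2.mul_left

theorem IsAtomFamily.fourier_dirPart (hb : IsAtomFamily α y q b) (hh : 0 < h) (hΩ : Measurable Ω)
    (hM : ∀ z, |Ω z| ≤ M) (hv : v ∈ V) (hI : ∀ m ∈ I, 1 ≤ m) (s : ℤ) (c : ι → ℕ → E → ℂ) (ξ : E) :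
    𝓕 (dirPart q b V h Ω s I c v) ξ = ∑ m ∈ I, ∑ i, c i m v *
      (𝓕 (fun z => (kern V h Ω (2 ^ (q i + s)) m v z : ℂ)) ξ * 𝓕 (b i) ξ) := by
  have hp : ∀ p ∈ Finset.univ ×ˢ I, _ := fun (p : ι × ℕ) hp =>
    hb.conv_kern hh hΩ hM hv (hI p.2 (Finset.mem_product.1 hp).2) s p.1
  unfold dirPart
  rw [fourier_sum_mul _ _ fun p hp' => (hp p hp').1.continuous.integrable_of_hasCompactSupport
    (hp p hp').2, Finset.sum_product_right]
  refine Finset.sum_congr rfl fun m hm => Finset.sum_congr rfl fun i _ => ?_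
  rw [fourier_conv (integrable_kern hh hΩ hM (by positivity) (hI m hm) hv) (hb.integrable i)]

theorem IsAtomFamily.enorm_dirPart_le (hb : IsAtomFamily α y q b) {Q : ℝ} (hh : 0 < h)
    (hΩ : Measurable Ω) (hM : ∀ z, |Ω z| ≤ M) (hv : v ∈ V) {m₀ m₁ : ℕ} (hm : m₀ ≤ m₁)
    (hm₀ : 1 ≤ 4 * h * m₀) (hm₁ : h * (m₁ + 1) ≤ Q) (s : ℤ) {c : ι → ℕ → E → ℂ}
    (hc : ∀ i m, ‖c i m v‖ ≤ 1) (x : E) :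
    ‖dirPart q b V h Ω s (Finset.Ico m₀ m₁) c v x‖ₑ ≤
      ENNReal.ofReal (4 ^ Module.finrank ℝ E * M) *
        ∑ i, ∫⁻ z, coneKer v h Q ((2 : ℝ) ^ (q i + s)) (x - z) * ‖b i z‖ₑ := by
  have hkm : ∀ i m, Measurable fun z =>
      ‖(kern V h Ω (2 ^ (q i + s)) m v (x - z) : ℂ)‖ₑ * ‖b i z‖ₑ := fun i m =>
    (Complex.measurable_ofReal.comp ((measurable_kern V h hΩ (2 ^ (q i + s)) m v).comp
      (measurable_const.sub measurable_id))).enorm.mul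
      (hb.contDiff i).continuous.measurable.enorm
  calc _ ≤ ∑ p ∈ Finset.univ ×ˢ Finset.Ico m₀ m₁,
        ∫⁻ z, ‖(kern V h Ω (2 ^ (q p.1 + s)) p.2 v (x - z) : ℂ)‖ₑ * ‖b p.1 z‖ₑ := by
        refine (enorm_sum_le _ _).trans (Finset.sum_le_sum fun p _ => ?_)
        rw [enorm_mul]
        have h1 : ‖c p.1 p.2 v‖ₑ ≤ 1 := by
          rw [← ofReal_norm, ← ENNReal.ofReal_one]; exact ENNReal.ofReal_le_ofReal (hc _ _)
        exact (mul_le_mul' h1 (enorm_conv_le _ _ _)).trans (one_mul _).le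
    _ = ∑ i, ∫⁻ z, (∑ m ∈ Finset.Ico m₀ m₁, ‖(kern V h Ω (2 ^ (q i + s)) m v (x - z) : ℂ)‖ₑ) *
          ‖b i z‖ₑ := by
        rw [Finset.sum_product]
        refine Finset.sum_congr rfl fun i _ => ?_
        rw [← lintegral_finsetSum _ fun m _ => hkm i m]
        simp only [Finset.sum_mul]
    _ ≤ ∑ i, ∫⁻ z, ENNReal.ofReal (4 ^ Module.finrank ℝ E * M) *
          (coneKer v h Q ((2 : ℝ) ^ (q i + s)) (x - z) * ‖b i z‖ₑ) := by
        refine Finset.sum_le_sum fun i _ => lintegral_mono fun z => ?_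
        dsimp only
        rw [← mul_assoc]
        exact mul_le_mul_left (sum_enorm_kern_le hh hM (by positivity) hm hm₀ hm₁ hv _) _
    _ = _ := by
        rw [Finset.mul_sum]
        refine Finset.sum_congr rfl fun i _ => ?_
        rw [lintegral_const_mul' _ _ ENNReal.ofReal_ne_top]

end

end Directions

section SumDirections
open FourierTransform Real
variable {E : Type*} [NormedAddCommGroup E] [InnerProductSpace ℝ E] [FiniteDimensional ℝ E]
  [MeasurableSpace E] [BorelSpace E] [Nontrivial E]

/-- Almost orthogonality of the directions. -/
theorem lintegral_sq_sum_directions_le {h ρ : ℝ} (hh : 0 < h) (hhρ : h ≤ ρ) (hρ : ρ ≤ 1)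
    (V : Finset E) (hV : ∀ v ∈ V, ‖v‖ = 1)
    (hsep : ∀ v ∈ V, ∀ w ∈ V, v ≠ w → h / 2 ≤ dist v w) {g : E → E → ℂ}
    (hg : ∀ v ∈ V, ContDiff ℝ (⊤ : ℕ∞) (g v)) (hgs : ∀ v ∈ V, HasCompactSupport (g v)) {a c : ℝ}
    (ha : 0 ≤ a) (hc : 0 ≤ c)
    (hgood : ∀ v ∈ V, ∫⁻ x, ‖g v x‖ₑ ^ 2 ≤ ENNReal.ofReal a)
    (hbad : ∀ v ∈ V, ∫⁻ ξ in {ξ | ρ * ‖ξ‖ < |inner ℝ v ξ|}, ‖𝓕 (g v) ξ‖ₑ ^ 2 ≤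
      ENNReal.ofReal c) :
    ∫⁻ x, ‖∑ v ∈ V, g v x‖ₑ ^ 2 ≤ ENNReal.ofReal (2 * (52 ^ Module.finrank ℝ E) ^ 2 *
      (ρ * (h * (h ^ Module.finrank ℝ E)⁻¹) ^ 2 * a + (h * (h ^ Module.finrank ℝ E)⁻¹) ^ 2 * c)) := by
  classical
  set d := Module.finrank ℝ E with hd
  set H : ℝ := 52 ^ d * (h * (h ^ d)⁻¹) with hH
  have hρ0 : 0 < ρ := hh.trans_le hhρ
  have hH0 : 0 < H := by positivity
  have hcard : ∀ W ⊆ V, ∀ r : ℝ, h ≤ r → r ≤ 1 → (∃ u : E, ‖u‖ = 1 ∧ ∀ v ∈ W, |inner ℝ v u| ≤ r) →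
      (W.card : ENNReal) ≤ ENNReal.ofReal (r * H) := by
    rintro W hW r hr hr1 ⟨u, hu, hWu⟩
    have := card_nearly_orthogonal_le hh hr hr1 W (fun v hv => hV v (hW hv))
      (fun v hv w hw => hsep v (hW hv) w (hW hw)) u hu hWu
    rw [← ENNReal.ofReal_natCast]
    refine ENNReal.ofReal_le_ofReal ?_
    rw [← le_div_iff₀ (by positivity)] at this
    refine this.trans (le_of_eq ?_)
    rw [hH, hd]; field_simp
  have hF : ContDiff ℝ (⊤ : ℕ∞) fun x => ∑ v ∈ V, g v x := ContDiff.sum hg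
  have hFs : HasCompactSupport fun x => ∑ v ∈ V, g v x := hasCompactSupport_finset_sum _ hgs
  have hcont : ∀ v ∈ V, Continuous (𝓕 (g v)) := fun v hv =>
    continuous_fourier_of_contDiff (hg v hv) (hgs v hv)
  have hfour : ∀ ξ, 𝓕 (fun x => ∑ v ∈ V, g v x) ξ = ∑ v ∈ V, 𝓕 (g v) ξ := by
    intro ξ
    have := fourier_sum_mul V (fun _ => 1) (f := g)
      (fun v hv => (hg v hv).continuous.integrable_of_hasCompactSupport (hgs v hv)) ξ
    simpa using this
  set B : E → Set E := fun v => {ξ | ρ * ‖ξ‖ < |inner ℝ v ξ|} with hB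
  have hBm : ∀ v, MeasurableSet (B v) := fun v => measurableSet_lt (by fun_prop) (by fun_prop)
  have hpt : ∀ ξ : E, ξ ≠ 0 → ‖∑ v ∈ V, 𝓕 (g v) ξ‖ₑ ^ 2 ≤
      2 * (ENNReal.ofReal (ρ * H) * ∑ v ∈ V, ‖𝓕 (g v) ξ‖ₑ ^ 2 +
        ENNReal.ofReal H * ∑ v ∈ V, (B v).indicator (fun ξ => ‖𝓕 (g v) ξ‖ₑ ^ 2) ξ) := by
    intro ξ hξ
    have hξ0 : 0 < ‖ξ‖ := norm_pos_iff.2 hξ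
    rw [← Finset.sum_filter_add_sum_filter_not V (fun v => ξ ∉ B v)]
    have htwo : ∀ z w : ℂ, ‖z + w‖ₑ ^ 2 ≤ 2 * (‖z‖ₑ ^ 2 + ‖w‖ₑ ^ 2) := by
      intro z w
      have := enorm_sum_sq_le Finset.univ ![z, w]
      simpa [Fin.sum_univ_two] using this
    refine (htwo _ _).trans (mul_le_mul_right (add_le_add ?_ ?_) _)
    · refine (enorm_sum_sq_le _ _).trans (mul_le_mul' ?_
        (Finset.sum_le_sum_of_subset (Finset.filter_subset _ _)))
      refine hcard _ (Finset.filter_subset _ _) ρ hhρ hρ ⟨‖ξ‖⁻¹ • ξ, norm_smul_inv_norm hξ, ?_⟩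
      intro v hv
      have hv' := (Finset.mem_filter.1 hv).2
      simp only [hB, Set.mem_ofPred_eq, not_lt] at hv'
      rw [inner_smul_right, abs_mul, abs_of_pos (inv_pos.2 hξ0), inv_mul_le_iff₀ hξ0]
      linarith
    · refine (enorm_sum_sq_le _ _).trans (mul_le_mul' ?_ ?_)
      · obtain ⟨u, hu⟩ := exists_norm_eq E (c := 1) zero_le_one
        have := hcard (V.filter fun v => ¬ ξ ∉ B v) (Finset.filter_subset _ _) 1 (hhρ.trans hρ) le_rfl
          ⟨u, hu, fun v hv => by
            have h1 := abs_real_inner_le_norm v u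
            rwa [hV v (Finset.mem_filter.1 hv).1, hu, one_mul] at h1⟩
        rwa [one_mul] at this
      · rw [Finset.sum_filter]
        refine Finset.sum_le_sum fun v _ => ?_
        by_cases hv : ξ ∈ B v <;> simp [hv]
  have hm1 : ∀ v ∈ V, Measurable fun ξ => ‖𝓕 (g v) ξ‖ₑ ^ 2 := fun v hv =>
    (hcont v hv).enorm.measurable.pow_const 2
  have hcardV : (V.card : ENNReal) ≤ ENNReal.ofReal H := by
    obtain ⟨u, hu⟩ := exists_norm_eq E (c := 1) zero_le_one
    have := hcard V subset_rfl 1 (hhρ.trans hρ) le_rfl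
      ⟨u, hu, fun v hv => by
        have h1 := abs_real_inner_le_norm v u
        rwa [hV v hv, hu, one_mul] at h1⟩
    rwa [one_mul] at this
  have hae : ∀ᵐ ξ : E, ξ ≠ 0 := by
    rw [ae_iff]; simp
  have hmain1 : ∑ v ∈ V, ∫⁻ ξ, ‖𝓕 (g v) ξ‖ₑ ^ 2 ≤ ENNReal.ofReal (H * a) := by
    calc _ ≤ ∑ v ∈ V, ENNReal.ofReal a := Finset.sum_le_sum fun v hv => by
          rw [lintegral_fourier_sq (hg v hv) (hgs v hv)]; exact hgood v hv
      _ ≤ _ := by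
          rw [Finset.sum_const, nsmul_eq_mul, ENNReal.ofReal_mul hH0.le]
          exact mul_le_mul_left hcardV _
  have hmain2 : ∑ v ∈ V, ∫⁻ ξ, (B v).indicator (fun ξ => ‖𝓕 (g v) ξ‖ₑ ^ 2) ξ ≤
      ENNReal.ofReal (H * c) := by
    calc _ ≤ ∑ v ∈ V, ENNReal.ofReal c := Finset.sum_le_sum fun v hv => by
          rw [lintegral_indicator (hBm v)]; exact hbad v hv
      _ ≤ _ := by
          rw [Finset.sum_const, nsmul_eq_mul, ENNReal.ofReal_mul hH0.le]
          exact mul_le_mul_left hcardV _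
  rw [← lintegral_fourier_sq hF hFs]
  simp only [hfour]
  calc _ ≤ ∫⁻ ξ, 2 * (ENNReal.ofReal (ρ * H) * ∑ v ∈ V, ‖𝓕 (g v) ξ‖ₑ ^ 2 +
        ENNReal.ofReal H * ∑ v ∈ V, (B v).indicator (fun ξ => ‖𝓕 (g v) ξ‖ₑ ^ 2) ξ) :=
        lintegral_mono_ae (hae.mono hpt)
    _ = 2 * (ENNReal.ofReal (ρ * H) * (∑ v ∈ V, ∫⁻ ξ, ‖𝓕 (g v) ξ‖ₑ ^ 2) +
        ENNReal.ofReal H * ∑ v ∈ V, ∫⁻ ξ, (B v).indicator (fun ξ => ‖𝓕 (g v) ξ‖ₑ ^ 2) ξ) := by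
        rw [lintegral_const_mul' _ _ (by simp), lintegral_add_left
          ((Finset.measurable_fun_sum _ hm1).const_mul _), lintegral_const_mul' _ _ (by simp),
          lintegral_const_mul' _ _ (by simp), lintegral_finsetSum _ hm1,
          lintegral_finsetSum _ fun v hv => (hm1 v hv).indicator (hBm v)]
    _ ≤ 2 * (ENNReal.ofReal (ρ * H) * ENNReal.ofReal (H * a) +
        ENNReal.ofReal H * ENNReal.ofReal (H * c)) := by
        gcongr
    _ = _ := by
        rw [← ENNReal.ofReal_mul (by positivity), ← ENNReal.ofReal_mul (by positivity),
          ← ENNReal.ofReal_add (by positivity) (by positivity),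
          show (2 : ENNReal) = ENNReal.ofReal 2 by simp, ← ENNReal.ofReal_mul (by positivity)]
        congr 1
        rw [hH]; ring

/-- The main `L²` estimate for the approximating operators. -/
theorem IsAtomFamily.exists_sum_dirPart_bound (E : Type*) [NormedAddCommGroup E]
    [InnerProductSpace ℝ E] [FiniteDimensional ℝ E] [MeasurableSpace E] [BorelSpace E]
    [Nontrivial E] (Q : ℝ) (hQ : 1 ≤ Q) :
    ∃ C : ℝ, 0 < C ∧ ∀ (ι : Type) [Fintype ι] (α : ℝ) (y : ι → E) (q : ι → ℤ) (b : ι → E → ℂ),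
      IsAtomFamily α y q b → 0 ≤ α →
      ∀ (V : Finset E) (h t : ℝ) (Ω : E → ℝ) (ω : ℝ) (s : ℤ) (m₀ m₁ : ℕ) (c : ι → ℕ → E → ℂ),
      (∀ v ∈ V, ‖v‖ = 1) → (∀ v ∈ V, ∀ w ∈ V, v ≠ w → h / 2 ≤ dist v w) →
      2 ≤ t → h = (t ^ 8)⁻¹ → 2 ^ s = t ^ (16 * Module.finrank ℝ E + 16) →
      Measurable Ω → (∀ z, |Ω z| ≤ t * ω) →
      (∀ r : ℝ, 0 < r → ∀ z : E, z ≠ 0 → Ω (r • z) = Ω z) →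
      (∫ θ : sphere (0 : E) 1, |Ω θ| ∂(volume : Measure E).toSphere) ≤ ω →
      m₀ ≤ m₁ → 1 ≤ m₀ → 1 ≤ 4 * h * m₀ → h * (m₁ + 1) ≤ Q → (∀ i m v, ‖c i m v‖ ≤ 1) →
      ∫⁻ x, ‖∑ v ∈ V, dirPart q b V h Ω s (Finset.Ico m₀ m₁) c v x‖ₑ ^ 2 ≤
        ENNReal.ofReal (C * (t ^ 2)⁻¹ * ω ^ 2 * α * ∑ i, ∫ z, ‖b i z‖) := by
  classical
  set d := Module.finrank ℝ E with hd
  obtain ⟨C₁, hC₁, hbadB⟩ := IsAtomFamily.exists_bad_bound E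
  set C₂ : ℝ := 50 * (4 ^ d) ^ 2 * ((2 * Q) ^ d) ^ 2 * 3 ^ d * volume.real (ball (0 : E) 1) with hC₂
  have hC₂0 : 0 ≤ C₂ := by positivity
  refine ⟨2 * (52 ^ d) ^ 2 * (C₂ + Q ^ 2 * C₁), by positivity, ?_⟩
  intro ι _ α y q b hb hα V h t Ω ω s m₀ m₁ c hV hsep ht hh' hs hΩ hM hΩh hω hm hm₀1 hm₀ hm₁ hc
  have ht0 : 0 < t := by linarith
  have ht1 : 1 ≤ t := by linarith
  have hh : 0 < h := by rw [hh']; positivity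
  have hd1 : 1 ≤ d := Module.finrank_pos
  set S := ∑ i, ∫ z, ‖b i z‖ with hS
  have hS0 : 0 ≤ S := Finset.sum_nonneg fun i _ => integral_nonneg fun _ => norm_nonneg _
  set ρ : ℝ := (t ^ 4)⁻¹ with hρ
  have hω0 : 0 ≤ ω := by
    have := (abs_nonneg _).trans (hM 0); nlinarith
  have hI : ∀ m ∈ Finset.Ico m₀ m₁, 1 ≤ m := fun m hm => hm₀1.trans (Finset.mem_Ico.1 hm).1
  have hh1 : h ≤ 1 := by rw [hh']; exact inv_le_one_of_one_le₀ (one_le_pow₀ ht1)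
  have hρ1 : ρ ≤ 1 := inv_le_one_of_one_le₀ (one_le_pow₀ ht1)
  have h2hρ : 2 * h ≤ ρ := by
    rw [hh', hρ, ← div_eq_mul_inv, div_le_iff₀ (by positivity)]
    have : (t ^ 4)⁻¹ * t ^ 8 = t ^ 4 := by field_simp
    rw [this]
    calc (2 : ℝ) ≤ t := ht
      _ ≤ t ^ 4 := le_self_pow₀ ht1 (by norm_num)
  have hX : (2 : ℝ) ^ s * h * ρ = t ^ (16 * d + 4) := by
    rw [hs, hh', hρ, show 16 * d + 16 = (16 * d + 4) + 8 + 4 by ring, pow_add, pow_add _ _ 8]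
    field_simp
  have hX1 : 1 ≤ (2 : ℝ) ^ s * h * ρ := by rw [hX]; exact one_le_pow₀ ht1
  have hsh : (2 : ℝ) ^ (-s) ≤ h := by
    rw [zpow_neg, hs, hh']
    exact inv_anti₀ (by positivity) (pow_le_pow_right₀ ht1 (by omega))
  have hgood : ∀ v ∈ V, ∫⁻ x, ‖dirPart q b V h Ω s (Finset.Ico m₀ m₁) c v x‖ₑ ^ 2 ≤
      ENNReal.ofReal ((4 ^ d * (t * ω)) ^ 2 * (2 * (5 / h * (2 * h * Q) ^ d) ^ 2 *
        3 ^ d * volume.real (ball (0 : E) 1) * α * S)) := by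
    intro v hv
    calc _ ≤ ∫⁻ x, ENNReal.ofReal ((4 ^ d * (t * ω)) ^ 2) *
          (∑ i, ∫⁻ z, coneKer v h Q ((2 : ℝ) ^ (q i + s)) (x - z) * ‖b i z‖ₑ) ^ 2 := by
          refine lintegral_mono fun x => ?_
          dsimp only
          rw [ENNReal.ofReal_pow (by positivity), ← mul_pow]
          gcongr
          exact hb.enorm_dirPart_le hh hΩ hM hv hm hm₀ hm₁ s (fun i m => hc i m v) x
      _ ≤ _ := by
          rw [lintegral_const_mul' _ _ (by simp), ENNReal.ofReal_mul (p := (4 ^ d * (t * ω)) ^ 2) (by positivity)]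
          exact mul_le_mul_right (hb.lintegral_sq_coneKer_le v (hV v hv) hh hh1 hQ s hsh) _
  have hm₁Q : (m₁ : ℝ) ≤ Q / h := by
    rw [le_div_iff₀ hh]; nlinarith
  have hbad : ∀ v ∈ V, ∫⁻ ξ in {ξ | ρ * ‖ξ‖ < |inner ℝ v ξ|},
      ‖𝓕 (dirPart q b V h Ω s (Finset.Ico m₀ m₁) c v) ξ‖ₑ ^ 2 ≤
      ENNReal.ofReal ((Q / h) ^ 2 * (C₁ * ω ^ 2 * (2 ^ s * h * ρ)⁻¹ * α * S)) := by
    intro v hv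
    simp only [hb.fourier_dirPart hh hΩ hM hv hI]
    have hcardI : ((Finset.Ico m₀ m₁).card : ENNReal) ≤ ENNReal.ofReal (Q / h) := by
      rw [← ENNReal.ofReal_natCast]
      refine ENNReal.ofReal_le_ofReal (le_trans ?_ hm₁Q)
      rw [Nat.card_Ico]
      exact_mod_cast Nat.sub_le _ _
    have hterm : ∀ m ∈ Finset.Ico m₀ m₁, ∫⁻ ξ in {ξ | ρ * ‖ξ‖ < |inner ℝ v ξ|},
        ‖∑ i, c i m v * (𝓕 (fun z => (kern V h Ω (2 ^ (q i + s)) m v z : ℂ)) ξ * 𝓕 (b i) ξ)‖ₑ ^ 2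
        ≤ ENNReal.ofReal (C₁ * ω ^ 2 * (2 ^ s * h * ρ)⁻¹ * α * S) := fun m hm =>
      hbadB ι α y q b hb hα V h ρ Ω (t * ω) ω s m v hh hh1 h2hρ hX1 hΩ hM hΩh hω (hI m hm) hv
        (fun i => c i m v) fun i => hc i m v
    have hmeas : ∀ m ∈ Finset.Ico m₀ m₁, Measurable fun ξ =>
        ‖∑ i, c i m v * (𝓕 (fun z => (kern V h Ω (2 ^ (q i + s)) m v z : ℂ)) ξ * 𝓕 (b i) ξ)‖ₑ ^ 2 := by
      intro m hm
      refine Measurable.pow_const (Measurable.enorm ?_) 2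
      refine Finset.measurable_fun_sum _ fun i _ => measurable_const.mul ?_
      have hk := hb.conv_kern hh hΩ hM hv (hI m hm) s i
      have := (continuous_fourier_of_contDiff hk.1 hk.2).measurable
      have h2 := fourier_conv (integrable_kern (D := 2 ^ (q i + s)) hh hΩ hM (by positivity)
        (hI m hm) hv) (hb.integrable i)
      rwa [funext h2] at this
    calc _ ≤ ∫⁻ ξ in {ξ | ρ * ‖ξ‖ < |inner ℝ v ξ|}, ENNReal.ofReal (Q / h) *
          ∑ m ∈ Finset.Ico m₀ m₁, ‖∑ i, c i m v *
            (𝓕 (fun z => (kern V h Ω (2 ^ (q i + s)) m v z : ℂ)) ξ * 𝓕 (b i) ξ)‖ₑ ^ 2 :=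
          lintegral_mono fun ξ => (enorm_sum_sq_le _ _).trans (mul_le_mul_left hcardI _)
      _ ≤ ENNReal.ofReal (Q / h) * ∑ m ∈ Finset.Ico m₀ m₁,
          ENNReal.ofReal (C₁ * ω ^ 2 * (2 ^ s * h * ρ)⁻¹ * α * S) := by
          rw [lintegral_const_mul' _ _ (by simp), lintegral_finsetSum _ hmeas]
          exact mul_le_mul_right (Finset.sum_le_sum hterm) _
      _ ≤ ENNReal.ofReal (Q / h) * (ENNReal.ofReal (Q / h) *
          ENNReal.ofReal (C₁ * ω ^ 2 * (2 ^ s * h * ρ)⁻¹ * α * S)) := by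
          rw [Finset.sum_const, nsmul_eq_mul]
          gcongr
      _ = _ := by
          rw [← ENNReal.ofReal_mul (by positivity), ← ENNReal.ofReal_mul (by positivity)]
          congr 1; ring
  have hsm := fun v (hv : v ∈ V) => hb.dirPart_smooth (v := v) hh hΩ hM hv hI s c
  refine (lintegral_sq_sum_directions_le hh (by linarith) hρ1 V hV hsep (fun v hv => (hsm v hv).1)
    (fun v hv => (hsm v hv).2) (by positivity) (by positivity) hgood hbad).trans ?_
  refine ENNReal.ofReal_le_ofReal ?_
  rw [← hd]
  have e1 : ρ * (h * (h ^ d)⁻¹) ^ 2 * ((4 ^ d * (t * ω)) ^ 2 * (2 * (5 / h * (2 * h * Q) ^ d) ^ 2 *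
        3 ^ d * volume.real (ball (0 : E) 1) * α * S)) = C₂ * (t ^ 2)⁻¹ * ω ^ 2 * α * S := by
    rw [hC₂, hρ, show 2 * h * Q = h * (2 * Q) by ring, mul_pow h]
    field_simp
    ring
  have e2 : (h * (h ^ d)⁻¹) ^ 2 * ((Q / h) ^ 2 * (C₁ * ω ^ 2 * (2 ^ s * h * ρ)⁻¹ * α * S)) ≤
      Q ^ 2 * C₁ * (t ^ 2)⁻¹ * ω ^ 2 * α * S := by
    have : (h * (h ^ d)⁻¹) ^ 2 * (Q / h) ^ 2 * (2 ^ s * h * ρ)⁻¹ = Q ^ 2 * (t ^ 4)⁻¹ := by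
      rw [hX, hh', show 16 * d + 4 = 8 * d + 8 * d + 4 by ring, pow_add, pow_add, inv_pow, ← pow_mul]
      field_simp
    calc _ = ((h * (h ^ d)⁻¹) ^ 2 * (Q / h) ^ 2 * (2 ^ s * h * ρ)⁻¹) * (C₁ * ω ^ 2 * α * S) := by ring
      _ = (t ^ 4)⁻¹ * (Q ^ 2 * (C₁ * ω ^ 2 * α * S)) := by rw [this]; ring
      _ ≤ (t ^ 2)⁻¹ * (Q ^ 2 * (C₁ * ω ^ 2 * α * S)) := by
          gcongr
          norm_num
      _ = _ := by ring
  rw [e1]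
  calc _ ≤ 2 * (52 ^ d) ^ 2 * (C₂ * (t ^ 2)⁻¹ * ω ^ 2 * α * S +
        Q ^ 2 * C₁ * (t ^ 2)⁻¹ * ω ^ 2 * α * S) := by gcongr
    _ = _ := by ring

end SumDirections

section CZKernel

/-- A Lipschitz cutoff vanishing on `(-∞, 1]` and equal to one on `[2, ∞)`. -/
def rampCut (u : ℝ) : ℝ := max 0 (min 1 (u - 1))

theorem rampCut_nonneg (u : ℝ) : 0 ≤ rampCut u := le_max_left _ _

theorem rampCut_le_one (u : ℝ) : rampCut u ≤ 1 := max_le zero_le_one (min_le_left _ _)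

theorem rampCut_of_le_one {u : ℝ} (hu : u ≤ 1) : rampCut u = 0 :=
  max_eq_left ((min_le_right _ _).trans (by linarith))

theorem rampCut_of_two_le {u : ℝ} (hu : 2 ≤ u) : rampCut u = 1 := by
  rw [rampCut, min_eq_left (by linarith), max_eq_right zero_le_one]

theorem rampCut_mono : Monotone rampCut := fun a b hab => by
  unfold rampCut; gcongr

theorem abs_rampCut_sub_le (u w : ℝ) : |rampCut u - rampCut w| ≤ |u - w| := by
  unfold rampCut
  refine (abs_max_sub_max_le_max _ _ _ _).trans (max_le (by simp) ?_)
  refine (abs_min_sub_min_le_max _ _ _ _).trans (max_le (by simp) ?_)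
  rw [sub_sub_sub_cancel_right]

/-- A Lipschitz cutoff to radii between `D` and `2 * Λ * D`. -/
def radialCut (Λ D r : ℝ) : ℝ := rampCut (r / D) - rampCut (r / (Λ * D))

variable {Λ D : ℝ}

theorem radialCut_nonneg (hΛ : 1 ≤ Λ) (hD : 0 < D) {r : ℝ} (hr : 0 ≤ r) : 0 ≤ radialCut Λ D r := by
  refine sub_nonneg.2 (rampCut_mono ?_)
  gcongr
  nlinarith

theorem radialCut_le_one (r : ℝ) : radialCut Λ D r ≤ 1 := by
  have := rampCut_le_one (r / D)
  have := rampCut_nonneg (r / (Λ * D))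
  unfold radialCut; linarith

theorem radialCut_ne_zero_bounds (hΛ : 1 ≤ Λ) (hD : 0 < D) {r : ℝ} (hr : radialCut Λ D r ≠ 0) :
    D ≤ r ∧ r ≤ 2 * Λ * D := by
  have hΛ0 : 0 < Λ * D := by positivity
  constructor
  · by_contra! hc
    refine hr ?_
    rw [radialCut, rampCut_of_le_one ((div_le_one hD).2 hc.le), rampCut_of_le_one, sub_zero]
    rw [div_le_one hΛ0]; nlinarith
  · by_contra! hc
    refine hr ?_
    rw [radialCut, rampCut_of_two_le, rampCut_of_two_le, sub_self]
    · rw [le_div_iff₀ hΛ0]; linarith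
    · rw [le_div_iff₀ hD]; nlinarith

theorem abs_radialCut_sub_le (hΛ : 1 ≤ Λ) (hD : 0 < D) (r r' : ℝ) :
    |radialCut Λ D r - radialCut Λ D r'| ≤ 2 * (|r - r'| / D) := by
  have h1 := abs_rampCut_sub_le (r / D) (r' / D)
  have h2 := abs_rampCut_sub_le (r / (Λ * D)) (r' / (Λ * D))
  rw [← sub_div, abs_div, abs_of_pos hD] at h1
  rw [← sub_div, abs_div, abs_of_pos (by positivity : 0 < Λ * D)] at h2
  have h3 : |r - r'| / (Λ * D) ≤ |r - r'| / D := by gcongr; nlinarith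
  unfold radialCut
  rw [abs_le] at *
  constructor <;> linarith

theorem sum_radialCut (Λ D r : ℝ) (N : ℕ) :
    ∑ n ∈ Finset.range N, radialCut Λ (Λ ^ n * D) r = rampCut (r / D) - rampCut (r / (Λ ^ N * D)) := by
  induction N with
  | zero => simp
  | succ N ih =>
    rw [Finset.sum_range_succ, ih, radialCut, ← mul_assoc, ← pow_succ']
    ring

variable {E : Type*} [NormedAddCommGroup E] [InnerProductSpace ℝ E]

/-- A kernel satisfying the standard size and regularity conditions. -/
structure IsStandardKernel (C₀ δ : ℝ) (K : E → E → ℂ) : Prop where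
  size : ∀ x y, x ≠ y → ‖K x y‖ ≤ C₀ / ‖x - y‖ ^ Module.finrank ℝ E
  regular_left : ∀ x₁ x₂ y, ‖x₁ - y‖ > 2 * ‖x₁ - x₂‖ →
    ‖K x₁ y - K x₂ y‖ ≤ C₀ * ‖x₁ - x₂‖ ^ δ / ‖x₁ - y‖ ^ ((Module.finrank ℝ E : ℝ) + δ)
  regular_right : ∀ x y₁ y₂, ‖x - y₁‖ > 2 * ‖y₁ - y₂‖ →
    ‖K x y₁ - K x y₂‖ ≤ C₀ * ‖y₁ - y₂‖ ^ δ / ‖x - y₁‖ ^ ((Module.finrank ℝ E : ℝ) + δ)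

namespace IsStandardKernel
variable {C₀ δ : ℝ} {K : E → E → ℂ}

theorem norm_le (hK : IsStandardKernel C₀ δ K) (hC₀ : 0 < C₀) (hD : 0 < D) {x y : E}
    (hxy : D ≤ ‖x - y‖) : ‖K x y‖ ≤ C₀ / D ^ Module.finrank ℝ E := by
  have hne : x ≠ y := by
    rintro rfl
    rw [sub_self, norm_zero] at hxy; linarith
  exact (hK.size x y hne).trans (by gcongr)

theorem continuousOn_right (hK : IsStandardKernel C₀ δ K) (hδ : 0 < δ) (x : E) :
    ContinuousOn (K x) {x}ᶜ := by
  intro y hy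
  have hy0 : 0 < ‖x - y‖ := norm_pos_iff.2 (sub_ne_zero.2 (Ne.symm hy))
  refine ContinuousAt.continuousWithinAt ?_
  rw [ContinuousAt, tendsto_iff_norm_sub_tendsto_zero]
  have hlim : Tendsto (fun y' => C₀ * ‖y - y'‖ ^ δ / ‖x - y‖ ^ ((Module.finrank ℝ E : ℝ) + δ))
      (𝓝 y) (𝓝 0) := by
    have h1 : ContinuousAt
        (fun y' => C₀ * ‖y - y'‖ ^ δ / ‖x - y‖ ^ ((Module.finrank ℝ E : ℝ) + δ)) y := by
      refine ContinuousAt.div_const (ContinuousAt.mul continuousAt_const ?_) _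
      exact ContinuousAt.rpow_const (by fun_prop) (Or.inr hδ.le)
    have h2 := h1.tendsto
    simp only [sub_self, norm_zero, Real.zero_rpow hδ.ne', mul_zero, zero_div] at h2
    exact h2
  refine squeeze_zero' (Eventually.of_forall fun _ => norm_nonneg _) ?_ hlim
  filter_upwards [ball_mem_nhds y (half_pos hy0)] with y' hy'
  rw [norm_sub_rev]
  refine hK.regular_right x y y' ?_
  rw [mem_ball, dist_eq_norm, norm_sub_rev] at hy'
  linarith

theorem norm_sub_le (hK : IsStandardKernel C₀ δ K) (hC₀ : 0 < C₀) (hδ : 0 < δ) (hδ1 : δ ≤ 1)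
    {h T : ℝ} (hh : 0 < h) (hh1 : h ≤ 1) (hT : 1 ≤ T) (hD : 0 < D) {x x' y y' : E}
    (hxy : D / 4 ≤ ‖x - y‖) (hxy' : D / 4 ≤ ‖x' - y'‖) (hx : ‖x - x'‖ ≤ T * (h * D))
    (hy : ‖y - y'‖ ≤ T * (h * D)) :
    ‖K x y - K x' y'‖ ≤ 64 * C₀ * T * 8 ^ Module.finrank ℝ E * h ^ δ / D ^ Module.finrank ℝ E := by
  set d := Module.finrank ℝ E with hd
  by_cases hs : T * h < 1 / 32
  · have h0 : T * (h * D) ≤ D / 32 := by nlinarith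
    have hx'y : D / 8 ≤ ‖x' - y‖ := by
      have := norm_sub_norm_le (x - y) (x - x')
      rw [show x - y - (x - x') = x' - y by abel] at this
      linarith
    have h1 := hK.regular_left x x' y (by linarith)
    have h2 := hK.regular_right x' y y' (by linarith)
    have key : ∀ a r : ℝ, 0 ≤ a → a ≤ T * (h * D) → D / 8 ≤ r → C₀ * a ^ δ / r ^ ((d : ℝ) + δ) ≤
        8 * C₀ * T * 8 ^ d * h ^ δ / D ^ d := by
      intro a r ha ha' hr
      have hD8 : 0 < D / 8 := by positivity
      have e1 : C₀ * a ^ δ / r ^ ((d : ℝ) + δ) ≤ C₀ * (T * (h * D)) ^ δ / (D / 8) ^ ((d : ℝ) + δ) := by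
        gcongr
      refine e1.trans ?_
      rw [Real.rpow_add hD8, Real.rpow_natCast, Real.mul_rpow (by positivity) (by positivity),
        Real.mul_rpow hh.le hD.le, Real.div_rpow hD.le (by norm_num), div_pow]
      have hT' : T ^ δ ≤ T := by
        simpa using Real.rpow_le_rpow_of_exponent_le hT hδ1
      have h8' : (8 : ℝ) ^ δ ≤ 8 := by
        simpa using Real.rpow_le_rpow_of_exponent_le (by norm_num : (1 : ℝ) ≤ 8) hδ1
      have hDδ : 0 < D ^ δ := Real.rpow_pos_of_pos hD _
      calc _ = 8 ^ δ * C₀ * T ^ δ * 8 ^ d * h ^ δ / D ^ d := by field_simp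
        _ ≤ _ := by gcongr
    have k1 := key ‖x - x'‖ ‖x - y‖ (norm_nonneg _) hx (by linarith)
    have k2 := key ‖y - y'‖ ‖x' - y‖ (norm_nonneg _) hy hx'y
    have hpos : 0 ≤ C₀ * T * 8 ^ d * h ^ δ / D ^ d := by positivity
    calc _ = ‖(K x y - K x' y) + (K x' y - K x' y')‖ := by congr 1; abel
      _ ≤ _ := (norm_add_le _ _).trans (add_le_add (h1.trans k1) (h2.trans k2))
      _ = 16 * (C₀ * T * 8 ^ d * h ^ δ / D ^ d) := by ring
      _ ≤ 64 * (C₀ * T * 8 ^ d * h ^ δ / D ^ d) := by linarith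
      _ = _ := by ring
  · push Not at hs
    have hD4 : 0 < D / 4 := by positivity
    have h1 := hK.norm_le hC₀ hD4 hxy
    have h2 := hK.norm_le hC₀ hD4 hxy'
    have hh' : h ≤ h ^ δ := by
      simpa using Real.rpow_le_rpow_of_exponent_ge hh hh1 hδ1
    have h3 : 1 ≤ 32 * T * h ^ δ := by nlinarith
    calc _ ≤ C₀ / (D / 4) ^ d + C₀ / (D / 4) ^ d := (_root_.norm_sub_le _ _).trans
          (add_le_add h1 h2)
      _ = 2 * C₀ * 4 ^ d / D ^ d * 1 := by rw [div_pow]; field_simp; ring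
      _ ≤ 2 * C₀ * 8 ^ d / D ^ d * (32 * T * h ^ δ) := by
          gcongr
          norm_num
      _ = _ := by ring

/-- The kernel localised to distances comparable with `D`, normalised to be bounded. -/
def localised (K : E → E → ℂ) (Λ D : ℝ) (x y : E) : ℂ :=
  ((D * ‖x - y‖ ^ (Module.finrank ℝ E - 1) * radialCut Λ D ‖x - y‖ : ℝ) : ℂ) * K x y

theorem norm_localised_le (hK : IsStandardKernel C₀ δ K) (hC₀ : 0 < C₀) (hΛ : 1 ≤ Λ) (hD : 0 < D)
    [Nontrivial E] [FiniteDimensional ℝ E] (x y : E) : ‖localised K Λ D x y‖ ≤ C₀ := by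
  rw [localised]
  by_cases hne : radialCut Λ D ‖x - y‖ = 0
  · rw [hne]; simp [hC₀.le]
  obtain ⟨h1, h2⟩ := radialCut_ne_zero_bounds hΛ hD hne
  have hr : 0 < ‖x - y‖ := hD.trans_le h1
  have hc0 := radialCut_nonneg hΛ hD hr.le
  have hc1 := radialCut_le_one (Λ := Λ) (D := D) ‖x - y‖
  have hk := hK.norm_le hC₀ hr le_rfl
  have hd1 : 1 ≤ Module.finrank ℝ E := Module.finrank_pos
  obtain ⟨k, hk'⟩ : ∃ k, Module.finrank ℝ E = k + 1 := ⟨Module.finrank ℝ E - 1, by omega⟩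
  rw [hk'] at hk ⊢
  rw [norm_mul, Complex.norm_real, Real.norm_eq_abs, abs_of_nonneg (by positivity),
    Nat.add_sub_cancel]
  calc _ ≤ (‖x - y‖ * ‖x - y‖ ^ k * 1) * (C₀ / ‖x - y‖ ^ (k + 1)) := by gcongr
    _ = C₀ := by rw [pow_succ']; field_simp

theorem norm_localised_sub_le (hK : IsStandardKernel C₀ δ K) (hC₀ : 0 < C₀) (hδ : 0 < δ)
    (hδ1 : δ ≤ 1) (hΛ : 1 ≤ Λ) {h T Q : ℝ} (hh : 0 < h) (hh1 : h ≤ 1) (hT : 1 ≤ T) (hQ : 1 ≤ Q)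
    (hD : 0 < D) {x x' y y' : E}
    (hxy : D / 4 ≤ ‖x - y‖) (hxy' : D / 4 ≤ ‖x' - y'‖) (hx : ‖x - x'‖ ≤ T * (h * D))
    (hy : ‖y - y'‖ ≤ T * (h * D)) (hQ1 : ‖x - y‖ ≤ Q * D) (hQ2 : ‖x' - y'‖ ≤ Q * D)
    [Nontrivial E] [FiniteDimensional ℝ E] :
    ‖localised K Λ D x y - localised K Λ D x' y'‖ ≤
      (200 * Module.finrank ℝ E * T * (8 * Q) ^ Module.finrank ℝ E * C₀) * h ^ δ := by
  obtain ⟨k, hk⟩ : ∃ k, Module.finrank ℝ E = k + 1 :=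
    ⟨Module.finrank ℝ E - 1, by have : 1 ≤ Module.finrank ℝ E := Module.finrank_pos; omega⟩
  have hdiff := hK.norm_sub_le hC₀ hδ hδ1 hh hh1 hT hD hxy hxy' hx hy
  have hKn := hK.norm_le hC₀ (by positivity) hxy'
  rw [hk] at hdiff hKn
  simp only [localised, hk, Nat.add_sub_cancel]
  set r := ‖x - y‖ with hr
  set r' := ‖x' - y'‖ with hr'
  have hr0 : 0 < r := by linarith
  have hr0' : 0 < r' := by linarith
  set w : ℝ → ℝ := fun r => D * r ^ k * radialCut Λ D r with hw
  have hrr : |r - r'| ≤ 2 * T * (h * D) := by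
    refine (abs_norm_sub_norm_le _ _).trans ?_
    rw [show x - y - (x' - y') = (x - x') - (y - y') by abel]
    refine (_root_.norm_sub_le _ _).trans ?_
    linarith
  have hw1 : |w r| ≤ D * (Q * D) ^ k := by
    have hc0 := radialCut_nonneg hΛ hD hr0.le
    simp only [hw]
    rw [abs_of_nonneg (by positivity)]
    have hc1 := radialCut_le_one (Λ := Λ) (D := D) r
    calc _ ≤ D * (Q * D) ^ k * 1 := by gcongr
      _ = _ := mul_one _
  have hw2 : |w r - w r'| ≤ D * (Q * D) ^ k * ((k + 1) * (8 * T * h)) := by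
    have hc0 := radialCut_nonneg hΛ hD hr0.le
    have hc1 := radialCut_le_one (Λ := Λ) (D := D) r
    have e1 : |r ^ k - r' ^ k| ≤ (Q * D) ^ k * (k * (8 * T * h)) := by
      rcases Nat.eq_zero_or_pos k with h0 | h0
      · simp [h0]
      obtain ⟨l, rfl⟩ : ∃ l, k = l + 1 := ⟨k - 1, by omega⟩
      have hmax : max |r| |r'| ≤ Q * D := by
        rw [abs_of_pos hr0, abs_of_pos hr0']; exact max_le hQ1 hQ2
      calc _ ≤ |r - r'| * (l + 1 : ℕ) * max |r| |r'| ^ (l + 1 - 1) := abs_pow_sub_pow_le _ _ _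
        _ ≤ (2 * T * (h * D)) * (l + 1 : ℕ) * (Q * D) ^ l := by
            rw [Nat.add_sub_cancel]; gcongr
        _ = (Q * D) ^ l * D * ((l + 1 : ℕ) * (2 * T * h)) := by ring
        _ ≤ (Q * D) ^ l * (Q * D) * ((l + 1 : ℕ) * (8 * T * h)) := by
            gcongr
            · nlinarith
            · norm_num
        _ = _ := by rw [pow_succ]
    have e2 : |radialCut Λ D r - radialCut Λ D r'| ≤ 8 * T * h := by
      refine (abs_radialCut_sub_le hΛ hD r r').trans ?_
      calc _ ≤ 2 * (2 * T * (h * D) / D) := by gcongr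
        _ = 4 * (T * h) := by field_simp; ring
        _ ≤ 8 * (T * h) := by gcongr; norm_num
        _ = _ := by ring
    have e3 : w r - w r' = D * (radialCut Λ D r * (r ^ k - r' ^ k) +
        r' ^ k * (radialCut Λ D r - radialCut Λ D r')) := by simp only [hw]; ring
    rw [e3, abs_mul, abs_of_pos hD]
    have e4 : r' ^ k ≤ (Q * D) ^ k := by gcongr
    calc _ ≤ D * (1 * ((Q * D) ^ k * (k * (8 * T * h))) + (Q * D) ^ k * (8 * T * h)) := by
          refine mul_le_mul_of_nonneg_left ((abs_add_le _ _).trans (add_le_add ?_ ?_)) hD.le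
          · rw [abs_mul, abs_of_nonneg hc0]
            exact mul_le_mul hc1 e1 (abs_nonneg _) zero_le_one
          · rw [abs_mul, abs_of_nonneg (by positivity)]
            exact mul_le_mul e4 e2 (abs_nonneg _) (by positivity)
      _ = _ := by ring
  have hsplit : (w r : ℂ) * K x y - (w r' : ℂ) * K x' y' =
      (w r : ℂ) * (K x y - K x' y') + ((w r - w r' : ℝ) : ℂ) * K x' y' := by push_cast; ring
  have hh' : h ≤ h ^ δ := by
    simpa using Real.rpow_le_rpow_of_exponent_ge hh hh1 hδ1
  change ‖(w r : ℂ) * K x y - (w r' : ℂ) * K x' y'‖ ≤ _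
  rw [hsplit]
  refine (norm_add_le _ _).trans ?_
  rw [norm_mul, norm_mul, Complex.norm_real, Complex.norm_real, Real.norm_eq_abs, Real.norm_eq_abs]
  have hk1 : (1 : ℝ) ≤ (k : ℝ) + 1 := by linarith [(Nat.cast_nonneg k : (0 : ℝ) ≤ k)]
  have hQk : Q ^ k ≤ Q ^ (k + 1) := pow_le_pow_right₀ hQ (by omega)
  have hpos : 0 ≤ ((k : ℝ) + 1) * T * 8 ^ (k + 1) * Q ^ (k + 1) * C₀ * h ^ δ := by positivity
  calc _ ≤ D * (Q * D) ^ k * (64 * C₀ * T * 8 ^ (k + 1) * h ^ δ / D ^ (k + 1)) +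
        D * (Q * D) ^ k * ((k + 1) * (8 * T * h)) * (C₀ / (D / 4) ^ (k + 1)) := by
        gcongr
    _ = 1 * (64 * T * 8 ^ (k + 1) * Q ^ k * C₀ * h ^ δ) +
        (k + 1) * 8 * T * 4 ^ (k + 1) * Q ^ k * C₀ * h := by
        rw [mul_pow, div_pow, pow_succ' D]; field_simp
    _ ≤ (k + 1) * (64 * T * 8 ^ (k + 1) * Q ^ (k + 1) * C₀ * h ^ δ) +
        (k + 1) * 8 * T * 8 ^ (k + 1) * Q ^ (k + 1) * C₀ * h ^ δ := by
        gcongr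
        norm_num
    _ = 72 * (((k : ℝ) + 1) * T * 8 ^ (k + 1) * Q ^ (k + 1) * C₀ * h ^ δ) := by ring
    _ ≤ 200 * (((k : ℝ) + 1) * T * 8 ^ (k + 1) * Q ^ (k + 1) * C₀ * h ^ δ) := by linarith
    _ = _ := by push_cast; rw [mul_pow]; ring

end IsStandardKernel
end CZKernel

section Comparison
variable {E : Type*} [NormedAddCommGroup E] [InnerProductSpace ℝ E] [FiniteDimensional ℝ E]
  [MeasurableSpace E] [BorelSpace E] [Nontrivial E]

theorem lintegral_closedBall_homogeneous_le {W : E → ENNReal} (hW : Measurable W)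
    (hh : ∀ r : ℝ, 0 < r → ∀ z : E, z ≠ 0 → W (r • z) = W z) {R : ℝ} (hR : 0 ≤ R) :
    ∫⁻ z in closedBall (0 : E) R, W z ≤ ENNReal.ofReal (R ^ Module.finrank ℝ E) *
      ∫⁻ θ : sphere (0 : E) 1, W θ ∂(volume : Measure E).toSphere := by
  obtain ⟨k, hk⟩ : ∃ k, Module.finrank ℝ E = k + 1 :=
    ⟨Module.finrank ℝ E - 1, by have : 1 ≤ Module.finrank ℝ E := Module.finrank_pos; omega⟩
  rw [← lintegral_indicator measurableSet_closedBall,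
    lintegral_polar (hW.indicator measurableSet_closedBall), hk, Nat.add_sub_cancel,
    ← lintegral_const_mul' _ _ ENNReal.ofReal_ne_top]
  refine lintegral_mono fun θ => ?_
  have hθ : ‖(θ : E)‖ = 1 := by simp
  have hθ0 : (θ : E) ≠ 0 := by rw [← norm_pos_iff, hθ]; exact one_pos
  calc _ ≤ ∫⁻ r in Set.Ioi (0 : ℝ), (Set.Ioc 0 R).indicator
        (fun _ => ENNReal.ofReal (R ^ k) * W θ) r := by
        refine setLIntegral_mono' measurableSet_Ioi fun r hr => ?_
        rw [Set.mem_Ioi] at hr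
        by_cases hrR : r ≤ R
        · rw [Set.indicator_of_mem (s := Set.Ioc 0 R) ⟨hr, hrR⟩]
          refine mul_le_mul' (ENNReal.ofReal_le_ofReal (by gcongr)) ?_
          refine (Set.indicator_le_self _ _ _).trans (hh r hr _ hθ0).le
        · rw [Set.indicator_of_notMem (s := closedBall 0 R), mul_zero]
          · exact zero_le
          · rw [mem_closedBall, dist_zero_right, norm_smul, hθ, mul_one, Real.norm_eq_abs,
              abs_of_pos hr]
            exact hrR
    _ ≤ ∫⁻ r, (Set.Ioc 0 R).indicator (fun _ => ENNReal.ofReal (R ^ k) * W θ) r :=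
        setLIntegral_le_lintegral _ _
    _ = ENNReal.ofReal (R ^ (k + 1)) * W θ := by
        rw [lintegral_indicator_const measurableSet_Ioc, Real.volume_Ioc, sub_zero, pow_succ,
          ENNReal.ofReal_mul (by positivity)]
        ring

/-- The truncation of `Ω` at height `M`. -/
def truncate (M : ℝ) (Ω : E → ℝ) (z : E) : ℝ := if |Ω z| ≤ M then Ω z else 0

/-- The size of the part of `Ω` not captured by the approximation with aperture `h`. -/
def angularError (h δ M : ℝ) (Ω : E → ℝ) (z : E) : ENNReal :=
  ENNReal.ofReal (h ^ δ * |Ω z|) + if M < |Ω z| then ENNReal.ofReal |Ω z| else 0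

theorem measurable_truncate (M : ℝ) {Ω : E → ℝ} (hΩ : Measurable Ω) : Measurable (truncate M Ω) :=
  Measurable.ite (measurableSet_le hΩ.abs measurable_const) hΩ measurable_const

theorem measurable_angularError (h δ M : ℝ) {Ω : E → ℝ} (hΩ : Measurable Ω) :
    Measurable (angularError h δ M Ω) :=
  ((hΩ.abs.const_mul _).ennreal_ofReal).add
    (Measurable.ite (measurableSet_lt measurable_const hΩ.abs) hΩ.abs.ennreal_ofReal
      measurable_const)

theorem abs_truncate_le {M : ℝ} (hM : 0 ≤ M) (Ω : E → ℝ) (z : E) : |truncate M Ω z| ≤ M := by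
  unfold truncate; split_ifs with h
  · exact h
  · simpa using hM

theorem abs_truncate_le_abs (M : ℝ) (Ω : E → ℝ) (z : E) : |truncate M Ω z| ≤ |Ω z| := by
  unfold truncate; split_ifs with h
  · exact le_rfl
  · simp

variable {V : Finset E} {h C₀ δ Λ Q M : ℝ} {K : E → E → ℂ} {Ω : E → ℝ}

/-- The coefficients of the approximating operator. -/
def coef (C₀ : ℝ) (K : E → E → ℂ) (Λ h D : ℝ) (y : E) (m : ℕ) (v : E) : ℂ :=
  (C₀ : ℂ)⁻¹ * IsStandardKernel.localised K Λ D (y + (D * h * m) • v) y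

theorem norm_coef_le (hK : IsStandardKernel C₀ δ K) (hC₀ : 0 < C₀) (hΛ : 1 ≤ Λ) {D : ℝ} (hD : 0 < D)
    (h : ℝ) (y : E) (m : ℕ) (v : E) : ‖coef C₀ K Λ h D y m v‖ ≤ 1 := by
  rw [coef, norm_mul, norm_inv, Complex.norm_real, Real.norm_eq_abs, abs_of_pos hC₀,
    inv_mul_le_iff₀ hC₀, mul_one]
  exact hK.norm_localised_le hC₀ hΛ hD _ _

theorem norm_kernel_sub_approx_le (hK : IsStandardKernel C₀ δ K) (hC₀ : 0 < C₀) (hδ : 0 < δ)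
    (hδ1 : δ ≤ 1) (hΛ : 1 ≤ Λ) (hh : 0 < h) (hh1 : h ≤ 1) {m₀ m₁ : ℕ}
    (hm₀ : 1 ≤ 4 * h * m₀) (hm₀' : h * (m₀ + 1) ≤ 1) (hm₁' : 2 * Λ ≤ h * m₁)
    (hm₁ : h * (m₁ + 1) ≤ Q) (hV : ∀ v ∈ V, ‖v‖ = 1)
    (hnet : ∀ θ : E, ‖θ‖ = 1 → ∃ v ∈ V, dist θ v < h) {D : ℝ} (hD : 0 < D) {x y y₀ : E}
    (hy : ‖y - y₀‖ ≤ D * h) :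
    ‖(Ω (x - y) : ℂ) * K x y * (radialCut Λ D ‖x - y‖ : ℂ) - ∑ v ∈ V, ∑ m ∈ Finset.Ico m₀ m₁,
      C₀ * coef C₀ K Λ h D y₀ m v * (kern V h (truncate M Ω) D m v (x - y) : ℂ)‖ₑ ≤
    (closedBall (0 : E) (Q * D)).indicator (fun z => ENNReal.ofReal
      (201 * Module.finrank ℝ E * (Q + 3) * (32 * Q) ^ Module.finrank ℝ E * C₀ *
        (D ^ Module.finrank ℝ E)⁻¹) * angularError h δ M Ω z) (x - y) := by
  set d := Module.finrank ℝ E with hd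
  have hd1 : 1 ≤ d := Module.finrank_pos
  have hd1' : (1 : ℝ) ≤ d := by exact_mod_cast hd1
  have hm01 : m₀ ≤ m₁ := by
    have : (m₀ : ℝ) ≤ m₁ := by
      by_contra! hc
      nlinarith
    exact_mod_cast this
  have hQΛ : 2 * Λ ≤ Q := by nlinarith
  have hQ1 : 1 ≤ Q := by linarith
  have hDh : 0 < D * h := by positivity
  set z := x - y with hz
  have hrange : ∀ m ∈ Finset.Ico m₀ m₁, stepBump (‖z‖ / (D * h) - m) ≠ 0 →
      D / 4 ≤ D * h * m ∧ D * h * m ≤ ‖z‖ ∧ ‖z‖ ≤ D * h * m + 2 * (D * h) ∧ ‖z‖ ≤ Q * D := by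
    intro m hm hne
    obtain ⟨h1, h2⟩ := stepBump_ne_zero_bounds hD hh hne
    rw [Finset.mem_Ico] at hm
    have hm0 : (m₀ : ℝ) ≤ m := by exact_mod_cast hm.1
    have hm1 : (m : ℝ) + 1 ≤ m₁ := by exact_mod_cast hm.2
    refine ⟨?_, h1, by linarith, ?_⟩
    · have : D * h * m₀ ≤ D * h * m := by gcongr
      nlinarith
    · have : D * h * (m + 2) ≤ D * h * (m₁ + 1) := by
        apply mul_le_mul_of_nonneg_left _ hDh.le; linarith
      nlinarith
  set G := IsStandardKernel.localised K Λ D x y with hG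
  set B : ℝ := 200 * d * (Q + 3) * (8 * Q) ^ d * C₀ with hB
  have hB0 : 0 ≤ B := by positivity
  have hBC : C₀ ≤ 201 * d * (Q + 3) * (32 * Q) ^ d * C₀ := by
    have : (1 : ℝ) ≤ (32 * Q) ^ d := one_le_pow₀ (by linarith)
    have h2 : (1 : ℝ) ≤ 201 * d * (Q + 3) := by nlinarith
    nlinarith [mul_le_mul h2 this zero_le_one (by positivity)]
  have hBC' : 4 ^ d * B ≤ 201 * d * (Q + 3) * (32 * Q) ^ d * C₀ := by
    rw [hB, show (32 : ℝ) * Q = 4 * (8 * Q) by ring, mul_pow 4]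
    have : 0 ≤ d * (Q + 3) * (4 ^ d * (8 * Q) ^ d) * C₀ := by positivity
    linarith
  by_cases hbig : |Ω z| ≤ M
  swap
  · have hk : ∀ v ∈ V, ∑ m ∈ Finset.Ico m₀ m₁,
        C₀ * coef C₀ K Λ h D y₀ m v * (kern V h (truncate M Ω) D m v z : ℂ) = 0 := by
      intro v _
      refine Finset.sum_eq_zero fun m _ => ?_
      simp [kern, truncate, hbig]
    rw [Finset.sum_eq_zero hk, sub_zero]
    by_cases hφ : radialCut Λ D ‖z‖ = 0
    · simp [hφ]
    obtain ⟨h1, h2⟩ := radialCut_ne_zero_bounds hΛ hD hφ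
    have hzQ : z ∈ closedBall (0 : E) (Q * D) := by
      rw [mem_closedBall, dist_zero_right]
      exact h2.trans (by gcongr)
    rw [Set.indicator_of_mem hzQ, angularError, if_pos (not_le.1 hbig)]
    have hkn := hK.norm_le hC₀ hD h1
    have hc0 := radialCut_nonneg hΛ hD (norm_nonneg z)
    refine le_trans ?_ (mul_le_mul_right le_add_self _)
    rw [← ENNReal.ofReal_mul (by positivity), ← ofReal_norm]
    refine ENNReal.ofReal_le_ofReal ?_
    rw [norm_mul, norm_mul, Complex.norm_real, Complex.norm_real, Real.norm_eq_abs,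
      Real.norm_eq_abs, abs_of_nonneg hc0]
    calc _ ≤ |Ω z| * (C₀ / D ^ d) * 1 := by
          gcongr
          exact radialCut_le_one _
      _ = C₀ * ((D ^ d)⁻¹ * |Ω z|) := by ring
      _ ≤ _ := by
          rw [mul_assoc _ (D ^ d)⁻¹]
          exact mul_le_mul_of_nonneg_right hBC (by positivity)
  have htr : truncate M Ω z = Ω z := by simp [truncate, hbig]
  have hGsum : G = ∑ v ∈ V, ∑ m ∈ Finset.Ico m₀ m₁,
      ((stepBump (‖z‖ / (D * h) - m) * capPart V h v z : ℝ) : ℂ) * G := by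
    by_cases hφ : radialCut Λ D ‖z‖ = 0
    · have : G = 0 := by rw [hG, IsStandardKernel.localised, ← hz, hφ]; simp
      simp [this]
    obtain ⟨h1, h2⟩ := radialCut_ne_zero_bounds hΛ hD hφ
    have hz0 : z ≠ 0 := norm_pos_iff.1 (hD.trans_le h1)
    have e1 := sum_capPart (exists_mem_cap_of_net hnet hz0)
    have e2 := sum_stepBump_eq_one hm01 (x := ‖z‖ / (D * h))
      (by rw [le_div_iff₀ hDh]; nlinarith) (by rw [div_le_iff₀ hDh]; nlinarith)
    simp only [← Finset.sum_mul, ← Complex.ofReal_sum, e2]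
    rw [← Finset.mul_sum, e1]
    simp
  have hmain : (Ω z : ℂ) * K x y * (radialCut Λ D ‖z‖ : ℂ) =
      ∑ v ∈ V, ∑ m ∈ Finset.Ico m₀ m₁, (kern V h (truncate M Ω) D m v z : ℂ) * G := by
    have e1 : (Ω z : ℂ) * K x y * (radialCut Λ D ‖z‖ : ℂ) =
        ((D⁻¹ * (‖z‖ ^ (d - 1))⁻¹ * Ω z : ℝ) : ℂ) * G := by
      rw [hG, IsStandardKernel.localised, ← hz, ← hd]
      by_cases hφ : radialCut Λ D ‖z‖ = 0
      · simp [hφ]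
      obtain ⟨h1, -⟩ := radialCut_ne_zero_bounds hΛ hD hφ
      have hz0 : (‖z‖ : ℂ) ≠ 0 := by exact_mod_cast (hD.trans_le h1).ne'
      have hDc : (D : ℂ) ≠ 0 := by exact_mod_cast hD.ne'
      push_cast
      field_simp
    rw [e1, hGsum, Finset.mul_sum]
    refine Finset.sum_congr rfl fun v _ => ?_
    rw [Finset.mul_sum]
    refine Finset.sum_congr rfl fun m _ => ?_
    rw [← hGsum, kern, htr, ← hd]
    push_cast; ring
  rw [hmain, ← Finset.sum_sub_distrib]
  simp only [← Finset.sum_sub_distrib]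
  by_cases hzQ : z ∈ closedBall (0 : E) (Q * D) ∧ D / 4 ≤ ‖z‖
  swap
  · refine le_trans (le_of_eq ?_) zero_le
    rw [enorm_eq_zero]
    refine Finset.sum_eq_zero fun v _ => Finset.sum_eq_zero fun m hm => ?_
    by_cases hs : stepBump (‖z‖ / (D * h) - m) = 0
    · simp [kern, hs]
    · obtain ⟨r1, r2, r3, r4⟩ := hrange m hm hs
      exact absurd ⟨by rwa [mem_closedBall, dist_zero_right], r1.trans r2⟩ hzQ
  obtain ⟨hzQ, hz4⟩ := hzQ
  have hzQ' : ‖z‖ ≤ Q * D := by rwa [mem_closedBall, dist_zero_right] at hzQ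
  rw [Set.indicator_of_mem hzQ, angularError, if_neg (not_lt.2 hbig), add_zero,
    ← ENNReal.ofReal_mul (by positivity), ← ofReal_norm]
  refine ENNReal.ofReal_le_ofReal ?_
  have hterm : ∀ v ∈ V, ∀ m ∈ Finset.Ico m₀ m₁,
      ‖(kern V h (truncate M Ω) D m v z : ℂ) * G - C₀ * coef C₀ K Λ h D y₀ m v *
        (kern V h (truncate M Ω) D m v z : ℂ)‖ ≤
      4 ^ d * (D ^ d)⁻¹ * |Ω z| * (B * h ^ δ) *
        (stepBump (‖z‖ / (D * h) - m) * capPart V h v z) := by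
    intro v hv m hm
    have hs0 := stepBump_nonneg (‖z‖ / (D * h) - m)
    have hc0 := capPart_nonneg V h v z
    by_cases hs : stepBump (‖z‖ / (D * h) - m) = 0
    · simp [kern, hs]
    by_cases hcap : z ∈ cap v h
    swap
    · simp [kern, capPart_eq_zero hcap]
    obtain ⟨r1, r2, r3, r4⟩ := hrange m hm hs
    have hcoef : (C₀ : ℂ) * coef C₀ K Λ h D y₀ m v =
        IsStandardKernel.localised K Λ D (y₀ + (D * h * m) • v) y₀ := by
      have : (C₀ : ℂ) ≠ 0 := by exact_mod_cast hC₀.ne'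
      rw [coef, mul_inv_cancel_left₀ this]
    have hnv : ‖y₀ + (D * h * m) • v - y₀‖ = D * h * m := by
      rw [add_sub_cancel_left, norm_smul, hV v hv, mul_one, Real.norm_eq_abs,
        abs_of_nonneg (by positivity)]
    have hxx : ‖x - (y₀ + (D * h * m) • v)‖ ≤ (Q + 3) * (h * D) := by
      have e1 : x - (y₀ + (D * h * m) • v) =
          (z - ‖z‖ • v) + (‖z‖ - D * h * m) • v + (y - y₀) := by rw [hz, sub_smul]; abel
      rw [e1]
      refine (norm_add₃_le).trans ?_
      have e2 : ‖z - ‖z‖ • v‖ ≤ h * ‖z‖ := hcap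
      have e3 : ‖(‖z‖ - D * h * m) • v‖ ≤ 2 * (D * h) := by
        rw [norm_smul, hV v hv, mul_one, Real.norm_eq_abs, abs_of_nonneg (by linarith)]
        linarith
      have e4 : h * ‖z‖ ≤ h * (Q * D) := by gcongr
      linarith
    have hdiff := hK.norm_localised_sub_le hC₀ hδ hδ1 hΛ hh hh1 (T := Q + 3) (by linarith) hQ1 hD
      (x := x) (y := y) (x' := y₀ + (D * h * m) • v) (y' := y₀) hz4 (by rw [hnv]; exact r1) hxx
      (hy.trans (by nlinarith)) hzQ' (by rw [hnv]; linarith)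
    rw [← hcoef] at hdiff
    have hfac : (kern V h (truncate M Ω) D m v z : ℂ) * G - C₀ * coef C₀ K Λ h D y₀ m v *
        (kern V h (truncate M Ω) D m v z : ℂ) =
        (kern V h (truncate M Ω) D m v z : ℂ) * (G - C₀ * coef C₀ K Λ h D y₀ m v) := by ring
    rw [hfac, norm_mul, Complex.norm_real, Real.norm_eq_abs, kern, htr, abs_mul, abs_mul, abs_mul,
      abs_of_nonneg hs0, abs_of_nonneg hc0, abs_of_nonneg (by positivity), ← hd]
    have h5 : D⁻¹ * (‖z‖ ^ (d - 1))⁻¹ ≤ 4 ^ d * (D ^ d)⁻¹ := by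
      obtain ⟨k, hk⟩ : ∃ k, d = k + 1 := ⟨d - 1, by omega⟩
      have h4 : (‖z‖ ^ (d - 1))⁻¹ ≤ ((D / 4) ^ (d - 1))⁻¹ := by gcongr
      refine (mul_le_mul_of_nonneg_left h4 (by positivity)).trans ?_
      rw [hk, Nat.add_sub_cancel, div_pow, inv_div, pow_succ, pow_succ, mul_inv]
      have : 0 ≤ 4 ^ k * (D ^ k)⁻¹ * D⁻¹ := by positivity
      calc D⁻¹ * (4 ^ k / D ^ k) = 4 ^ k * (D ^ k)⁻¹ * D⁻¹ := by ring
        _ ≤ 4 * (4 ^ k * (D ^ k)⁻¹ * D⁻¹) := by linarith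
        _ = _ := by ring
    calc _ ≤ 4 ^ d * (D ^ d)⁻¹ * |Ω z| * stepBump (‖z‖ / (D * h) - m) * capPart V h v z *
          (B * h ^ δ) := by
          refine mul_le_mul ?_ hdiff (norm_nonneg _) (by positivity)
          gcongr
      _ = _ := by ring
  calc _ ≤ ∑ v ∈ V, ∑ m ∈ Finset.Ico m₀ m₁, 4 ^ d * (D ^ d)⁻¹ * |Ω z| * (B * h ^ δ) *
        (stepBump (‖z‖ / (D * h) - m) * capPart V h v z) :=
        (norm_sum_le _ _).trans (Finset.sum_le_sum fun v hv =>
          (norm_sum_le _ _).trans (Finset.sum_le_sum fun m hm => hterm v hv m hm))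
    _ = 4 ^ d * (D ^ d)⁻¹ * |Ω z| * (B * h ^ δ) *
        ((∑ m ∈ Finset.Ico m₀ m₁, stepBump (‖z‖ / (D * h) - m)) * ∑ v ∈ V, capPart V h v z) := by
        rw [Finset.sum_mul_sum, Finset.sum_comm, Finset.mul_sum]
        refine Finset.sum_congr rfl fun m _ => ?_
        rw [Finset.mul_sum]
    _ ≤ 4 ^ d * (D ^ d)⁻¹ * |Ω z| * (B * h ^ δ) * 1 := by
        refine mul_le_mul_of_nonneg_left ?_ (by positivity)
        exact mul_le_one₀ (sum_stepBump_le_one hm01 _)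
          (Finset.sum_nonneg fun v _ => capPart_nonneg V h v z) (sum_capPart_le_one V h z)
    _ = (4 ^ d * B) * ((D ^ d)⁻¹ * (h ^ δ * |Ω z|)) := by ring
    _ ≤ _ := by
        rw [mul_assoc _ (D ^ d)⁻¹]
        exact mul_le_mul_of_nonneg_right hBC' (by positivity)

end Comparison

section RingOperators
variable {E : Type*} [NormedAddCommGroup E] [InnerProductSpace ℝ E] [FiniteDimensional ℝ E]
  [MeasurableSpace E] [BorelSpace E] [Nontrivial E]
variable {C₀ δ Λ Q h : ℝ} {K : E → E → ℂ} {V : Finset E} {Ω : E → ℝ}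

theorem integrableOn_closedBall_of_sphere (hΩ : Measurable Ω)
    (hhom : ∀ r : ℝ, 0 < r → ∀ z : E, z ≠ 0 → Ω (r • z) = Ω z)
    (hint : Integrable (fun θ : sphere (0 : E) 1 => Ω θ) (volume : Measure E).toSphere) (R : ℝ) :
    IntegrableOn Ω (closedBall (0 : E) R) := by
  have hR : closedBall (0 : E) R ⊆ closedBall (0 : E) (max R 0) := closedBall_subset_closedBall (le_max_left _ _)
  refine IntegrableOn.mono_set ⟨hΩ.aestronglyMeasurable, ?_⟩ hR
  refine (lintegral_closedBall_homogeneous_le hΩ.enorm (fun r hr z hz => by rw [hhom r hr z hz])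
    (le_max_right R 0)).trans_lt ?_
  exact ENNReal.mul_lt_top ENNReal.ofReal_lt_top hint.hasFiniteIntegral

theorem IsStandardKernel.integrable_mul (hK : IsStandardKernel C₀ δ K) (hC₀ : 0 < C₀) (hδ : 0 < δ)
    (hΩ : Measurable Ω) (hhom : ∀ r : ℝ, 0 < r → ∀ z : E, z ≠ 0 → Ω (r • z) = Ω z)
    (hint : Integrable (fun θ : sphere (0 : E) 1 => Ω θ) (volume : Measure E).toSphere)
    (x : E) {ε R B : ℝ} (hε : 0 < ε) {g : E → ℂ} (hg : AEStronglyMeasurable g)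
    (hB : ∀ y, ‖g y‖ ≤ B) (hsupp : ∀ y, g y ≠ 0 → ε ≤ ‖x - y‖ ∧ ‖x - y‖ ≤ R) :
    Integrable fun y => (Ω (x - y) : ℂ) * K x y * g y := by
  have hKm : AEStronglyMeasurable (K x) := by
    have h1 : AEStronglyMeasurable (K x) (volume.restrict {x}ᶜ) :=
      (hK.continuousOn_right hδ x).aestronglyMeasurable (measurableSet_singleton x).compl
    rwa [Measure.restrict_eq_self_of_ae_mem] at h1
    exact compl_mem_ae_iff.2 (measure_singleton x)
  have hΩm : Measurable fun y => (Ω (x - y) : ℂ) :=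
    Complex.measurable_ofReal.comp (hΩ.comp (measurable_const.sub measurable_id))
  have hI : Integrable fun y => ((closedBall (0 : E) R).indicator Ω (x - y)) * (C₀ / ε ^ Module.finrank ℝ E * B) := by
    refine Integrable.mul_const ?_ _
    exact ((integrable_indicator_iff measurableSet_closedBall).2
      (integrableOn_closedBall_of_sphere hΩ hhom hint R)).comp_sub_left x
  refine hI.mono ((hΩm.aestronglyMeasurable.mul hKm).mul hg) (Eventually.of_forall fun y => ?_)
  by_cases hy : g y = 0
  · rw [hy, mul_zero, norm_zero]; positivity
  · obtain ⟨h1, h2⟩ := hsupp y hy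
    have h3 := hK.norm_le hC₀ hε h1
    have hB0 : 0 ≤ B := (norm_nonneg _).trans (hB y)
    rw [Set.indicator_of_mem (by simpa using h2), norm_mul, norm_mul, norm_mul, Complex.norm_real,
      Real.norm_of_nonneg (by positivity : 0 ≤ C₀ / ε ^ Module.finrank ℝ E * B), mul_assoc]
    refine mul_le_mul_of_nonneg_left ?_ (norm_nonneg _)
    exact mul_le_mul h3 (hB y) (norm_nonneg _) (by positivity)

/-- The part of the singular integral living at distance about `D` from the diagonal. -/
def ringOp (Ω : E → ℝ) (K : E → E → ℂ) (Λ D : ℝ) (β : E → ℂ) (x : E) : ℂ :=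
  ∫ y, (Ω (x - y) : ℂ) * K x y * (radialCut Λ D ‖x - y‖ * β y)

theorem IsStandardKernel.integrable_ringOp (hK : IsStandardKernel C₀ δ K) (hC₀ : 0 < C₀) (hδ : 0 < δ)
    (hΩ : Measurable Ω) (hhom : ∀ r : ℝ, 0 < r → ∀ z : E, z ≠ 0 → Ω (r • z) = Ω z)
    (hint : Integrable (fun θ : sphere (0 : E) 1 => Ω θ) (volume : Measure E).toSphere)
    (hΛ : 1 ≤ Λ) {D : ℝ} (hD : 0 < D) {β : E → ℂ} (hβ : Continuous β) (hβc : HasCompactSupport β)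
    (x : E) : Integrable fun y => (Ω (x - y) : ℂ) * K x y * (radialCut Λ D ‖x - y‖ * β y) := by
  obtain ⟨B, hB⟩ := hβ.bounded_above_of_compact_support hβc
  have hrc : Continuous (radialCut Λ D) := by unfold radialCut rampCut; fun_prop
  have hc : Continuous fun y => ((radialCut Λ D ‖x - y‖ : ℝ) : ℂ) * β y :=
    (Complex.continuous_ofReal.comp (hrc.comp (by fun_prop))).mul hβ
  refine hK.integrable_mul hC₀ hδ hΩ hhom hint x (R := 2 * Λ * D) (B := B) hD
    hc.aestronglyMeasurable (fun y => ?_) fun y hy => ?_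
  · rw [norm_mul, Complex.norm_real, Real.norm_of_nonneg (radialCut_nonneg hΛ hD (norm_nonneg _))]
    exact (mul_le_of_le_one_left (norm_nonneg _) (radialCut_le_one _)).trans (hB y)
  · refine radialCut_ne_zero_bounds hΛ hD fun h0 => hy ?_
    rw [h0, Complex.ofReal_zero, zero_mul]

theorem integrable_kern_mul (hh : 0 < h) (hΩ : Measurable Ω) {M : ℝ} (hM : ∀ z, |Ω z| ≤ M) {D : ℝ}
    (hD : 0 < D) {m : ℕ} (hm : 1 ≤ m) {v : E} (hv : v ∈ V) {β : E → ℂ} (hβ : Continuous β)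
    (hβc : HasCompactSupport β) (x : E) :
    Integrable fun y => (kern V h Ω D m v (x - y) : ℂ) * β y := by
  obtain ⟨B, hB⟩ := hβ.bounded_above_of_compact_support hβc
  exact ((integrable_kern hh hΩ hM hD hm hv).comp_sub_left x).mul_bdd
    hβ.aestronglyMeasurable (Eventually.of_forall hB)

/-- The pointwise error of the approximation of `ringOp` by convolutions. -/
def ringError (h δ M C : ℝ) (Q : ℝ) (Ω : E → ℝ) (D : ℝ) (β : E → ℂ) (x : E) : ENNReal :=
  ∫⁻ y, (closedBall (0 : E) (Q * D)).indicator (fun z => ENNReal.ofReal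
    (C * (D ^ Module.finrank ℝ E)⁻¹) * angularError h δ M Ω z) (x - y) * ‖β y‖ₑ

theorem enorm_ringOp_sub_le (hK : IsStandardKernel C₀ δ K) (hC₀ : 0 < C₀) (hδ : 0 < δ)
    (hδ1 : δ ≤ 1) (hΛ : 1 ≤ Λ) (hh : 0 < h) (hh1 : h ≤ 1) {m₀ m₁ : ℕ} (hm₀1 : 1 ≤ m₀)
    (hm₀ : 1 ≤ 4 * h * m₀) (hm₀' : h * (m₀ + 1) ≤ 1) (hm₁' : 2 * Λ ≤ h * m₁)
    (hm₁ : h * (m₁ + 1) ≤ Q) (hV : ∀ v ∈ V, ‖v‖ = 1)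
    (hnet : ∀ θ : E, ‖θ‖ = 1 → ∃ v ∈ V, dist θ v < h)
    (hΩ : Measurable Ω) (hhom : ∀ r : ℝ, 0 < r → ∀ z : E, z ≠ 0 → Ω (r • z) = Ω z)
    (hint : Integrable (fun θ : sphere (0 : E) 1 => Ω θ) (volume : Measure E).toSphere)
    {M : ℝ} (hM : 0 ≤ M) {D : ℝ} (hD : 0 < D) {β : E → ℂ} (hβ : Continuous β)
    (hβc : HasCompactSupport β) {y₀ : E} (hβs : ∀ y, D * h < ‖y - y₀‖ → β y = 0) (x : E) :
    ‖ringOp Ω K Λ D β x - ∑ v ∈ V, ∑ m ∈ Finset.Ico m₀ m₁, C₀ * coef C₀ K Λ h D y₀ m v *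
      conv (fun z => (kern V h (truncate M Ω) D m v z : ℂ)) β x‖ₑ ≤
    ringError h δ M (201 * Module.finrank ℝ E * (Q + 3) * (32 * Q) ^ Module.finrank ℝ E * C₀) Q Ω D
      β x := by
  have hTm := measurable_truncate M hΩ
  have hkint : ∀ v ∈ V, ∀ m ∈ Finset.Ico m₀ m₁, Integrable fun y =>
      C₀ * coef C₀ K Λ h D y₀ m v * ((kern V h (truncate M Ω) D m v (x - y) : ℂ) * β y) :=
    fun v hv m hm => (integrable_kern_mul hh hTm (abs_truncate_le hM Ω) hD
      (hm₀1.trans (Finset.mem_Ico.1 hm).1) hv hβ hβc x).const_mul _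
  have hsum : ∑ v ∈ V, ∑ m ∈ Finset.Ico m₀ m₁, C₀ * coef C₀ K Λ h D y₀ m v *
      conv (fun z => (kern V h (truncate M Ω) D m v z : ℂ)) β x =
      ∫ y, ∑ v ∈ V, ∑ m ∈ Finset.Ico m₀ m₁,
        C₀ * coef C₀ K Λ h D y₀ m v * ((kern V h (truncate M Ω) D m v (x - y) : ℂ) * β y) := by
    rw [integral_finsetSum _ fun v hv => integrable_finsetSum _ fun m hm => hkint v hv m hm]
    refine Finset.sum_congr rfl fun v hv => ?_
    rw [integral_finsetSum _ fun m hm => hkint v hv m hm]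
    refine Finset.sum_congr rfl fun m _ => ?_
    rw [conv_apply, integral_const_mul]
  rw [hsum, ringOp, ← integral_sub (hK.integrable_ringOp hC₀ hδ hΩ hhom hint hΛ hD hβ hβc x)
    (integrable_finsetSum _ fun v hv => integrable_finsetSum _ fun m hm => hkint v hv m hm)]
  refine (enorm_integral_le_lintegral_enorm _).trans (lintegral_mono fun y => ?_)
  by_cases hy : D * h < ‖y - y₀‖
  · simp [hβs y hy]
  · have := norm_kernel_sub_approx_le (Ω := Ω) (M := M) hK hC₀ hδ hδ1 hΛ hh hh1 hm₀ hm₀' hm₁' hm₁ hV hnet hD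
      (x := x) (not_lt.1 hy)
    have h2 := mul_le_mul_left this ‖β y‖ₑ
    rw [← enorm_mul, sub_mul, Finset.sum_mul] at h2
    refine le_trans (le_of_eq ?_) h2
    congr 2
    · ring
    · refine Finset.sum_congr rfl fun v _ => ?_
      rw [Finset.sum_mul]
      exact Finset.sum_congr rfl fun m _ => by ring

theorem measurable_ringError (h δ M C Q : ℝ) (hΩ : Measurable Ω) (D : ℝ) {β : E → ℂ}
    (hβ : Measurable β) : Measurable (ringError h δ M C Q Ω D β) := by
  refine Measurable.lintegral_prod_right' (f := fun p : E × E =>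
    (closedBall (0 : E) (Q * D)).indicator (fun z => ENNReal.ofReal
    (C * (D ^ Module.finrank ℝ E)⁻¹) * angularError h δ M Ω z) (p.1 - p.2) * ‖β p.2‖ₑ) ?_
  refine Measurable.mul ?_ (hβ.enorm.comp measurable_snd)
  exact (((measurable_angularError h δ M hΩ).const_mul _).indicator measurableSet_closedBall).comp
    (measurable_fst.sub measurable_snd)

theorem lintegral_ringError_le {h δ M C Q : ℝ} (hC : 0 ≤ C) (hQ : 0 ≤ Q) (hΩ : Measurable Ω)
    (hhom : ∀ r : ℝ, 0 < r → ∀ z : E, z ≠ 0 → Ω (r • z) = Ω z) {D : ℝ} (hD : 0 < D) {β : E → ℂ}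
    (hβ : Measurable β) :
    ∫⁻ x, ringError h δ M C Q Ω D β x ≤ ENNReal.ofReal (C * Q ^ Module.finrank ℝ E) *
      (∫⁻ θ : sphere (0 : E) 1, angularError h δ M Ω θ ∂(volume : Measure E).toSphere) *
      ∫⁻ y, ‖β y‖ₑ := by
  set F : E → ENNReal := (closedBall (0 : E) (Q * D)).indicator (fun z => ENNReal.ofReal
    (C * (D ^ Module.finrank ℝ E)⁻¹) * angularError h δ M Ω z) with hF
  have hA := measurable_angularError h δ M hΩ
  have hFm : Measurable F := (hA.const_mul _).indicator measurableSet_closedBall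
  have hm : Measurable fun p : E × E => F (p.1 - p.2) * ‖β p.2‖ₑ :=
    (hFm.comp (measurable_fst.sub measurable_snd)).mul (hβ.enorm.comp measurable_snd)
  have h1 : ∫⁻ x, ringError h δ M C Q Ω D β x = (∫⁻ z, F z) * ∫⁻ y, ‖β y‖ₑ := by
    simp only [ringError, ← hF]
    rw [lintegral_lintegral_swap hm.aemeasurable, ← lintegral_const_mul _ hβ.enorm]
    refine lintegral_congr fun z => ?_
    rw [lintegral_mul_const _ (by exact hFm.comp (measurable_id.sub_const z)),
      lintegral_sub_right_eq_self (fun x => F x) z]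
  rw [h1]
  refine mul_le_mul_left ?_ _
  rw [hF, lintegral_indicator measurableSet_closedBall, lintegral_const_mul _ hA]
  have h2 := lintegral_closedBall_homogeneous_le hA (fun r hr z hz => by
    simp only [angularError, hhom r hr z hz]) (R := Q * D) (by positivity)
  refine (mul_le_mul_right h2 _).trans (le_of_eq ?_)
  rw [← mul_assoc, ← ENNReal.ofReal_mul (by positivity)]
  congr 2
  field_simp
  ring

end RingOperators

section SquareSums

theorem sq_sum_range_le (a : ℕ → ENNReal) (N : ℕ) :
    (∑ n ∈ Finset.range N, a n) ^ 2 ≤ ∑ n ∈ Finset.range N, 2 ^ (n + 1) * a n ^ 2 := by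
  induction N generalizing a with
  | zero => simp
  | succ N ih =>
    rw [Finset.sum_range_succ', Finset.sum_range_succ' (fun n => 2 ^ (n + 1) * a n ^ 2)]
    have h := ENNReal.rpow_add_le_mul_rpow_add_rpow (∑ n ∈ Finset.range N, a (n + 1)) (a 0)
      (p := 2) one_le_two
    have h1 : (2 : ℝ) - 1 = 1 := by norm_num
    simp only [h1, ENNReal.rpow_one, ENNReal.rpow_two] at h
    refine h.trans ?_
    rw [mul_add]
    refine add_le_add ?_ (by simp)
    refine (mul_le_mul_right (ih fun n => a (n + 1)) 2).trans (le_of_eq ?_)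
    rw [Finset.mul_sum]
    exact Finset.sum_congr rfl fun n _ => by ring

theorem sq_tsum_le (a : ℕ → ENNReal) : (∑' n, a n) ^ 2 ≤ ∑' n, 2 ^ (n + 1) * a n ^ 2 := by
  have h := ((ENNReal.continuous_pow 2).tendsto _).comp
    (ENNReal.summable (f := a)).hasSum.tendsto_sum_nat
  exact le_of_tendsto' h fun N => (sq_sum_range_le a N).trans (ENNReal.sum_le_tsum _)

theorem lintegral_sq_tsum_le {X : Type*} [MeasurableSpace X] {μ : Measure X} {a : ℕ → X → ENNReal}
    (ha : ∀ n, Measurable (a n)) {B : ℝ} (hB : 0 ≤ B)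
    (hle : ∀ n, ∫⁻ x, a n x ^ 2 ∂μ ≤ ENNReal.ofReal (((2 ^ (n + 1)) ^ 2)⁻¹ * B)) :
    ∫⁻ x, (∑' n, a n x) ^ 2 ∂μ ≤ ENNReal.ofReal B := by
  refine (lintegral_mono fun x => sq_tsum_le fun n => a n x).trans ?_
  rw [lintegral_tsum fun n => (((ha n).pow_const 2).const_mul _).aemeasurable]
  have h1 : ∀ n : ℕ, ∫⁻ x, 2 ^ (n + 1) * a n x ^ 2 ∂μ ≤ ENNReal.ofReal ((1 / 2) ^ (n + 1) * B) := by
    intro n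
    rw [lintegral_const_mul _ ((ha n).pow_const 2)]
    refine (mul_le_mul_right (hle n) _).trans (le_of_eq ?_)
    have : (2 : ENNReal) ^ (n + 1) = ENNReal.ofReal (2 ^ (n + 1)) := by
      rw [ENNReal.ofReal_pow zero_le_two, ENNReal.ofReal_ofNat]
    rw [this, ← ENNReal.ofReal_mul (by positivity)]
    congr 1
    rw [one_div, inv_pow]
    field_simp
  refine (ENNReal.tsum_le_tsum h1).trans (le_of_eq ?_)
  have hs : HasSum (fun n : ℕ => (1 / 2 : ℝ) ^ (n + 1) * B) B := by
    have := (hasSum_geometric_two.mul_left (1 / 2 : ℝ)).mul_right B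
    simpa [pow_succ, mul_comm, mul_left_comm] using this
  rw [← ENNReal.ofReal_tsum_of_nonneg (fun n => by positivity) hs.summable, hs.tsum_eq]

end SquareSums

section BadPart
variable {E : Type*} [NormedAddCommGroup E] [InnerProductSpace ℝ E] [FiniteDimensional ℝ E]
  [MeasurableSpace E] [BorelSpace E] [Nontrivial E]

/-- The weight `|Ω| (1 + log⁺ (|Ω| / ω))`. -/
def logWeight (ω : ℝ) (Ω : E → ℝ) (z : E) : ℝ := |Ω z| * (1 + max (Real.log (|Ω z| / ω)) 0)

theorem tsum_angularError_le {δ : ℝ} (hδ : 0 < δ) {ω : ℝ} (hω : 0 < ω) (Ω : E → ℝ) (z : E) :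
    ∑' n : ℕ, angularError ((2 ^ (n + 1)) ^ 8 : ℝ)⁻¹ δ (2 ^ (n + 1) * ω) Ω z ≤
      ENNReal.ofReal ((1 - (1 / 2) ^ δ)⁻¹ + (Real.log 2)⁻¹) * ENNReal.ofReal (logWeight ω Ω z) := by
  set w := |Ω z| with hw
  have hw0 : 0 ≤ w := abs_nonneg _
  set r : ℝ := (1 / 2) ^ δ with hr
  have hr0 : 0 < r := by positivity
  have hr1 : r < 1 := Real.rpow_lt_one (by norm_num) (by norm_num) hδ
  have hl2 : 0 < Real.log 2 := Real.log_pos one_lt_two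
  set L := max (Real.log (w / ω)) 0 with hL
  have hL0 : 0 ≤ L := le_max_right _ _
  have hfirst : ∑' n : ℕ, ENNReal.ofReal (((2 ^ (n + 1)) ^ 8 : ℝ)⁻¹ ^ δ * w) ≤
      ENNReal.ofReal ((1 - r)⁻¹ * w) := by
    have hs : HasSum (fun n : ℕ => r ^ n * w) ((1 - r)⁻¹ * w) :=
      (hasSum_geometric_of_lt_one hr0.le hr1).mul_right w
    rw [← hs.tsum_eq, ENNReal.ofReal_tsum_of_nonneg (fun n => by positivity) hs.summable]
    refine ENNReal.tsum_le_tsum fun n => ENNReal.ofReal_le_ofReal ?_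
    refine mul_le_mul_of_nonneg_right ?_ hw0
    rw [hr, ← Real.rpow_natCast ((1 / 2 : ℝ) ^ δ), ← Real.rpow_mul (by norm_num), mul_comm δ,
      Real.rpow_mul (by norm_num), Real.rpow_natCast]
    refine Real.rpow_le_rpow (by positivity) ?_ hδ.le
    rw [one_div, inv_pow, ← pow_mul]
    exact inv_anti₀ (by positivity) (pow_le_pow_right₀ one_le_two (by omega))
  have hsecond : ∑' n : ℕ, (if 2 ^ (n + 1) * ω < w then ENNReal.ofReal w else 0) ≤
      ENNReal.ofReal ((Real.log 2)⁻¹ * L * w) := by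
    have hz : ∀ n ∉ Finset.range ⌊(Real.log 2)⁻¹ * L⌋₊,
        (if 2 ^ (n + 1) * ω < w then ENNReal.ofReal w else 0) = 0 := by
      intro n hn
      rw [if_neg]
      intro hlt
      refine hn (Finset.mem_range.2 (Nat.lt_of_succ_le (Nat.le_floor ?_)))
      have h1 : (2 : ℝ) ^ (n + 1) < w / ω := (lt_div_iff₀ hω).2 hlt
      have h2 := Real.log_lt_log (by positivity) h1
      rw [Real.log_pow] at h2
      rw [inv_mul_eq_div, le_div_iff₀ hl2]
      push_cast at h2 ⊢
      exact h2.le.trans (le_max_left _ _)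
    rw [tsum_eq_sum hz]
    refine (Finset.sum_le_card_nsmul _ _ (ENNReal.ofReal w) fun n _ => ?_).trans ?_
    · split_ifs <;> simp
    · rw [Finset.card_range, nsmul_eq_mul, ← ENNReal.ofReal_natCast,
        ← ENNReal.ofReal_mul (Nat.cast_nonneg _)]
      refine ENNReal.ofReal_le_ofReal (mul_le_mul_of_nonneg_right (Nat.floor_le (by positivity)) hw0)
  simp only [angularError, ← hw]
  rw [ENNReal.tsum_add]
  refine (add_le_add hfirst hsecond).trans ?_
  have h1r : 0 < 1 - r := by linarith
  rw [← ENNReal.ofReal_add (by positivity) (by positivity), ← ENNReal.ofReal_mul (by positivity)]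
  refine ENNReal.ofReal_le_ofReal ?_
  rw [logWeight, ← hw, ← hL]
  have e1 : 0 ≤ (1 - r)⁻¹ * w * L := by positivity
  have e2 : 0 ≤ (Real.log 2)⁻¹ * w := by positivity
  nlinarith

theorem tsum_lintegral_angularError_le {δ : ℝ} (hδ : 0 < δ) {ω : ℝ} (hω : 0 < ω) {Ω : E → ℝ}
    (hΩ : Measurable Ω)
    (hW : Integrable (fun θ : sphere (0 : E) 1 => logWeight ω Ω θ) (volume : Measure E).toSphere) :
    ∑' n : ℕ, ∫⁻ θ : sphere (0 : E) 1,
      angularError ((2 ^ (n + 1)) ^ 8 : ℝ)⁻¹ δ (2 ^ (n + 1) * ω) Ω θ ∂(volume : Measure E).toSphere ≤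
      ENNReal.ofReal (((1 - (1 / 2) ^ δ)⁻¹ + (Real.log 2)⁻¹) *
        ∫ θ : sphere (0 : E) 1, logWeight ω Ω θ ∂(volume : Measure E).toSphere) := by
  have h0 : 0 ≤ (1 - (1 / 2 : ℝ) ^ δ)⁻¹ + (Real.log 2)⁻¹ := by
    have h1 : (1 / 2 : ℝ) ^ δ < 1 := Real.rpow_lt_one (by norm_num) (by norm_num) hδ
    have h2 : 0 < Real.log 2 := Real.log_pos one_lt_two
    have h3 : 0 < 1 - (1 / 2 : ℝ) ^ δ := by linarith
    positivity
  have hnn : ∀ z : E, 0 ≤ logWeight ω Ω z := fun z => by rw [logWeight]; positivity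
  have hm : ∀ n : ℕ, Measurable fun θ : sphere (0 : E) 1 =>
      angularError ((2 ^ (n + 1)) ^ 8 : ℝ)⁻¹ δ (2 ^ (n + 1) * ω) Ω θ := fun n =>
    (measurable_angularError _ δ _ hΩ).comp measurable_subtype_coe
  rw [← lintegral_tsum fun n => (hm n).aemeasurable,
    ENNReal.ofReal_mul h0, ofReal_integral_eq_lintegral_ofReal hW (Eventually.of_forall fun θ => hnn θ),
    ← lintegral_const_mul' _ _ (by simp)]
  exact lintegral_mono fun θ => tsum_angularError_le hδ hω Ω θ

/-- The dilation factor between consecutive rings. -/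
def ringRatio (E : Type*) [NormedAddCommGroup E] [InnerProductSpace ℝ E] : ℕ :=
  2 ^ (16 * Module.finrank ℝ E + 16)

/-- Decomposition of the singular integral of a family of atoms, off the diagonal. -/
theorem IsAtomFamily.exists_ringOp_bound (E : Type*) [NormedAddCommGroup E]
    [InnerProductSpace ℝ E] [FiniteDimensional ℝ E] [MeasurableSpace E] [BorelSpace E]
    [Nontrivial E] {C₀ δ : ℝ} (hC₀ : 0 < C₀) (hδ : 0 < δ) (hδ1 : δ ≤ 1) :
    ∃ C : ℝ, 0 < C ∧ ∀ (ι : Type) [Fintype ι] (α : ℝ) (y : ι → E) (q : ι → ℤ) (b : ι → E → ℂ),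
      IsAtomFamily α y q b → 0 ≤ α → ∀ (K : E → E → ℂ) (Ω : E → ℝ) (ω : ℝ),
      IsStandardKernel C₀ δ K → Measurable Ω →
      (∀ r : ℝ, 0 < r → ∀ z : E, z ≠ 0 → Ω (r • z) = Ω z) →
      Integrable (fun θ : sphere (0 : E) 1 => Ω θ) (volume : Measure E).toSphere →
      (∫ θ : sphere (0 : E) 1, |Ω θ| ∂(volume : Measure E).toSphere) ≤ ω → 0 < ω →
      Integrable (fun θ : sphere (0 : E) 1 => logWeight ω Ω θ) (volume : Measure E).toSphere →
      ∃ F₁ F₂ : E → ENNReal, Measurable F₁ ∧ Measurable F₂ ∧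
        (∀ N x, ‖∑ n ∈ Finset.range N, ∑ i,
          ringOp Ω K (ringRatio E) ((ringRatio E) ^ (n + 1) * 2 ^ q i) (b i) x‖ₑ ≤ F₁ x + F₂ x) ∧
        ∫⁻ x, F₁ x ≤ ENNReal.ofReal (C *
          (∫ θ : sphere (0 : E) 1, logWeight ω Ω θ ∂(volume : Measure E).toSphere) *
          ∑ i, ∫ z, ‖b i z‖) ∧
        ∫⁻ x, F₂ x ^ 2 ≤ ENNReal.ofReal (C * ω ^ 2 * α * ∑ i, ∫ z, ‖b i z‖) := by
  set d := Module.finrank ℝ E with hd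
  have hΛ1 : 1 ≤ ringRatio E := Nat.one_le_two_pow
  have hΛr : (ringRatio E : ℝ) = 2 ^ (16 * d + 16) := by rw [ringRatio]; push_cast; rfl
  generalize ringRatio E = Λ at hΛ1 hΛr ⊢
  have hΛ1' : (1 : ℝ) ≤ Λ := by exact_mod_cast hΛ1
  set Q : ℝ := 2 * Λ + 1 with hQ
  have hQ1 : 1 ≤ Q := by linarith
  obtain ⟨C₁, hC₁, hA⟩ := IsAtomFamily.exists_sum_dirPart_bound E Q hQ1
  set C₂ : ℝ := 201 * d * (Q + 3) * (32 * Q) ^ d * C₀ with hC₂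
  have hC₂0 : 0 ≤ C₂ := by positivity
  set C₃ : ℝ := (1 - (1 / 2 : ℝ) ^ δ)⁻¹ + (Real.log 2)⁻¹ with hC₃
  have hC₃0 : 0 < C₃ := by
    have h1 : (1 / 2 : ℝ) ^ δ < 1 := Real.rpow_lt_one (by norm_num) (by norm_num) hδ
    have h2 : 0 < Real.log 2 := Real.log_pos one_lt_two
    have h3 : 0 < 1 - (1 / 2 : ℝ) ^ δ := by linarith
    positivity
  refine ⟨C₂ * Q ^ d * C₃ + C₀ ^ 2 * C₁, by positivity, ?_⟩
  intro ι _ α y q b hb hα K Ω ω hK hΩ hhom hint hω hω0 hW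
  set S := ∑ i, ∫ z, ‖b i z‖ with hS
  have hS0 : 0 ≤ S := Finset.sum_nonneg fun i _ => integral_nonneg fun _ => norm_nonneg _
  set J := ∫ θ : sphere (0 : E) 1, logWeight ω Ω θ ∂(volume : Measure E).toSphere with hJ
  have hJ0 : 0 ≤ J := integral_nonneg fun θ => by rw [logWeight]; positivity
  set t : ℕ → ℝ := fun n => 2 ^ (n + 1) with ht
  set h : ℕ → ℝ := fun n => (t n ^ 8)⁻¹ with hh
  set s : ℕ → ℤ := fun n => ((16 * d + 16) * (n + 1) : ℕ) with hs
  have ht2 : ∀ n, 2 ≤ t n := fun n => by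
    simp only [ht, pow_succ]
    nlinarith [one_le_pow₀ (one_le_two : (1 : ℝ) ≤ 2) (n := n)]
  have hh0 : ∀ n, 0 < h n := fun n => by have := ht2 n; simp only [hh]; positivity
  have hh1 : ∀ n, h n ≤ 1 / 2 := fun n => by
    simp only [hh]
    rw [one_div]
    refine inv_anti₀ two_pos ((ht2 n).trans (le_self_pow₀ (by linarith [ht2 n]) (by norm_num)))
  choose V hV1 hVsep hVnet using fun n => exists_sphere_net (E := E) (half_pos (hh0 n))
  have hVnet' : ∀ n, ∀ θ : E, ‖θ‖ = 1 → ∃ v ∈ V n, dist θ v < h n := fun n θ hθ => by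
    obtain ⟨v, hv, hlt⟩ := hVnet n θ hθ
    exact ⟨v, hv, hlt.trans (half_lt_self (hh0 n))⟩
  set m₀ : ℕ → ℕ := fun n => 2 ^ (8 * (n + 1) - 1) with hm₀
  set m₁ : ℕ → ℕ := fun n => 2 * Λ * 2 ^ (8 * (n + 1)) with hm₁
  have hm₀r : ∀ n, h n * m₀ n = 1 / 2 := fun n => by
    have : t n ^ 8 = 2 * m₀ n := by
      simp only [ht, hm₀]
      push_cast
      rw [← pow_mul, ← pow_succ']
      congr 1
      omega
    simp only [hh, this]
    have : (0 : ℝ) < m₀ n := by simp only [hm₀]; positivity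
    field_simp
  have hm₁r : ∀ n, h n * m₁ n = 2 * Λ := fun n => by
    have : (m₁ n : ℝ) = 2 * Λ * t n ^ 8 := by
      simp only [ht, hm₁]
      push_cast
      rw [← pow_mul, mul_comm 8]
    have h8 : 0 < t n ^ 8 := by have := ht2 n; positivity
    simp only [hh, this]
    rw [inv_mul_eq_div, mul_div_assoc, div_self h8.ne', mul_one]
  have hm₀1 : ∀ n, 1 ≤ m₀ n := fun n => Nat.one_le_two_pow
  have hm01 : ∀ n, m₀ n ≤ m₁ n := fun n => by
    simp only [hm₀, hm₁]
    calc 2 ^ (8 * (n + 1) - 1) ≤ 2 ^ (8 * (n + 1)) := Nat.pow_le_pow_right two_pos (by omega)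
      _ ≤ _ := Nat.le_mul_of_pos_left _ (by omega)
  have e1 : ∀ n, 1 ≤ 4 * h n * m₀ n := fun n => by rw [mul_assoc, hm₀r]; norm_num
  have e2 : ∀ n, h n * (m₀ n + 1) ≤ 1 := fun n => by rw [mul_add, hm₀r]; linarith [hh1 n]
  have e3 : ∀ n, 2 * (Λ : ℝ) ≤ h n * m₁ n := fun n => (hm₁r n).ge
  have e4 : ∀ n, h n * (m₁ n + 1) ≤ Q := fun n => by rw [mul_add, hm₁r]; linarith [hh1 n]
  have hs2 : ∀ n, (2 : ℝ) ^ s n = t n ^ (16 * d + 16) := fun n => by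
    simp only [hs, ht]
    rw [zpow_natCast, ← pow_mul, mul_comm]
  have hDeq : ∀ n i, (2 : ℝ) ^ (q i + s n) = (Λ : ℝ) ^ (n + 1) * 2 ^ q i := fun n i => by
    rw [zpow_add₀ two_ne_zero, hs2, hΛr, mul_comm]
    simp only [ht]
    rw [← pow_mul, ← pow_mul, mul_comm (n + 1)]
  have hDh : ∀ n i, (2 : ℝ) ^ q i ≤ 2 ^ (q i + s n) * h n := fun n i => by
    have h8 : 0 < t n ^ 8 := by have := ht2 n; positivity
    rw [zpow_add₀ two_ne_zero, hs2, mul_assoc]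
    refine le_mul_of_one_le_right (by positivity) ?_
    simp only [hh]
    rw [← div_eq_mul_inv, one_le_div h8]
    exact pow_le_pow_right₀ (by linarith [ht2 n]) (by omega)
  set c : ℕ → ι → ℕ → E → ℂ := fun n i m v =>
    coef C₀ K Λ (h n) (2 ^ (q i + s n)) (y i) m v with hc
  have hc1 : ∀ n i m v, ‖c n i m v‖ ≤ 1 := fun n i m v =>
    norm_coef_le hK hC₀ hΛ1' (by positivity) _ _ _ _
  set Ωt : ℕ → E → ℝ := fun n => truncate (t n * ω) Ω with hΩt
  have htω : ∀ n, 0 ≤ t n * ω := fun n => mul_nonneg (by linarith [ht2 n]) hω0.le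
  have hΩtm : ∀ n, Measurable (Ωt n) := fun n => measurable_truncate _ hΩ
  have hΩtM : ∀ n z, |Ωt n z| ≤ t n * ω := fun n z => abs_truncate_le (htω n) Ω z
  have hΩth : ∀ n, ∀ r : ℝ, 0 < r → ∀ z : E, z ≠ 0 → Ωt n (r • z) = Ωt n z := fun n r hr z hz => by
    simp only [hΩt, truncate, hhom r hr z hz]
  have hΩtω : ∀ n, (∫ θ : sphere (0 : E) 1, |Ωt n θ| ∂(volume : Measure E).toSphere) ≤ ω := fun n => by
    refine le_trans ?_ hω
    exact integral_mono_of_nonneg (Eventually.of_forall fun θ => abs_nonneg _) hint.abs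
      (Eventually.of_forall fun θ => abs_truncate_le_abs _ _ _)
  set G : ℕ → E → ℂ := fun n x => ∑ v ∈ V n,
    dirPart q b (V n) (h n) (Ωt n) (s n) (Finset.Ico (m₀ n) (m₁ n)) (c n) v x with hG
  set R : ℕ → E → ENNReal := fun n x => ∑ i,
    ringError (h n) δ (t n * ω) C₂ Q Ω (2 ^ (q i + s n)) (b i) x with hR
  have hGc : ∀ n, Continuous (G n) := fun n => by
    refine continuous_finsetSum _ fun v hv => ?_
    exact (hb.dirPart_smooth (hh0 n) (hΩtm n) (hΩtM n) hv
      (fun m hm => (hm₀1 n).trans (Finset.mem_Ico.1 hm).1) (s n) (c n)).1.continuous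
  have hbm : ∀ i, Measurable (b i) := fun i => (hb.contDiff i).continuous.measurable
  have hRm : ∀ n, Measurable (R n) := fun n =>
    Finset.measurable_fun_sum _ fun i _ => measurable_ringError _ _ _ _ _ hΩ _ (hbm i)
  have hpt : ∀ n x, ‖∑ i, ringOp Ω K Λ ((Λ : ℝ) ^ (n + 1) * 2 ^ q i) (b i) x‖ₑ ≤
      R n x + ENNReal.ofReal C₀ * ‖G n x‖ₑ := by
    intro n x
    have hsplit : ∑ i, ringOp Ω K Λ ((Λ : ℝ) ^ (n + 1) * 2 ^ q i) (b i) x =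
        ∑ i, (ringOp Ω K Λ (2 ^ (q i + s n)) (b i) x - ∑ v ∈ V n, ∑ m ∈ Finset.Ico (m₀ n) (m₁ n),
          C₀ * c n i m v * conv (fun z => (kern (V n) (h n) (Ωt n) (2 ^ (q i + s n)) m v z : ℂ))
            (b i) x) + C₀ * G n x := by
      rw [Finset.sum_sub_distrib]
      simp only [hDeq]
      have : (C₀ : ℂ) * G n x = ∑ i, ∑ v ∈ V n, ∑ m ∈ Finset.Ico (m₀ n) (m₁ n),
          C₀ * c n i m v * conv (fun z => (kern (V n) (h n) (Ωt n) ((Λ : ℝ) ^ (n + 1) * 2 ^ q i)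
            m v z : ℂ)) (b i) x := by
        rw [Finset.sum_comm]
        simp only [hG, Finset.mul_sum, dirPart, Finset.sum_product, hDeq, mul_assoc]
      rw [this]
      ring
    rw [hsplit]
    refine (enorm_add_le _ _).trans (add_le_add ?_ ?_)
    · refine (enorm_sum_le _ _).trans (Finset.sum_le_sum fun i _ => ?_)
      refine enorm_ringOp_sub_le hK hC₀ hδ hδ1 hΛ1' (hh0 n) ((hh1 n).trans (by norm_num)) (hm₀1 n)
        (e1 n) (e2 n) (e3 n) (e4 n) (hV1 n) (hVnet' n) hΩ hhom hint (htω n) (by positivity)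
        (hb.contDiff i).continuous (hb.hasCompactSupport i) (fun z hz => hb.support i z ?_) x
      rw [mem_closedBall, dist_eq_norm, not_le]
      exact (hDh n i).trans_lt hz
    · rw [enorm_mul, ← ofReal_norm, Complex.norm_real, Real.norm_of_nonneg hC₀.le]
  refine ⟨fun x => ∑' n, R n x, fun x => ENNReal.ofReal C₀ * ∑' n, ‖G n x‖ₑ,
    Measurable.tsum hRm,
    (Measurable.tsum fun n => (hGc n).measurable.enorm).const_mul _, ?_, ?_, ?_⟩
  · intro N x
    refine (enorm_sum_le _ _).trans ((Finset.sum_le_sum fun n _ => hpt n x).trans ?_)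
    rw [Finset.sum_add_distrib, ← Finset.mul_sum]
    exact add_le_add (ENNReal.sum_le_tsum _) (mul_le_mul_right (ENNReal.sum_le_tsum _) _)
  · rw [lintegral_tsum fun n => (hRm n).aemeasurable]
    have h1 : ∀ n, ∫⁻ x, R n x ≤ ENNReal.ofReal (C₂ * Q ^ d * S) * ∫⁻ θ : sphere (0 : E) 1,
        angularError (h n) δ (t n * ω) Ω θ ∂(volume : Measure E).toSphere := by
      intro n
      simp only [hR]
      rw [lintegral_finsetSum _ fun i _ => measurable_ringError _ _ _ _ _ hΩ _ (hbm i)]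
      refine (Finset.sum_le_sum fun i _ => lintegral_ringError_le hC₂0 (by linarith) hΩ hhom
        (by positivity) (hbm i)).trans (le_of_eq ?_)
      rw [← Finset.mul_sum, Finset.sum_congr rfl fun i _ => hb.lintegral_enorm i,
        ← ENNReal.ofReal_sum_of_nonneg fun i _ => integral_nonneg fun _ => norm_nonneg _, ← hS,
        mul_right_comm, ← ENNReal.ofReal_mul (by positivity)]
    refine (ENNReal.tsum_le_tsum h1).trans ?_
    rw [ENNReal.tsum_mul_left]
    refine (mul_le_mul_right (tsum_lintegral_angularError_le hδ hω0 hΩ hW) _).trans ?_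
    rw [← ENNReal.ofReal_mul (by positivity)]
    refine ENNReal.ofReal_le_ofReal ?_
    rw [← hC₃, ← hJ]
    have : 0 ≤ C₀ ^ 2 * C₁ * J * S := by positivity
    linarith
  · have h2 : ∀ n, ∫⁻ x, ‖G n x‖ₑ ^ 2 ≤ ENNReal.ofReal (((2 ^ (n + 1)) ^ 2)⁻¹ * (C₁ * ω ^ 2 * α * S)) := by
      intro n
      refine (hA ι α y q b hb hα (V n) (h n) (t n) (Ωt n) ω (s n) (m₀ n) (m₁ n) (c n) (hV1 n)
        (hVsep n) (ht2 n) rfl (hs2 n) (hΩtm n) (hΩtM n) (hΩth n) (hΩtω n) (hm01 n) (hm₀1 n) (e1 n)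
        (e4 n) (hc1 n)).trans (le_of_eq ?_)
      congr 1
      simp only [ht, ← hS]
      ring
    simp only [mul_pow]
    rw [lintegral_const_mul' _ _ (by simp)]
    refine (mul_le_mul_right (lintegral_sq_tsum_le (fun n => (hGc n).measurable.enorm)
      (by positivity) h2) _).trans ?_
    rw [← ENNReal.ofReal_pow hC₀.le, ← ENNReal.ofReal_mul (by positivity)]
    refine ENNReal.ofReal_le_ofReal ?_
    have : 0 ≤ C₂ * Q ^ d * C₃ * ω ^ 2 * α * S := by positivity
    linarith

end BadPart

section OffDiagonal
variable {E : Type*} [NormedAddCommGroup E] [InnerProductSpace ℝ E] [FiniteDimensional ℝ E]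
  [MeasurableSpace E] [BorelSpace E] [Nontrivial E]
variable {C₀ δ : ℝ} {K : E → E → ℂ} {Ω : E → ℝ}
variable {ι : Type*} [Fintype ι] {α : ℝ} {y : ι → E} {q : ι → ℤ} {b : ι → E → ℂ}

theorem two_le_ringRatio : (2 : ℝ) ≤ ringRatio E := by
  rw [ringRatio]
  push_cast
  exact le_self_pow₀ one_le_two (by omega)

/-- Far from the atoms the truncated singular integrals are finite sums of ring operators. -/
theorem IsAtomFamily.exists_truncated_eq_sum_ringOp (hb : IsAtomFamily α y q b)
    (hK : IsStandardKernel C₀ δ K) (hC₀ : 0 < C₀) (hδ : 0 < δ)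
    (hΩ : Measurable Ω) (hhom : ∀ r : ℝ, 0 < r → ∀ z : E, z ≠ 0 → Ω (r • z) = Ω z)
    (hint : Integrable (fun θ : sphere (0 : E) 1 => Ω θ) (volume : Measure E).toSphere) {x : E}
    (hx : ∀ i, x ∉ closedBall (y i) (3 * ringRatio E * 2 ^ q i)) :
    ∃ N : ℕ, ∀ᶠ ε : ℝ in 𝓝[>] 0,
      ∫ z in {z : E | ε < ‖x - z‖}, (Ω (x - z) : ℂ) * K x z * ∑ i, b i z =
        ∑ n ∈ Finset.range N, ∑ i,
          ringOp Ω K (ringRatio E) ((ringRatio E) ^ (n + 1) * 2 ^ q i) (b i) x := by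
  have hΛ2 := two_le_ringRatio (E := E)
  generalize (ringRatio E : ℝ) = Λ at hx hΛ2 ⊢
  have hΛ1 : 1 ≤ Λ := by linarith
  have hΛ0 : 0 < Λ := by linarith
  have hfar : ∀ i z, b i z ≠ 0 → 2 * (Λ * 2 ^ q i) ≤ ‖x - z‖ ∧ ‖x - z‖ ≤ ‖x - y i‖ + 2 ^ q i := by
    intro i z hz
    have hz' : ‖z - y i‖ ≤ 2 ^ q i := by
      by_contra hc
      exact hz (hb.support i z (by rwa [mem_closedBall, dist_eq_norm]))
    have hxi := hx i
    rw [mem_closedBall, dist_eq_norm, not_le] at hxi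
    have h2 : (0 : ℝ) < 2 ^ q i := by positivity
    have t1 : ‖x - y i‖ ≤ ‖x - z‖ + ‖z - y i‖ := norm_sub_le_norm_sub_add_norm_sub _ _ _
    have t2 : ‖x - z‖ ≤ ‖x - y i‖ + ‖y i - z‖ := norm_sub_le_norm_sub_add_norm_sub _ _ _
    rw [norm_sub_rev (y i)] at t2
    constructor <;> nlinarith
  obtain ⟨N, hN⟩ : ∃ N : ℕ, ∀ i, ‖x - y i‖ + 2 ^ q i ≤ Λ ^ N * (Λ * 2 ^ q i) := by
    have : ∀ᶠ N : ℕ in atTop, ∀ i, ‖x - y i‖ + 2 ^ q i ≤ Λ ^ N * (Λ * 2 ^ q i) := by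
      refine eventually_all.2 fun i => ?_
      exact ((tendsto_pow_atTop_atTop_of_one_lt (by linarith : 1 < Λ)).atTop_mul_const
        (by positivity)).eventually_ge_atTop _
    exact this.exists
  refine ⟨N, ?_⟩
  have hε : ∀ᶠ ε : ℝ in 𝓝[>] 0, ∀ i, ε < 2 * (Λ * 2 ^ q i) :=
    eventually_all.2 fun i => (eventually_lt_nhds (by positivity)).filter_mono nhdsWithin_le_nhds
  filter_upwards [hε] with ε hε
  rw [setIntegral_eq_integral_of_forall_compl_eq_zero]
  · simp only [ringOp]
    have hI : ∀ n : ℕ, ∀ i, Integrable fun z =>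
        (Ω (x - z) : ℂ) * K x z * (radialCut Λ (Λ ^ (n + 1) * 2 ^ q i) ‖x - z‖ * b i z) :=
      fun n i => hK.integrable_ringOp hC₀ hδ hΩ hhom hint hΛ1 (by positivity)
        (hb.contDiff i).continuous (hb.hasCompactSupport i) x
    simp only [← integral_finsetSum _ fun i _ => hI _ i]
    rw [← integral_finsetSum _ fun n _ => integrable_finsetSum _ fun i _ => hI n i]
    refine integral_congr_ae (Eventually.of_forall fun z => ?_)
    simp only []
    rw [Finset.sum_comm, Finset.mul_sum]
    refine Finset.sum_congr rfl fun i _ => ?_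
    rw [← Finset.mul_sum, ← Finset.sum_mul]
    by_cases hz : b i z = 0
    · simp [hz]
    · obtain ⟨h1, h2⟩ := hfar i z hz
      have hD : 0 < Λ * 2 ^ q i := by positivity
      have hs : ∑ n ∈ Finset.range N, radialCut Λ (Λ ^ (n + 1) * 2 ^ q i) ‖x - z‖ = 1 := by
        have := sum_radialCut Λ (Λ * 2 ^ q i) ‖x - z‖ N
        rw [rampCut_of_two_le ((le_div_iff₀ hD).2 h1), rampCut_of_le_one, sub_zero] at this
        · rw [← this]
          refine Finset.sum_congr rfl fun n _ => ?_
          rw [pow_succ, mul_assoc]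
        · exact (div_le_one (by positivity)).2 (h2.trans (hN i))
      rw [← Complex.ofReal_sum, hs, Complex.ofReal_one, one_mul]
  · intro z hz
    rw [Set.mem_ofPred_eq, not_lt] at hz
    have : ∀ i, b i z = 0 := fun i => by
      by_contra hc
      linarith [(hfar i z hc).1, hε i]
    simp [this]

/-- The truncated singular integrals of smooth functions converge absolutely. -/
theorem IsStandardKernel.integrableOn_truncated (hK : IsStandardKernel C₀ δ K) (hC₀ : 0 < C₀)
    (hδ : 0 < δ) (hΩ : Measurable Ω)
    (hhom : ∀ r : ℝ, 0 < r → ∀ z : E, z ≠ 0 → Ω (r • z) = Ω z)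
    (hint : Integrable (fun θ : sphere (0 : E) 1 => Ω θ) (volume : Measure E).toSphere)
    (x : E) {ε : ℝ} (hε : 0 < ε) {g : E → ℂ} (hg : Continuous g) (hgc : HasCompactSupport g) :
    IntegrableOn (fun z => (Ω (x - z) : ℂ) * K x z * g z) {z : E | ε < ‖x - z‖} := by
  have hs : MeasurableSet {z : E | ε < ‖x - z‖} :=
    (isOpen_lt continuous_const (by fun_prop)).measurableSet
  obtain ⟨B, hB⟩ := hg.bounded_above_of_compact_support hgc
  obtain ⟨R, hR⟩ := hgc.isCompact.isBounded.subset_closedBall x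
  rw [← integrable_indicator_iff hs]
  have := hK.integrable_mul hC₀ hδ hΩ hhom hint x (R := R) (B := B) hε
    (g := {z : E | ε < ‖x - z‖}.indicator g) (hg.aestronglyMeasurable.indicator hs)
    (fun z => (norm_indicator_le_norm_self _ _).trans (hB z)) fun z hz => by
      have hz1 := Set.mem_of_indicator_ne_zero hz
      rw [Set.indicator_of_mem hz1] at hz
      have h3 := hR (subset_tsupport _ hz)
      rw [mem_closedBall, dist_comm, dist_eq_norm] at h3
      exact ⟨le_of_lt hz1, h3⟩
  refine this.congr (Eventually.of_forall fun z => ?_)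
  simp only [Set.indicator_apply]
  split_ifs <;> simp

end OffDiagonal

section Dyadic
variable {d : ℕ}

/-- The index of the dyadic cube of side `2 ^ k` containing a point. -/
def dyadicIndex (k : ℤ) (x : EuclideanSpace ℝ (Fin d)) : Fin d → ℤ := fun i => ⌊x i / 2 ^ k⌋

/-- The dyadic cube of side `2 ^ k` with a given index. -/
def dyadicCube (k : ℤ) (n : Fin d → ℤ) : Set (EuclideanSpace ℝ (Fin d)) := {x | dyadicIndex k x = n}

theorem dyadicCube_eq_preimage (k : ℤ) (n : Fin d → ℤ) :
    dyadicCube k n = WithLp.ofLp ⁻¹'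
      Set.univ.pi fun i => Set.Ico ((2 : ℝ) ^ k * n i) ((2 : ℝ) ^ k * (n i + 1)) := by
  ext x
  have h2 : (0 : ℝ) < 2 ^ k := by positivity
  simp only [dyadicCube, dyadicIndex, Set.mem_ofPred_eq, funext_iff, Set.mem_preimage, Set.mem_univ_pi,
    Set.mem_Ico, Int.floor_eq_iff]
  refine forall_congr' fun i => and_congr ?_ ?_
  · rw [le_div_iff₀ h2, mul_comm]
  · rw [div_lt_iff₀ h2, mul_comm]

theorem measurableSet_dyadicCube (k : ℤ) (n : Fin d → ℤ) : MeasurableSet (dyadicCube k n) := by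
  rw [dyadicCube_eq_preimage]
  exact (PiLp.volume_preserving_ofLp (Fin d)).measurable
    (MeasurableSet.univ_pi fun i => measurableSet_Ico)

theorem volume_dyadicCube (k : ℤ) (n : Fin d → ℤ) :
    volume (dyadicCube k n) = ENNReal.ofReal ((2 ^ k) ^ d) := by
  rw [dyadicCube_eq_preimage, (PiLp.volume_preserving_ofLp (Fin d)).measure_preimage
    (MeasurableSet.univ_pi fun i => measurableSet_Ico).nullMeasurableSet, Real.volume_pi_Ico]
  have : ∀ i, (2 : ℝ) ^ k * (n i + 1) - 2 ^ k * n i = 2 ^ k := fun i => by ring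
  simp only [this, Finset.prod_const, Finset.card_univ, Fintype.card_fin]
  rw [ENNReal.ofReal_pow (by positivity)]

theorem dyadicIndex_eq_of_le {k l : ℤ} (hkl : k ≤ l) {x x' : EuclideanSpace ℝ (Fin d)}
    (h : dyadicIndex k x = dyadicIndex k x') : dyadicIndex l x = dyadicIndex l x' := by
  obtain ⟨m, rfl⟩ := Int.le.dest hkl
  have key : ∀ z : EuclideanSpace ℝ (Fin d), ∀ i,
      ⌊z i / (2 : ℝ) ^ (k + m : ℤ)⌋ = ⌊z i / (2 : ℝ) ^ k⌋ / (2 ^ m : ℕ) := by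
    intro z i
    rw [← Int.mul_natCast_floor_div_cancel (n := 2 ^ m) (by positivity)]
    congr 2
    rw [zpow_add₀ two_ne_zero, zpow_natCast]
    push_cast
    field_simp
  ext i
  simp only [dyadicIndex, key]
  rw [show ⌊x i / (2 : ℝ) ^ k⌋ = ⌊x' i / (2 : ℝ) ^ k⌋ from congrFun h i]

theorem norm_le_of_abs_apply_le {s : ℝ} (hs : 0 ≤ s) {x : EuclideanSpace ℝ (Fin d)}
    (h : ∀ i, |x i| ≤ s) : ‖x‖ ≤ d * s := by
  rw [EuclideanSpace.norm_eq, Real.sqrt_le_left (by positivity)]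
  calc ∑ i, ‖x i‖ ^ 2 ≤ ∑ _i : Fin d, s ^ 2 :=
        Finset.sum_le_sum fun i _ => pow_le_pow_left₀ (norm_nonneg _) (h i) 2
    _ = d * s ^ 2 := by simp
    _ ≤ (d * s) ^ 2 := by
        rw [mul_pow]
        refine mul_le_mul_of_nonneg_right ?_ (by positivity)
        exact_mod_cast Nat.le_self_pow two_ne_zero d

theorem norm_sub_le_of_dyadicIndex_eq {k : ℤ} {x x' : EuclideanSpace ℝ (Fin d)}
    (h : dyadicIndex k x = dyadicIndex k x') : ‖x - x'‖ ≤ d * 2 ^ k := by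
  have h2 : (0 : ℝ) < 2 ^ k := by positivity
  refine norm_le_of_abs_apply_le h2.le fun i => ?_
  have h1 := Int.abs_sub_lt_one_of_floor_eq_floor (congrFun h i)
  rw [← sub_div, abs_div, abs_of_pos h2, div_lt_one h2] at h1
  exact h1.le

/-- Stopping-time selection of dyadic cubes. -/
theorem exists_dyadic_selection {u : EuclideanSpace ℝ (Fin d) → ℝ} (hu : Continuous u)
    (huc : HasCompactSupport u) (hu0 : ∀ x, 0 ≤ u x) {α : ℝ} (hα : 0 < α) (hd : 1 ≤ d) (k₀ : ℤ) :
    ∃ (ι : Type) (_ : Fintype ι) (k : ι → ℤ) (y : ι → EuclideanSpace ℝ (Fin d))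
      (S : ι → Set (EuclideanSpace ℝ (Fin d))),
      (∀ i, MeasurableSet (S i)) ∧ Pairwise (Function.onFun Disjoint S) ∧ (∀ i, k₀ ≤ k i) ∧
      (∀ i, volume (S i) = ENNReal.ofReal ((2 ^ k i) ^ d)) ∧
      (∀ i, S i ⊆ closedBall (y i) (d * 2 ^ k i)) ∧
      (∀ i, α * (2 ^ k i) ^ d ≤ ∫ z in S i, u z) ∧
      (∀ i, ∫ z in S i, u z ≤ 2 ^ d * α * (2 ^ k i) ^ d) ∧
      ∀ x, (∀ i, x ∉ S i) → ∃ U : Set (EuclideanSpace ℝ (Fin d)), MeasurableSet U ∧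
        volume U = ENNReal.ofReal ((2 ^ k₀) ^ d) ∧ U ⊆ closedBall x (d * 2 ^ k₀) ∧
        ∫ z in U, u z ≤ α * (2 ^ k₀) ^ d := by
  classical
  have hui : Integrable u := hu.integrable_of_hasCompactSupport huc
  set bad : ℤ → EuclideanSpace ℝ (Fin d) → Prop := fun k x =>
    α * (2 ^ k) ^ d < ∫ z in dyadicCube k (dyadicIndex k x), u z with hbad
  have hbad_congr : ∀ {k l : ℤ} {x x'}, k ≤ l → dyadicIndex k x = dyadicIndex k x' →
      (bad l x ↔ bad l x') := fun hkl h => by simp only [hbad, dyadicIndex_eq_of_le hkl h]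
  obtain ⟨L, hL⟩ : ∃ L : ℕ, ∀ k : ℤ, (L : ℤ) ≤ k → ∀ x, ¬ bad k x := by
    obtain ⟨L, hL⟩ := pow_unbounded_of_one_lt ((∫ z, u z) / α) (one_lt_two : (1 : ℝ) < 2)
    refine ⟨L, fun k hk x => not_lt.2 ?_⟩
    refine (setIntegral_le_integral hui (Eventually.of_forall hu0)).trans ?_
    have h1 : (2 : ℝ) ^ L ≤ 2 ^ k := by
      rw [← zpow_natCast]; exact zpow_le_zpow_right₀ one_le_two hk
    have h2 : (1 : ℝ) ≤ 2 ^ k := (one_le_pow₀ one_le_two).trans h1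
    have h3 : (2 : ℝ) ^ k ≤ (2 ^ k) ^ d := le_self_pow₀ h2 (by omega)
    rw [mul_comm, ← div_le_iff₀ hα]
    linarith
  set sel : ℤ → EuclideanSpace ℝ (Fin d) → Prop := fun k x =>
    k₀ ≤ k ∧ bad k x ∧ ∀ j, k < j → ¬ bad j x with hsel
  have hsel_congr : ∀ {k : ℤ} {x x'}, dyadicIndex k x = dyadicIndex k x' → sel k x → sel k x' := by
    intro k x x' h hx
    exact ⟨hx.1, (hbad_congr le_rfl h).1 hx.2.1, fun j hj hb => hx.2.2 j hj ((hbad_congr hj.le h).2 hb)⟩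
  set P : Set (ℤ × (Fin d → ℤ)) := {p | ∃ x, dyadicIndex p.1 x = p.2 ∧ sel p.1 x} with hP
  have hfin : P.Finite := by
    obtain ⟨R, hR⟩ := huc.isCompact.isBounded.subset_closedBall 0
    refine Set.Finite.subset ((Set.finite_Icc k₀ (L : ℤ)).biUnion fun k _ =>
      (Set.Finite.pi' fun _ : Fin d => Set.finite_Icc ⌊-R / (2 : ℝ) ^ k⌋ ⌊R / (2 : ℝ) ^ k⌋).image
        fun n => (k, n)) ?_
    rintro ⟨k, n⟩ ⟨x, hn, hk, hb, -⟩
    obtain rfl : dyadicIndex k x = n := hn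
    replace hb : bad k x := hb
    replace hk : k₀ ≤ k := hk
    have hkL : k ≤ L := by
      by_contra hc
      exact hL k (by omega) x hb
    refine Set.mem_biUnion (Set.mem_Icc.2 ⟨hk, hkL⟩) ⟨_, ?_, rfl⟩
    obtain ⟨z, hz, hzu⟩ : ∃ z ∈ dyadicCube k (dyadicIndex k x), u z ≠ 0 := by
      by_contra! hc
      have h0 := setIntegral_eq_zero_of_forall_eq_zero (μ := volume) hc
      have h2 : 0 < α * ((2 : ℝ) ^ k) ^ d := by positivity
      simp only [hbad, h0] at hb
      linarith
    have hzR := hR (subset_tsupport _ hzu)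
    rw [mem_closedBall_zero_iff] at hzR
    intro i
    have hi := abs_le.1 ((PiLp.norm_apply_le z i).trans hzR)
    have h2 : (0 : ℝ) < 2 ^ k := by positivity
    have hzi : dyadicIndex k x i = ⌊z i / (2 : ℝ) ^ k⌋ := (congrFun hz i).symm
    simp only [Set.mem_Icc, hzi]
    exact ⟨Int.floor_le_floor (by gcongr; exact hi.1), Int.floor_le_floor (by gcongr; exact hi.2)⟩
  have := hfin.fintype
  choose w hw using fun p : P => p.2
  have hmem : ∀ (p : P) {z}, z ∈ dyadicCube p.1.1 p.1.2 → sel p.1.1 z := fun p z hz =>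
    hsel_congr ((hw p).1.trans hz.symm) (hw p).2
  refine ⟨P, inferInstance, fun p => p.1.1, w, fun p => dyadicCube p.1.1 p.1.2,
    fun p => measurableSet_dyadicCube _ _, ?_, fun p => (hw p).2.1, fun p => volume_dyadicCube _ _,
    ?_, ?_, ?_, ?_⟩
  · intro p p' hpp'
    refine Set.disjoint_left.2 fun z hz hz' => hpp' ?_
    have h1 := hmem p hz
    have h2 := hmem p' hz'
    have hk : p.1.1 = p'.1.1 := by
      rcases lt_trichotomy p.1.1 p'.1.1 with h | h | h
      · exact absurd h2.2.1 (h1.2.2 _ h)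
      · exact h
      · exact absurd h1.2.1 (h2.2.2 _ h)
    refine Subtype.ext (Prod.ext hk ?_)
    have hz1 : dyadicIndex p.1.1 z = p.1.2 := hz
    have hz2 : dyadicIndex p'.1.1 z = p'.1.2 := hz'
    rw [← hz1, ← hz2, hk]
  · intro p z hz
    rw [mem_closedBall, dist_eq_norm]
    exact norm_sub_le_of_dyadicIndex_eq ((hw p).1.trans hz.symm).symm
  · intro p
    have h1 := (hw p).2.2.1
    simp only [hbad, (hw p).1] at h1
    exact h1.le
  · intro p
    have h1 := (hw p).2.2.2 (p.1.1 + 1) (by omega)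
    simp only [hbad, not_lt] at h1
    refine le_trans ?_ (h1.trans (le_of_eq ?_))
    · refine setIntegral_mono_set hui.integrableOn (Eventually.of_forall hu0)
        (Eventually.of_forall fun z hz => ?_)
      exact dyadicIndex_eq_of_le (by omega) (Eq.trans hz (hw p).1.symm)
    · rw [zpow_add₀ two_ne_zero, zpow_one, mul_pow]
      ring
  · intro x hx
    refine ⟨dyadicCube k₀ (dyadicIndex k₀ x), measurableSet_dyadicCube _ _, volume_dyadicCube _ _,
      fun z hz => ?_, not_lt.1 fun hb => ?_⟩
    · rw [mem_closedBall, dist_eq_norm]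
      exact norm_sub_le_of_dyadicIndex_eq hz
    · obtain ⟨k, ⟨hk, hkb⟩, hmax⟩ := Int.exists_greatest_of_bdd (P := fun k => k₀ ≤ k ∧ bad k x)
        ⟨L, fun k hk => by
          by_contra hc
          exact hL k (by omega) x hk.2⟩ ⟨k₀, le_rfl, hb⟩
      refine hx ⟨(k, dyadicIndex k x), x, rfl, hk, hkb, fun j hj hjb => ?_⟩ rfl
      have := hmax j ⟨by omega, hjb⟩
      omega

end Dyadic

section Mollified
open Convolution
variable {E : Type*} [NormedAddCommGroup E] [InnerProductSpace ℝ E] [FiniteDimensional ℝ E]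
  [MeasurableSpace E] [BorelSpace E]

/-- The indicator of `S`, smoothed at the outer scale of the bump `φ`. -/
def smoothInd (φ : ContDiffBump (0 : E)) (S : Set E) (x : E) : ℝ := ∫ z in S, φ.normed volume (x - z)

variable (φ : ContDiffBump (0 : E)) {S : Set E}

theorem integrable_normed_sub (x : E) : Integrable fun z => φ.normed volume (x - z) :=
  (φ.integrable_normed (μ := volume)).comp_sub_left x

theorem integral_normed_sub (x : E) : ∫ z, φ.normed volume (x - z) = 1 := by
  rw [integral_sub_left_eq_self (fun z => φ.normed volume z) volume x, φ.integral_normed]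

theorem smoothInd_nonneg (S : Set E) (x : E) : 0 ≤ smoothInd φ S x :=
  integral_nonneg fun _ => φ.nonneg_normed _

theorem exists_mem_of_smoothInd_ne_zero {x : E} (hx : smoothInd φ S x ≠ 0) :
    ∃ z ∈ S, ‖x - z‖ < φ.rOut := by
  by_contra! hc
  refine hx (setIntegral_eq_zero_of_forall_eq_zero fun z hz => ?_)
  rw [← Function.notMem_support, φ.support_normed_eq, mem_ball_zero_iff, not_lt]
  exact hc z hz

theorem smoothInd_add_compl (hS : MeasurableSet S) (x : E) :
    smoothInd φ S x + smoothInd φ Sᶜ x = 1 := by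
  rw [smoothInd, smoothInd, integral_add_compl hS (integrable_normed_sub φ x), integral_normed_sub]

theorem sum_smoothInd {ι : Type*} [Fintype ι] {S : ι → Set E} (hS : ∀ i, MeasurableSet (S i))
    (hd : Pairwise (Function.onFun Disjoint S)) (x : E) :
    ∑ i, smoothInd φ (S i) x = smoothInd φ (⋃ i, S i) x :=
  (integral_iUnion_fintype hS hd fun _ => (integrable_normed_sub φ x).integrableOn).symm

theorem contDiff_smoothInd (hS : MeasurableSet S) : ContDiff ℝ (⊤ : ℕ∞) (smoothInd φ S) := by
  have h : smoothInd φ S =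
      (S.indicator fun _ => (1 : ℝ)) ⋆[ContinuousLinearMap.mul ℝ ℝ, volume] φ.normed volume := by
    ext x
    rw [smoothInd, ← integral_indicator hS, convolution_def]
    refine integral_congr_ae (Eventually.of_forall fun z => ?_)
    by_cases hz : z ∈ S <;> simp [hz]
  rw [h]
  refine φ.hasCompactSupport_normed.contDiff_convolution_right _ ?_ φ.contDiff_normed
  exact (locallyIntegrable_const 1).indicator hS

theorem lintegral_mul_smoothInd_le {w : E → ℝ} (hw : Continuous w)
    {a : ℝ} (hw0 : ∀ x, 0 ≤ w x) (ha : 0 ≤ a) (hosc : ∀ x z, ‖x - z‖ < φ.rOut → w x ≤ w z + a) :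
    ∫⁻ x, ENNReal.ofReal (w x * smoothInd φ S x) ≤ ∫⁻ z in S, ENNReal.ofReal (w z + a) := by
  have h1 : ∀ x, ENNReal.ofReal (w x * smoothInd φ S x) =
      ∫⁻ z in S, ENNReal.ofReal (w x * φ.normed volume (x - z)) := by
    intro x
    rw [smoothInd, ← integral_const_mul, ofReal_integral_eq_lintegral_ofReal
      ((integrable_normed_sub φ x).integrableOn.const_mul _)
      (Eventually.of_forall fun z => mul_nonneg (hw0 x) (φ.nonneg_normed _))]
  simp only [h1]
  have hm : Measurable fun p : E × E => ENNReal.ofReal (w p.1 * φ.normed volume (p.1 - p.2)) := by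
    refine ENNReal.measurable_ofReal.comp (Continuous.measurable ?_)
    have := φ.continuous_normed (μ := volume)
    fun_prop
  rw [lintegral_lintegral_swap hm.aemeasurable]
  refine lintegral_mono fun z => ?_
  have h2 : ∀ x, ENNReal.ofReal (w x * φ.normed volume (x - z)) ≤
      ENNReal.ofReal (w z + a) * ENNReal.ofReal (φ.normed volume (x - z)) := by
    intro x
    rw [← ENNReal.ofReal_mul (add_nonneg (hw0 z) ha)]
    refine ENNReal.ofReal_le_ofReal ?_
    by_cases hx : φ.normed volume (x - z) = 0
    · simp [hx]
    · refine mul_le_mul_of_nonneg_right (hosc x z ?_) (φ.nonneg_normed _)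
      rwa [← Ne, ← Function.mem_support, φ.support_normed_eq, mem_ball_zero_iff] at hx
  refine (lintegral_mono h2).trans (le_of_eq ?_)
  rw [lintegral_const_mul' _ _ (by simp),
    lintegral_sub_right_eq_self (fun x => ENNReal.ofReal (φ.normed volume x)) z,
    ← ofReal_integral_eq_lintegral_ofReal φ.integrable_normed
      (Eventually.of_forall fun z => φ.nonneg_normed _), φ.integral_normed, ENNReal.ofReal_one, mul_one]

theorem lintegral_smoothInd :
    ∫⁻ x, ENNReal.ofReal (smoothInd φ S x) = volume S := by
  have h1 : ∀ x, ENNReal.ofReal (smoothInd φ S x) =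
      ∫⁻ z in S, ENNReal.ofReal (φ.normed volume (x - z)) := by
    intro x
    rw [smoothInd, ofReal_integral_eq_lintegral_ofReal (integrable_normed_sub φ x).integrableOn
      (Eventually.of_forall fun z => φ.nonneg_normed _)]
  simp only [h1]
  have hm : Measurable fun p : E × E => ENNReal.ofReal (φ.normed volume (p.1 - p.2)) := by
    refine ENNReal.measurable_ofReal.comp (Continuous.measurable ?_)
    have := φ.continuous_normed (μ := volume)
    fun_prop
  rw [lintegral_lintegral_swap hm.aemeasurable]
  have h2 : ∀ z : E, ∫⁻ x, ENNReal.ofReal (φ.normed volume (x - z)) = 1 := fun z => by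
    rw [lintegral_sub_right_eq_self (fun x => ENNReal.ofReal (φ.normed volume x)) z,
      ← ofReal_integral_eq_lintegral_ofReal φ.integrable_normed
        (Eventually.of_forall fun z => φ.nonneg_normed _), φ.integral_normed, ENNReal.ofReal_one]
  simp [h2]

theorem smoothInd_eq_zero_of_subset_closedBall {y : E} {R : ℝ}
    (hSR : S ⊆ closedBall y R) {x : E} (hx : x ∉ closedBall y (R + φ.rOut)) : smoothInd φ S x = 0 := by
  by_contra hc
  obtain ⟨z, hz, hlt⟩ := exists_mem_of_smoothInd_ne_zero φ hc
  refine hx ?_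
  have h1 := hSR hz
  rw [mem_closedBall] at h1 ⊢
  rw [← dist_eq_norm] at hlt
  linarith [dist_triangle x z y]

theorem integral_smoothInd (hS : MeasurableSet S) : ∫ x, smoothInd φ S x = volume.real S := by
  rw [integral_eq_lintegral_of_nonneg_ae (Eventually.of_forall (smoothInd_nonneg φ S))
    (contDiff_smoothInd φ hS).continuous.aestronglyMeasurable, lintegral_smoothInd φ, Measure.real]

theorem integral_mul_smoothInd_le (hS : MeasurableSet S) (hSv : volume S ≠ ⊤) {w : E → ℝ}
    (hw : Continuous w) (hwi : Integrable w) {a : ℝ} (hw0 : ∀ x, 0 ≤ w x) (ha : 0 ≤ a)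
    (hosc : ∀ x z, ‖x - z‖ < φ.rOut → w x ≤ w z + a) :
    ∫ x, w x * smoothInd φ S x ≤ (∫ z in S, w z) + a * volume.real S := by
  have hi : IntegrableOn (fun _ => a) S := integrableOn_const hSv
  have h1 : (∫ z in S, w z) + a * volume.real S = ∫ z in S, (w z + a) := by
    rw [integral_add hwi.integrableOn hi, setIntegral_const, smul_eq_mul, mul_comm]
  rw [h1, integral_eq_lintegral_of_nonneg_ae
    (Eventually.of_forall fun x => mul_nonneg (hw0 x) (smoothInd_nonneg φ S x))
    (hw.mul (contDiff_smoothInd φ hS).continuous).aestronglyMeasurable,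
    integral_eq_lintegral_of_nonneg_ae (Eventually.of_forall fun x => add_nonneg (hw0 x) ha)
    (by fun_prop)]
  refine ENNReal.toReal_mono ?_ (lintegral_mul_smoothInd_le φ hw hw0 ha hosc)
  have hadd : IntegrableOn (fun x => w x + a) S := hwi.integrableOn.add hi
  rw [← ofReal_integral_eq_lintegral_ofReal hadd
    (Eventually.of_forall fun x => add_nonneg (hw0 x) ha)]
  exact ENNReal.ofReal_ne_top

end Mollified

section Decomposition

section Piece
variable {E : Type*} [NormedAddCommGroup E] [InnerProductSpace ℝ E] [FiniteDimensional ℝ E]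
  [MeasurableSpace E] [BorelSpace E]

/-- The average of `f` against the weight `χ`. -/
def weightedMean (χ : E → ℝ) (f : E → ℂ) : ℂ := ((∫ x, χ x)⁻¹ : ℝ) * ∫ x, (χ x : ℂ) * f x

variable {χ : E → ℝ} {f : E → ℂ}

theorem integrable_ofReal_mul (hχ : Continuous χ) (hχc : HasCompactSupport χ) (hf : Continuous f) :
    Integrable fun x => (χ x : ℂ) * f x := by
  refine Continuous.integrable_of_hasCompactSupport (by fun_prop) ?_
  refine hχc.mono fun x hx => ?_
  rw [Function.mem_support] at hx ⊢
  intro h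
  simp [h] at hx

theorem norm_weightedMean_mul_le (hχ0 : ∀ x, 0 ≤ χ x) (hv : 0 < ∫ x, χ x) :
    ‖weightedMean χ f‖ * ∫ x, χ x ≤ ∫ x, ‖f x‖ * χ x := by
  have h1 : ‖∫ x, (χ x : ℂ) * f x‖ ≤ ∫ x, ‖f x‖ * χ x := by
    refine (norm_integral_le_integral_norm _).trans (le_of_eq ?_)
    congr 1 with x
    rw [norm_mul, Complex.norm_real, Real.norm_of_nonneg (hχ0 x), mul_comm]
  rw [weightedMean, norm_mul, Complex.norm_real, Real.norm_of_nonneg (inv_nonneg.2 hv.le), mul_comm,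
    ← mul_assoc, mul_inv_cancel₀ hv.ne', one_mul]
  exact h1

theorem integral_mul_sub_weightedMean (hχ : Continuous χ) (hχc : HasCompactSupport χ)
    (hv : 0 < ∫ x, χ x) (hf : Continuous f) :
    ∫ x, (χ x : ℂ) * (f x - weightedMean χ f) = 0 := by
  simp only [mul_sub]
  rw [integral_sub (integrable_ofReal_mul hχ hχc hf)
    (integrable_ofReal_mul hχ hχc continuous_const), integral_mul_const,
    integral_complex_ofReal, weightedMean, ← mul_assoc, ← Complex.ofReal_mul,
    mul_inv_cancel₀ hv.ne', Complex.ofReal_one, one_mul, sub_self]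

theorem integral_norm_mul_sub_weightedMean_le (hχ : Continuous χ) (hχc : HasCompactSupport χ)
    (hχ0 : ∀ x, 0 ≤ χ x) (hv : 0 < ∫ x, χ x) (hf : Continuous f) :
    ∫ x, ‖(χ x : ℂ) * (f x - weightedMean χ f)‖ ≤ 2 * ∫ x, ‖f x‖ * χ x := by
  have hi : Integrable χ := hχ.integrable_of_hasCompactSupport hχc
  have hfi : Integrable fun x => ‖f x‖ * χ x := by
    refine (integrable_ofReal_mul hχ hχc hf).norm.congr (Eventually.of_forall fun x => ?_)
    simp only
    rw [norm_mul, Complex.norm_real, Real.norm_of_nonneg (hχ0 x), mul_comm]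
  calc ∫ x, ‖(χ x : ℂ) * (f x - weightedMean χ f)‖
      ≤ ∫ x, (‖f x‖ * χ x + ‖weightedMean χ f‖ * χ x) := by
        refine integral_mono (integrable_ofReal_mul hχ hχc (by fun_prop)).norm
          (hfi.add (hi.const_mul _)) fun x => ?_
        simp only
        rw [norm_mul, Complex.norm_real, Real.norm_of_nonneg (hχ0 x), ← add_mul, mul_comm]
        exact mul_le_mul_of_nonneg_right (norm_sub_le _ _) (hχ0 x)
    _ = (∫ x, ‖f x‖ * χ x) + ‖weightedMean χ f‖ * ∫ x, χ x := by
        rw [integral_add hfi (hi.const_mul _), integral_const_mul]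
    _ ≤ 2 * ∫ x, ‖f x‖ * χ x := by
        linarith [norm_weightedMean_mul_le (f := f) hχ0 hv]

end Piece

variable {d : ℕ}

/-- Disjoint sets inside a ball have total volume at most that of the ball. -/
theorem sum_le_of_disjoint_subset_closedBall {ι : Type*} (s : Finset ι) (v : ι → ℝ)
    {S : ι → Set (EuclideanSpace ℝ (Fin d))} (hS : ∀ i, MeasurableSet (S i))
    (hd : Pairwise (Function.onFun Disjoint S)) (hv : ∀ i, volume.real (S i) = v i)
    {x : EuclideanSpace ℝ (Fin d)} {R : ℝ} (hR : 0 ≤ R) (hsub : ∀ i ∈ s, S i ⊆ closedBall x R) :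
    ∑ i ∈ s, v i ≤ R ^ d * volume.real (ball (0 : EuclideanSpace ℝ (Fin d)) 1) := by
  have hfin : volume (closedBall x R) ≠ ⊤ := measure_closedBall_lt_top.ne
  calc ∑ i ∈ s, v i = ∑ i ∈ s, volume.real (S i) := by simp only [hv]
    _ = volume.real (⋃ i ∈ s, S i) := by
        rw [measureReal_biUnion_finset (fun i _ j _ hij => hd hij) (fun i _ => hS i)
          (fun i hi => measure_ne_top_of_subset (hsub i hi) hfin)]
    _ ≤ volume.real (closedBall x R) := measureReal_mono (Set.iUnion₂_subset hsub) hfin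
    _ = R ^ d * volume.real (ball (0 : EuclideanSpace ℝ (Fin d)) 1) := by
        rw [Measure.real, Measure.addHaar_closedBall _ _ hR, ENNReal.toReal_mul,
          ENNReal.toReal_ofReal (by positivity), finrank_euclideanSpace_fin, Measure.real]

/-- Calderón-Zygmund decomposition of a test function into smooth pieces. -/
theorem exists_calderonZygmund_decomposition (hd : 1 ≤ d) :
    ∃ C : ℝ, 0 < C ∧ ∀ f : EuclideanSpace ℝ (Fin d) → ℂ, ContDiff ℝ (⊤ : ℕ∞) f →
      HasCompactSupport f → ∀ α : ℝ, 0 < α →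
      ∃ (ι : Type) (_ : Fintype ι) (y : ι → EuclideanSpace ℝ (Fin d)) (q : ι → ℤ)
        (b : ι → EuclideanSpace ℝ (Fin d) → ℂ) (g : EuclideanSpace ℝ (Fin d) → ℂ),
        IsAtomFamily (C * α) y q b ∧ ContDiff ℝ (⊤ : ℕ∞) g ∧ HasCompactSupport g ∧
        (∀ x, f x = g x + ∑ i, b i x) ∧ (∀ x, ‖g x‖ ≤ C * α) ∧
        ∫ x, ‖g x‖ ≤ ∫ x, ‖f x‖ ∧ ∑ i, ∫ x, ‖b i x‖ ≤ 2 * ∫ x, ‖f x‖ ∧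
        α * ∑ i, ((2 : ℝ) ^ q i) ^ d ≤ C * ∫ x, ‖f x‖ := by
  set B := volume.real (ball (0 : EuclideanSpace ℝ (Fin d)) 1) with hB
  have hB0 : 0 ≤ B := measureReal_nonneg
  refine ⟨2 ^ (d + 1) * (2 ^ d + 1) * B + (2 ^ d + 4) + 2 ^ (d * d), by positivity, ?_⟩
  set C : ℝ := 2 ^ (d + 1) * (2 ^ d + 1) * B + (2 ^ d + 4) + 2 ^ (d * d) with hC
  intro f hf hfc α hα
  have hC1 : 2 ^ (d + 1) * (2 ^ d + 1) * B ≤ C := by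
    rw [hC]
    have : (0 : ℝ) ≤ (2 ^ d + 4) + 2 ^ (d * d) := by positivity
    linarith
  have hC2 : (2 : ℝ) ^ d + 4 ≤ C := by
    rw [hC]
    have : (0 : ℝ) ≤ 2 ^ (d + 1) * (2 ^ d + 1) * B + 2 ^ (d * d) := by positivity
    linarith
  have hC3 : (2 : ℝ) ^ (d * d) ≤ C := by
    rw [hC]
    have : (0 : ℝ) ≤ 2 ^ (d + 1) * (2 ^ d + 1) * B + (2 ^ d + 4) := by positivity
    linarith
  set w : EuclideanSpace ℝ (Fin d) → ℝ := fun x => ‖f x‖ with hw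
  have hwcont : Continuous w := hf.continuous.norm
  have hwc : HasCompactSupport w := hfc.norm
  have hwi : Integrable w := hwcont.integrable_of_hasCompactSupport hwc
  have hw0 : ∀ x, 0 ≤ w x := fun x => norm_nonneg _
  obtain ⟨r₀, hr₀, hosc₀⟩ := Metric.uniformContinuous_iff.1
    (hwc.uniformContinuous_of_continuous hwcont) α hα
  obtain ⟨n, hn⟩ := exists_pow_lt_of_lt_one (show 0 < r₀ / (d + 1) by positivity)
    (show (1 / 2 : ℝ) < 1 by norm_num)
  set k₀ : ℤ := -(n : ℤ) with hk₀
  have hk₀' : (2 : ℝ) ^ k₀ = (1 / 2) ^ n := by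
    rw [hk₀, zpow_neg, zpow_natCast, one_div, inv_pow]
  have hk₀pos : (0 : ℝ) < 2 ^ k₀ := by positivity
  have hk₀r : (d + 1) * (2 : ℝ) ^ k₀ < r₀ := by
    rw [hk₀', ← lt_div_iff₀' (by positivity)]; exact hn
  have hosc : ∀ x z, ‖x - z‖ ≤ (d + 1) * (2 : ℝ) ^ k₀ → w x ≤ w z + α := by
    intro x z hxz
    have h := hosc₀ (a := x) (b := z) (by rw [dist_eq_norm]; exact hxz.trans_lt hk₀r)
    rw [Real.dist_eq] at h
    linarith [le_abs_self (w x - w z)]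
  obtain ⟨ι, hι, k, y, S, hSm, hSd, hkk, hSv, hSb, hSlow, hSup, hout⟩ :=
    exists_dyadic_selection hwcont hwc hw0 hα hd k₀
  let φ : ContDiffBump (0 : EuclideanSpace ℝ (Fin d)) :=
    ⟨2 ^ k₀ / 2, 2 ^ k₀, by positivity, by linarith⟩
  have hφ : φ.rOut = 2 ^ k₀ := rfl
  have hφosc : ∀ x z, ‖x - z‖ < φ.rOut → w x ≤ w z + α := by
    intro x z hxz
    refine hosc x z ?_
    rw [hφ] at hxz
    nlinarith [(Nat.cast_nonneg d : (0 : ℝ) ≤ d)]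
  set χ : ι → EuclideanSpace ℝ (Fin d) → ℝ := fun i => smoothInd φ (S i) with hχ
  set v : ι → ℝ := fun i => ((2 : ℝ) ^ k i) ^ d with hv
  have hv0 : ∀ i, 0 < v i := fun i => by positivity
  have hSr : ∀ i, volume.real (S i) = v i := fun i => by
    rw [Measure.real, hSv, ENNReal.toReal_ofReal (hv0 i).le]
  have hSfin : ∀ i, volume (S i) ≠ ⊤ := fun i => by rw [hSv]; exact ENNReal.ofReal_ne_top
  have hχv : ∀ i, ∫ x, χ i x = v i := fun i => (integral_smoothInd φ (hSm i)).trans (hSr i)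
  have hχpos : ∀ i, 0 < ∫ x, χ i x := fun i => by rw [hχv]; exact hv0 i
  have hχ0 : ∀ i x, 0 ≤ χ i x := fun i x => smoothInd_nonneg φ (S i) x
  have hχd : ∀ i, ContDiff ℝ (⊤ : ℕ∞) (χ i) := fun i => contDiff_smoothInd φ (hSm i)
  have hq : ∀ i, (d + 1) * (2 : ℝ) ^ k i ≤ 2 ^ (k i + d) := by
    intro i
    rw [zpow_add₀ two_ne_zero, zpow_natCast, mul_comm]
    refine mul_le_mul_of_nonneg_left ?_ (by positivity)
    exact_mod_cast Nat.succ_le_of_lt (Nat.lt_two_pow_self (n := d))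
  have hkk' : ∀ i, (2 : ℝ) ^ k₀ ≤ 2 ^ k i := fun i => zpow_le_zpow_right₀ (by norm_num) (hkk i)
  have hχs : ∀ i x, x ∉ closedBall (y i) ((2 : ℝ) ^ (k i + d)) → χ i x = 0 := by
    intro i x hx
    refine smoothInd_eq_zero_of_subset_closedBall φ (hSb i) fun hx' => hx ?_
    refine closedBall_subset_closedBall ?_ hx'
    rw [hφ]
    linarith [hq i, hkk' i]
  have hχc : ∀ i, HasCompactSupport (χ i) := fun i =>
    HasCompactSupport.intro (isCompact_closedBall _ _) (hχs i)
  set c : ι → ℂ := fun i => weightedMean (χ i) f with hc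
  set I : ι → ℝ := fun i => ∫ x, w x * χ i x with hI
  have hI0 : ∀ i, 0 ≤ I i := fun i => integral_nonneg fun x => mul_nonneg (hw0 x) (hχ0 i x)
  have hIle : ∀ i, I i ≤ (2 ^ d + 1) * α * v i := by
    intro i
    have h := integral_mul_smoothInd_le φ (hSm i) (hSfin i) hwcont hwi hw0 hα.le hφosc
    rw [hSr i] at h
    have h2 := hSup i
    simp only [hI, hv] at h h2 ⊢
    linarith
  have hcI : ∀ i, ‖c i‖ * v i ≤ I i := fun i => by
    rw [← hχv i]; exact norm_weightedMean_mul_le (hχ0 i) (hχpos i)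
  have hcle : ∀ i, ‖c i‖ ≤ (2 ^ d + 1) * α := fun i =>
    le_of_mul_le_mul_right ((hcI i).trans (hIle i)) (hv0 i)
  set U := ⋃ i, S i with hU
  have hUm : MeasurableSet U := MeasurableSet.iUnion hSm
  set ψ := smoothInd φ Uᶜ with hψ
  have hψd : ContDiff ℝ (⊤ : ℕ∞) ψ := contDiff_smoothInd φ hUm.compl
  have hψ0 : ∀ x, 0 ≤ ψ x := smoothInd_nonneg φ _
  have hone : ∀ x, ∑ i, χ i x + ψ x = 1 := fun x => by
    rw [hχ]
    simp only
    rw [sum_smoothInd φ hSm hSd, smoothInd_add_compl φ hUm]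
  have hχsum0 : ∀ x, 0 ≤ ∑ i, χ i x := fun x => Finset.sum_nonneg fun i _ => hχ0 i x
  set b : ι → EuclideanSpace ℝ (Fin d) → ℂ := fun i x => (χ i x : ℂ) * (f x - c i) with hb
  have hbd : ∀ i, ContDiff ℝ (⊤ : ℕ∞) (b i) := fun i =>
    (Complex.ofRealCLM.contDiff.comp (hχd i)).mul (hf.sub contDiff_const)
  have hbI : ∀ i, ∫ x, ‖b i x‖ ≤ 2 * I i := fun i =>
    integral_norm_mul_sub_weightedMean_le (hχd i).continuous (hχc i) (hχ0 i) (hχpos i) hf.continuous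
  set g : EuclideanSpace ℝ (Fin d) → ℂ := fun x => (ψ x : ℂ) * f x + ∑ i, (χ i x : ℂ) * c i with hg
  have hfg : ∀ x, f x = g x + ∑ i, b i x := by
    intro x
    have h : (∑ i, (χ i x : ℂ)) + (ψ x : ℂ) = 1 := by exact_mod_cast hone x
    simp only [hg, hb, mul_sub, Finset.sum_sub_distrib, ← Finset.sum_mul]
    linear_combination (-f x) * h
  have hgd : ContDiff ℝ (⊤ : ℕ∞) g :=
    ((Complex.ofRealCLM.contDiff.comp hψd).mul hf).add
      (ContDiff.sum fun i _ => (Complex.ofRealCLM.contDiff.comp (hχd i)).mul contDiff_const)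
  have hgc : HasCompactSupport g := by
    refine HasCompactSupport.intro (K := tsupport f ∪ ⋃ i, closedBall (y i) ((2 : ℝ) ^ (k i + d)))
      (hfc.isCompact.union (isCompact_iUnion fun i => isCompact_closedBall _ _)) fun x hx => ?_
    rw [Set.mem_union, not_or, Set.mem_iUnion, not_exists] at hx
    simp only [hg]
    rw [image_eq_zero_of_notMem_tsupport hx.1, mul_zero, zero_add]
    exact Finset.sum_eq_zero fun i _ => by rw [hχs i x (hx.2 i), Complex.ofReal_zero, zero_mul]
  have hwU : ∀ z, z ∉ U → w z ≤ 2 * α := by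
    intro z hz
    obtain ⟨V, hVm, hVv, hVb, hVi⟩ := hout z (by simpa [hU] using hz)
    have hVr : volume.real V = ((2 : ℝ) ^ k₀) ^ d := by
      rw [Measure.real, hVv, ENNReal.toReal_ofReal (by positivity)]
    have h1 : (w z - α) * ((2 : ℝ) ^ k₀) ^ d ≤ ∫ x in V, w x := by
      have hVfin : volume V ≠ ⊤ := by rw [hVv]; exact ENNReal.ofReal_ne_top
      have h2 : ∫ x in V, (w z - α) ≤ ∫ x in V, w x := by
        refine setIntegral_mono_on (integrableOn_const hVfin) hwi.integrableOn hVm fun x hx => ?_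
        have h3 := hVb hx
        rw [mem_closedBall, dist_comm, dist_eq_norm] at h3
        linarith [hosc z x (by linarith)]
      rwa [setIntegral_const, hVr, smul_eq_mul, mul_comm] at h2
    have h4 := le_of_mul_le_mul_right (h1.trans hVi) (by positivity)
    linarith
  have hψw : ∀ x, ψ x * w x ≤ 3 * α := by
    intro x
    by_cases hx : ψ x = 0
    · rw [hx, zero_mul]; positivity
    · obtain ⟨z, hz, hxz⟩ := exists_mem_of_smoothInd_ne_zero φ hx
      have h1 := hφosc x z hxz
      have h2 := hwU z hz
      have h3 := hone x
      nlinarith [hχsum0 x, hw0 x, hψ0 x]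
  have hgle : ∀ x, ‖g x‖ ≤ ψ x * w x + ∑ i, ‖c i‖ * χ i x := by
    intro x
    refine (norm_add_le _ _).trans (add_le_add (le_of_eq ?_) ((norm_sum_le _ _).trans
      (le_of_eq (Finset.sum_congr rfl fun i _ => ?_))))
    · rw [norm_mul, Complex.norm_real, Real.norm_of_nonneg (hψ0 x)]
    · rw [norm_mul, Complex.norm_real, Real.norm_of_nonneg (hχ0 i x), mul_comm]
  have hχi : ∀ i, Integrable (χ i) := fun i =>
    (hχd i).continuous.integrable_of_hasCompactSupport (hχc i)
  have hwχi : ∀ i, Integrable fun x => w x * χ i x := fun i =>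
    (hwcont.mul (hχd i).continuous).integrable_of_hasCompactSupport (hwc.mul_right)
  have hψwi : Integrable fun x => ψ x * w x :=
    (hψd.continuous.mul hwcont).integrable_of_hasCompactSupport (hwc.mul_left)
  have hw_split : (∫ x, ψ x * w x) + ∑ i, I i = ∫ x, w x := by
    simp only [hI]
    rw [← integral_finsetSum _ fun i _ => hwχi i, ← integral_add hψwi
      (integrable_finsetSum _ fun i _ => hwχi i)]
    congr 1 with x
    rw [← Finset.mul_sum]
    linear_combination (w x) * hone x
  have hvle : α * ∑ i, v i ≤ ∫ x, w x := by
    rw [Finset.mul_sum]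
    calc ∑ i, α * v i ≤ ∑ i, ∫ z in S i, w z := Finset.sum_le_sum fun i _ => hSlow i
      _ = ∫ z in U, w z := (integral_iUnion_fintype hSm hSd fun i => hwi.integrableOn).symm
      _ ≤ ∫ x, w x := setIntegral_le_integral hwi (Eventually.of_forall hw0)
  have hψwint : 0 ≤ ∫ x, ψ x * w x := integral_nonneg fun x => mul_nonneg (hψ0 x) (hw0 x)
  refine ⟨ι, hι, y, fun i => k i + d, b, g, ⟨hbd, ?_, ?_, ?_⟩, hgd, hgc, hfg, ?_, ?_, ?_, ?_⟩
  · intro i x hx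
    simp only [hb]
    rw [hχs i x hx, Complex.ofReal_zero, zero_mul]
  · exact fun i => integral_mul_sub_weightedMean (hχd i).continuous (hχc i) (hχpos i) hf.continuous
  · intro x R hR
    rw [finrank_euclideanSpace_fin]
    have h1 : ∑ i with (2 : ℝ) ^ (k i + d) ≤ R ∧ ‖y i - x‖ ≤ R, v i ≤ (2 * R) ^ d * B := by
      refine sum_le_of_disjoint_subset_closedBall _ v hSm hSd hSr (x := x) (by positivity) ?_
      intro i hi
      rw [Finset.mem_filter] at hi
      refine (hSb i).trans (closedBall_subset_closedBall' ?_)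
      rw [dist_eq_norm]
      have : (0 : ℝ) < 2 ^ k i := by positivity
      linarith [hq i, hi.2.1, hi.2.2]
    calc ∑ i with (2 : ℝ) ^ (k i + d) ≤ R ∧ ‖y i - x‖ ≤ R, ∫ z, ‖b i z‖
        ≤ ∑ i with (2 : ℝ) ^ (k i + d) ≤ R ∧ ‖y i - x‖ ≤ R, 2 * ((2 ^ d + 1) * α) * v i := by
          refine Finset.sum_le_sum fun i _ => (hbI i).trans ?_
          linarith [hIle i]
      _ ≤ 2 * ((2 ^ d + 1) * α) * ((2 * R) ^ d * B) := by
          rw [← Finset.mul_sum]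
          exact mul_le_mul_of_nonneg_left h1 (by positivity)
      _ = 2 ^ (d + 1) * (2 ^ d + 1) * B * (α * R ^ d) := by ring
      _ ≤ C * (α * R ^ d) := mul_le_mul_of_nonneg_right hC1 (by positivity)
      _ = C * α * R ^ d := by ring
  · intro x
    have h1 : ∑ i, ‖c i‖ * χ i x ≤ (2 ^ d + 1) * α := by
      calc ∑ i, ‖c i‖ * χ i x ≤ ∑ i, (2 ^ d + 1) * α * χ i x :=
            Finset.sum_le_sum fun i _ => mul_le_mul_of_nonneg_right (hcle i) (hχ0 i x)
        _ = (2 ^ d + 1) * α * ∑ i, χ i x := by rw [Finset.mul_sum]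
        _ ≤ (2 ^ d + 1) * α * 1 := by
            refine mul_le_mul_of_nonneg_left ?_ (by positivity)
            linarith [hone x, hψ0 x]
        _ = _ := mul_one _
    have h2 := hgle x
    have h3 := hψw x
    calc ‖g x‖ ≤ (2 ^ d + 4) * α := by linarith
      _ ≤ C * α := mul_le_mul_of_nonneg_right hC2 hα.le
  · have hsi : Integrable fun x => ∑ i, ‖c i‖ * χ i x :=
      integrable_finsetSum _ fun i _ => (hχi i).const_mul _
    calc ∫ x, ‖g x‖ ≤ ∫ x, (ψ x * w x + ∑ i, ‖c i‖ * χ i x) :=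
          integral_mono (hgd.continuous.integrable_of_hasCompactSupport hgc).norm
            (hψwi.add hsi) hgle
      _ = (∫ x, ψ x * w x) + ∑ i, ‖c i‖ * v i := by
          rw [integral_add hψwi hsi, integral_finsetSum _ fun i _ => (hχi i).const_mul _]
          simp only [integral_const_mul, hχv]
      _ ≤ (∫ x, ψ x * w x) + ∑ i, I i := by
          gcongr with i
          exact hcI i
      _ = _ := hw_split
  · calc ∑ i, ∫ x, ‖b i x‖ ≤ ∑ i, 2 * I i := Finset.sum_le_sum fun i _ => hbI i
      _ = 2 * ∑ i, I i := by rw [Finset.mul_sum]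
      _ ≤ 2 * ∫ x, ‖f x‖ := by linarith [hw_split]
  · have h1 : ∀ i, ((2 : ℝ) ^ (k i + d)) ^ d = 2 ^ (d * d) * v i := fun i => by
      rw [zpow_add₀ two_ne_zero, zpow_natCast, mul_pow, ← pow_mul, mul_comm]
    simp only [h1]
    rw [← Finset.mul_sum]
    calc α * (2 ^ (d * d) * ∑ i, v i) = 2 ^ (d * d) * (α * ∑ i, v i) := by ring
      _ ≤ 2 ^ (d * d) * ∫ x, w x := mul_le_mul_of_nonneg_left hvle (by positivity)
      _ ≤ C * ∫ x, ‖f x‖ :=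
          mul_le_mul_of_nonneg_right hC3 (integral_nonneg fun x => norm_nonneg _)

end Decomposition

section Truncations
variable {E : Type*} [NormedAddCommGroup E] [InnerProductSpace ℝ E] [FiniteDimensional ℝ E]
  [MeasurableSpace E] [BorelSpace E]
variable {C₀ δ : ℝ} {K : E → E → ℂ} {Ω : E → ℝ}

theorem IsStandardKernel.continuousOn_uncurry (hK : IsStandardKernel C₀ δ K) (hδ : 0 < δ) :
    ContinuousOn (fun p : E × E => K p.1 p.2) {p | p.1 ≠ p.2} := by
  rintro ⟨x, y⟩ hxy
  have hxy' : x ≠ y := hxy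
  have hD : 0 < ‖x - y‖ := norm_pos_iff.2 (sub_ne_zero.2 hxy')
  refine ContinuousAt.continuousWithinAt ?_
  rw [ContinuousAt, tendsto_iff_norm_sub_tendsto_zero]
  have hlim : Tendsto (fun p : E × E =>
      C₀ * ‖y - p.2‖ ^ δ / ‖p.1 - y‖ ^ ((Module.finrank ℝ E : ℝ) + δ) +
        C₀ * ‖x - p.1‖ ^ δ / ‖x - y‖ ^ ((Module.finrank ℝ E : ℝ) + δ)) (𝓝 (x, y)) (𝓝 0) := by
    have h1 : ContinuousAt (fun p : E × E =>
      C₀ * ‖y - p.2‖ ^ δ / ‖p.1 - y‖ ^ ((Module.finrank ℝ E : ℝ) + δ) +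
        C₀ * ‖x - p.1‖ ^ δ / ‖x - y‖ ^ ((Module.finrank ℝ E : ℝ) + δ)) (x, y) := by
      refine ContinuousAt.add (ContinuousAt.div ?_ ?_ (Real.rpow_pos_of_pos hD _).ne')
        (ContinuousAt.div_const ?_ _)
      · exact continuousAt_const.mul (ContinuousAt.rpow_const (by fun_prop) (Or.inr hδ.le))
      · exact ContinuousAt.rpow_const (by fun_prop) (Or.inl hD.ne')
      · exact continuousAt_const.mul (ContinuousAt.rpow_const (by fun_prop) (Or.inr hδ.le))
    have h2 := h1.tendsto
    simp only [sub_self, norm_zero, Real.zero_rpow hδ.ne', mul_zero, zero_div, add_zero] at h2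
    exact h2
  refine squeeze_zero' (Eventually.of_forall fun _ => norm_nonneg _) ?_ hlim
  have hb : ∀ᶠ p : E × E in 𝓝 (x, y), ‖x - p.1‖ < ‖x - y‖ / 8 ∧ ‖y - p.2‖ < ‖x - y‖ / 8 := by
    refine Eventually.and ?_ ?_
    · have : ContinuousAt (fun p : E × E => ‖x - p.1‖) (x, y) := by fun_prop
      exact this.eventually_lt continuousAt_const (by simpa using hD)
    · have : ContinuousAt (fun p : E × E => ‖y - p.2‖) (x, y) := by fun_prop
      exact this.eventually_lt continuousAt_const (by simpa using hD)
  filter_upwards [hb] with p hp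
  have h3 : ‖x - y‖ ≤ ‖x - p.1‖ + ‖p.1 - y‖ := norm_sub_le_norm_sub_add_norm_sub _ _ _
  have h4 := hK.regular_right p.1 y p.2 (by linarith [hp.1, hp.2])
  have h5 := hK.regular_left x p.1 y (by linarith [hp.1])
  rw [norm_sub_rev] at h4 h5
  exact (norm_sub_le_norm_sub_add_norm_sub _ (K p.1 y) _).trans (add_le_add h4 h5)

/-- The singular integral truncated at distance `ε` from the diagonal. -/
def truncatedIntegral (Ω : E → ℝ) (K : E → E → ℂ) (g : E → ℂ) (ε : ℝ) (x : E) : ℂ :=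
  ∫ y in {y : E | ε < ‖x - y‖}, (Ω (x - y) : ℂ) * K x y * g y

theorem IsStandardKernel.aestronglyMeasurable_truncatedIntegral (hK : IsStandardKernel C₀ δ K)
    (hδ : 0 < δ) (hΩ : Measurable Ω) {g : E → ℂ} (hg : Continuous g) {ε : ℝ} (hε : 0 < ε) :
    AEStronglyMeasurable (truncatedIntegral Ω K g ε) := by
  have hs : MeasurableSet {p : E × E | ε < ‖p.1 - p.2‖} :=
    (isOpen_lt continuous_const (by fun_prop)).measurableSet
  have hsub : {p : E × E | ε < ‖p.1 - p.2‖} ⊆ {p | p.1 ≠ p.2} := by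
    intro p hp h
    rw [Set.mem_ofPred_eq, h, sub_self, norm_zero] at hp
    linarith
  have hKm : AEStronglyMeasurable (fun p : E × E => K p.1 p.2)
      ((volume.prod volume).restrict {p : E × E | ε < ‖p.1 - p.2‖}) :=
    ((hK.continuousOn_uncurry hδ).mono hsub).aestronglyMeasurable hs
  have hΩm : Measurable fun p : E × E => (Ω (p.1 - p.2) : ℂ) :=
    Complex.measurable_ofReal.comp (hΩ.comp (measurable_fst.sub measurable_snd))
  have hgm : Continuous fun p : E × E => g p.2 := by fun_prop
  have := (aestronglyMeasurable_indicator_iff hs).2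
    ((hΩm.aestronglyMeasurable.mul hKm).mul hgm.aestronglyMeasurable)
  refine this.integral_prod_right'.congr (Eventually.of_forall fun x => ?_)
  have hsx : MeasurableSet {y : E | ε < ‖x - y‖} :=
    (isOpen_lt continuous_const (by fun_prop)).measurableSet
  simp only [truncatedIntegral]
  rw [← integral_indicator hsx]
  rfl

theorem IsStandardKernel.aestronglyMeasurable_of_tendsto (hK : IsStandardKernel C₀ δ K)
    (hδ : 0 < δ) (hΩ : Measurable Ω) {g : E → ℂ} (hg : Continuous g) {u : E → ℂ}
    (h : ∀ᵐ x, Tendsto (fun ε => truncatedIntegral Ω K g ε x) (𝓝[>] 0) (𝓝 (u x))) :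
    AEStronglyMeasurable u := by
  refine aestronglyMeasurable_of_tendsto_ae atTop
    (f := fun (n : ℕ) => truncatedIntegral Ω K g (1 / ((n : ℝ) + 1)))
    (fun n => hK.aestronglyMeasurable_truncatedIntegral hδ hΩ hg (by positivity)) ?_
  filter_upwards [h] with x hx
  refine hx.comp (tendsto_nhdsWithin_iff.2 ⟨tendsto_one_div_add_atTop_nhds_zero_nat, ?_⟩)
  exact Eventually.of_forall fun n => Set.mem_Ioi.2 (by positivity)

theorem IsStandardKernel.truncatedIntegral_add [Nontrivial E] (hK : IsStandardKernel C₀ δ K)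
    (hC₀ : 0 < C₀) (hδ : 0 < δ) (hΩ : Measurable Ω)
    (hhom : ∀ r : ℝ, 0 < r → ∀ z : E, z ≠ 0 → Ω (r • z) = Ω z)
    (hint : Integrable (fun θ : sphere (0 : E) 1 => Ω θ) (volume : Measure E).toSphere)
    (x : E) {ε : ℝ} (hε : 0 < ε) {f g : E → ℂ} (hf : Continuous f) (hfc : HasCompactSupport f)
    (hg : Continuous g) (hgc : HasCompactSupport g) :
    truncatedIntegral Ω K (fun z => f z + g z) ε x =
      truncatedIntegral Ω K f ε x + truncatedIntegral Ω K g ε x := by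
  simp only [truncatedIntegral, mul_add]
  exact integral_add (hK.integrableOn_truncated hC₀ hδ hΩ hhom hint x hε hf hfc)
    (hK.integrableOn_truncated hC₀ hδ hΩ hhom hint x hε hg hgc)

end Truncations

section Chebyshev
variable {X : Type*} [MeasurableSpace X] {μ : Measure X} {F : X → ENNReal}

theorem meas_ofReal_le_le_of_lintegral (hF : AEMeasurable F μ) {a t : ℝ} (ht : 0 < t)
    (h : ∫⁻ x, F x ∂μ ≤ ENNReal.ofReal a) :
    μ {x | ENNReal.ofReal t ≤ F x} ≤ ENNReal.ofReal (a / t) := by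
  refine (meas_ge_le_lintegral_div hF (by simpa using ht) ENNReal.ofReal_ne_top).trans ?_
  rw [ENNReal.ofReal_div_of_pos ht]
  gcongr

theorem meas_ofReal_le_le_of_lintegral_sq (hF : AEMeasurable F μ) {a t : ℝ} (ht : 0 < t)
    (h : ∫⁻ x, F x ^ 2 ∂μ ≤ ENNReal.ofReal a) :
    μ {x | ENNReal.ofReal t ≤ F x} ≤ ENNReal.ofReal (a / t ^ 2) := by
  refine (measure_mono fun x hx => ?_).trans
    (meas_ofReal_le_le_of_lintegral (hF.pow_const 2) (by positivity : 0 < t ^ 2) h)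
  rw [Set.mem_ofPred_eq] at hx ⊢
  rw [ENNReal.ofReal_pow ht.le]
  gcongr

theorem eLpNorm_two_sq {f : X → ℂ} : eLpNorm f 2 μ ^ 2 = ∫⁻ x, ‖f x‖ₑ ^ 2 ∂μ := by
  have := eLpNorm_nnreal_pow_eq_lintegral (f := f) (μ := μ) (p := 2) two_ne_zero
  simpa using this

/-- An `L²` bound for a bounded integrable function. -/
theorem lintegral_enorm_sq_le {f : X → ℂ} (hf : Integrable f μ) {B F : ℝ} (hB0 : 0 ≤ B)
    (hB : ∀ x, ‖f x‖ ≤ B) (hF : ∫ x, ‖f x‖ ∂μ ≤ F) :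
    ∫⁻ x, ‖f x‖ₑ ^ 2 ∂μ ≤ ENNReal.ofReal (B * F) := by
  calc ∫⁻ x, ‖f x‖ₑ ^ 2 ∂μ ≤ ∫⁻ x, ENNReal.ofReal B * ‖f x‖ₑ ∂μ := by
        refine lintegral_mono fun x => ?_
        rw [sq, ← ofReal_norm (f x)]
        gcongr
        exact hB x
    _ = ENNReal.ofReal B * ENNReal.ofReal (∫ x, ‖f x‖ ∂μ) := by
        rw [lintegral_const_mul' _ _ ENNReal.ofReal_ne_top, ofReal_integral_norm_eq_lintegral_enorm hf]
    _ ≤ ENNReal.ofReal (B * F) := by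
        rw [ENNReal.ofReal_mul hB0]
        gcongr

end Chebyshev

section LogWeight
variable {E : Type*} [NormedAddCommGroup E] [MeasurableSpace E] {ν : Measure (sphere (0 : E) 1)}
  {Ω : E → ℝ}

theorem abs_mul_log_two_le (a : ℝ) : |a| * Real.log 2 ≤ |a| * Real.log (2 + |a|) :=
  mul_le_mul_of_nonneg_left (Real.log_le_log two_pos (by linarith [abs_nonneg a])) (abs_nonneg a)

variable [BorelSpace E]

theorem integrable_of_mul_log (hΩ : Measurable Ω)
    (h : Integrable (fun θ : sphere (0 : E) 1 => |Ω θ| * Real.log (2 + |Ω θ|)) ν) :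
    Integrable (fun θ : sphere (0 : E) 1 => Ω θ) ν := by
  have hl : 0 < Real.log 2 := Real.log_pos one_lt_two
  refine (h.const_mul (Real.log 2)⁻¹).mono' (hΩ.comp measurable_subtype_coe).aestronglyMeasurable
    (Eventually.of_forall fun θ => ?_)
  rw [Real.norm_eq_abs, le_inv_mul_iff₀ hl, mul_comm]
  exact abs_mul_log_two_le _

theorem integrable_logWeight_of_mul_log (hΩ : Measurable Ω)
    (h : Integrable (fun θ : sphere (0 : E) 1 => |Ω θ| * Real.log (2 + |Ω θ|)) ν) (ω : ℝ) :
    Integrable (fun θ : sphere (0 : E) 1 => logWeight ω Ω θ) ν := by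
  have hΩs : Measurable fun θ : sphere (0 : E) 1 => Ω θ := hΩ.comp measurable_subtype_coe
  refine ((h.add ((integrable_of_mul_log hΩ h).abs.const_mul (1 + |Real.log ω|)))).mono' ?_
    (Eventually.of_forall fun θ => ?_)
  · unfold logWeight
    have : Measurable fun θ : sphere (0 : E) 1 => |Ω θ| := hΩs.abs
    exact (this.mul (measurable_const.add
      ((Real.measurable_log.comp (this.div_const ω)).max measurable_const))).aestronglyMeasurable
  · have ha : 0 ≤ |Ω θ| := abs_nonneg _
    have h0 : 0 ≤ logWeight ω Ω θ :=
      mul_nonneg ha (add_nonneg zero_le_one (le_max_right _ _))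
    rw [Real.norm_of_nonneg h0]
    have hlog2 : 0 ≤ Real.log (2 + |Ω θ|) := Real.log_nonneg (by linarith)
    have hmax : max (Real.log (|Ω θ| / ω)) 0 ≤ Real.log (2 + |Ω θ|) + |Real.log ω| := by
      refine max_le ?_ (add_nonneg hlog2 (abs_nonneg _))
      by_cases hz : |Ω θ| = 0
      · rw [hz, zero_div, Real.log_zero]
        positivity
      by_cases hω : ω = 0
      · rw [hω, div_zero, Real.log_zero]
        positivity
      rw [Real.log_div hz hω]
      have := Real.log_le_log (lt_of_le_of_ne ha (Ne.symm hz)) (by linarith : |Ω θ| ≤ 2 + |Ω θ|)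
      linarith [neg_abs_le (Real.log ω)]
    simp only [logWeight, Pi.add_apply]
    nlinarith

theorem abs_le_logWeight (ω : ℝ) (z : E) : |Ω z| ≤ logWeight ω Ω z :=
  le_mul_of_one_le_right (abs_nonneg _) (le_add_of_nonneg_right (le_max_right _ _))

end LogWeight

section WeakType
variable {d : ℕ}

/-- Total volume of finitely many balls. -/
theorem volume_iUnion_closedBall_le {ι : Type} [Fintype ι] (y : ι → EuclideanSpace ℝ (Fin d))
    {c : ℝ} (hc : 0 ≤ c) (r : ι → ℝ) (hr : ∀ i, 0 ≤ r i) :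
    volume (⋃ i, closedBall (y i) (c * r i)) ≤ ENNReal.ofReal
      (c ^ d * volume.real (ball (0 : EuclideanSpace ℝ (Fin d)) 1) * ∑ i, r i ^ d) := by
  set B := volume.real (ball (0 : EuclideanSpace ℝ (Fin d)) 1)
  have hB : volume (ball (0 : EuclideanSpace ℝ (Fin d)) 1) = ENNReal.ofReal B :=
    (ofReal_measureReal measure_ball_lt_top.ne).symm
  refine (measure_iUnion_fintype_le _ _).trans (le_of_eq ?_)
  rw [Finset.mul_sum, ENNReal.ofReal_sum_of_nonneg fun i _ =>
    mul_nonneg (mul_nonneg (pow_nonneg hc _) measureReal_nonneg) (pow_nonneg (hr i) _)]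
  refine Finset.sum_congr rfl fun i _ => ?_
  rw [Measure.addHaar_closedBall _ _ (mul_nonneg hc (hr i)), hB, finrank_euclideanSpace_fin,
    ← ENNReal.ofReal_mul (pow_nonneg (mul_nonneg hc (hr i)) _)]
  congr 1
  ring

theorem setOf_lt_norm_subset {X : Type*} {Tf Tg Tb : X → ℂ} {F₁ F₂ : X → ENNReal} {N S : Set X}
    {lam : ℝ} (hlam : 0 < lam)
    (h : ∀ x, x ∉ N → Tf x = Tg x + Tb x ∧ (x ∉ S → ‖Tb x‖ₑ ≤ F₁ x + F₂ x)) :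
    {x | lam < ‖Tf x‖} ⊆ N ∪ {x | ENNReal.ofReal (lam / 2) ≤ ‖Tg x‖ₑ} ∪ S ∪
      {x | ENNReal.ofReal (lam / 4) ≤ F₁ x} ∪ {x | ENNReal.ofReal (lam / 4) ≤ F₂ x} := by
  intro x hx
  simp only [Set.mem_union, Set.mem_ofPred_eq] at hx ⊢
  by_contra! hc
  obtain ⟨⟨⟨⟨hN, hg⟩, hS⟩, h1⟩, h2⟩ := hc
  obtain ⟨he, hb⟩ := h x hN
  have h3 : ENNReal.ofReal lam < ‖Tf x‖ₑ := by
    rw [← ofReal_norm]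
    exact (ENNReal.ofReal_lt_ofReal_iff (hlam.trans hx)).2 hx
  refine absurd h3 (not_lt.2 ?_)
  calc ‖Tf x‖ₑ ≤ ‖Tg x‖ₑ + ‖Tb x‖ₑ := by rw [he]; exact enorm_add_le _ _
    _ ≤ ENNReal.ofReal (lam / 2) + (ENNReal.ofReal (lam / 4) + ENNReal.ofReal (lam / 4)) :=
        add_le_add hg.le ((hb hS).trans (add_le_add h1.le h2.le))
    _ = ENNReal.ofReal lam := by
        rw [← ENNReal.ofReal_add (by positivity) (by positivity),
          ← ENNReal.ofReal_add (by positivity) (by positivity)]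
        congr 1
        ring

theorem exists_weak_type_bound (hd : 2 ≤ d) {C₀ δ A : ℝ} (hC₀ : 0 < C₀) (hδ : 0 < δ) (hδ1 : δ ≤ 1)
    (hA : 0 < A) :
    ∃ C : ℝ, 0 < C ∧
      ∀ (K : EuclideanSpace ℝ (Fin d) → EuclideanSpace ℝ (Fin d) → ℂ)
        (Ω : EuclideanSpace ℝ (Fin d) → ℝ)
        (T : (EuclideanSpace ℝ (Fin d) → ℂ) → EuclideanSpace ℝ (Fin d) → ℂ) (M ω W : ℝ),
        IsStandardKernel C₀ δ K → Measurable Ω →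
        (∀ r : ℝ, 0 < r → ∀ x : EuclideanSpace ℝ (Fin d), x ≠ 0 → Ω (r • x) = Ω x) →
        Integrable (fun θ : sphere (0 : EuclideanSpace ℝ (Fin d)) 1 => Ω θ)
          (volume : Measure (EuclideanSpace ℝ (Fin d))).toSphere →
        (∫ θ : sphere (0 : EuclideanSpace ℝ (Fin d)) 1, |Ω θ|
          ∂(volume : Measure (EuclideanSpace ℝ (Fin d))).toSphere) ≤ ω → 0 < ω →
        Integrable (fun θ : sphere (0 : EuclideanSpace ℝ (Fin d)) 1 => logWeight ω Ω θ)
          (volume : Measure (EuclideanSpace ℝ (Fin d))).toSphere →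
        (∫ θ : sphere (0 : EuclideanSpace ℝ (Fin d)) 1, logWeight ω Ω θ
          ∂(volume : Measure (EuclideanSpace ℝ (Fin d))).toSphere) ≤ W → ω ≤ W → 0 ≤ M → M ≤ W →
        (∀ f : EuclideanSpace ℝ (Fin d) → ℂ, ContDiff ℝ (⊤ : ℕ∞) f → HasCompactSupport f →
          ∀ᵐ x, Tendsto (fun ε => truncatedIntegral Ω K f ε x) (𝓝[>] 0) (𝓝 (T f x))) →
        (∀ f : EuclideanSpace ℝ (Fin d) → ℂ, ContDiff ℝ (⊤ : ℕ∞) f → HasCompactSupport f →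
          eLpNorm (T f) 2 volume ≤ ENNReal.ofReal (A * M) * eLpNorm f 2 volume) →
        ∀ lam : ℝ, 0 < lam →
          ∀ f : EuclideanSpace ℝ (Fin d) → ℂ, ContDiff ℝ (⊤ : ℕ∞) f → HasCompactSupport f →
            volume {x | lam < ‖T f x‖} ≤ ENNReal.ofReal (C * (W * (∫ x, ‖f x‖) / lam)) := by
  have : Nonempty (Fin d) := ⟨⟨0, by omega⟩⟩
  have : Nontrivial (EuclideanSpace ℝ (Fin d)) := by
    rw [← Module.finrank_pos_iff (R := ℝ), finrank_euclideanSpace_fin]; omega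
  obtain ⟨Cz, hCz, hdec⟩ := exists_calderonZygmund_decomposition (d := d) (by omega)
  obtain ⟨Cr, hCr, hring⟩ :=
    IsAtomFamily.exists_ringOp_bound (EuclideanSpace ℝ (Fin d)) hC₀ hδ hδ1
  obtain ⟨Λ, hΛ⟩ : ∃ Λ : ℝ, Λ = 3 * ringRatio (EuclideanSpace ℝ (Fin d)) := ⟨_, rfl⟩
  have hΛ0 : 0 ≤ Λ := hΛ ▸ mul_nonneg zero_le_three (Nat.cast_nonneg _)
  set B := volume.real (ball (0 : EuclideanSpace ℝ (Fin d)) 1) with hB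
  have hB0 : 0 ≤ B := measureReal_nonneg
  refine ⟨4 * A ^ 2 * Cz + Λ ^ d * B * Cz + 8 * Cr + 32 * Cr * Cz, by positivity, ?_⟩
  intro K Ω T M ω W hK hΩ hhom hint hω hω0 hlogi hlog hωW hM0 hMW hPV hL2 lam hlam f hf hfc
  have hW0 : 0 < W := hω0.trans_le hωW
  set F := ∫ x, ‖f x‖ with hF
  have hF0 : 0 ≤ F := integral_nonneg fun x => norm_nonneg _
  set α := lam / W with hα
  have hα0 : 0 < α := div_pos hlam hW0
  obtain ⟨ι, hι, y, q, b, g, hb, hg, hgc, hfg, hgB, hgF, hbF, hvol⟩ := hdec f hf hfc α hα0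
  obtain ⟨F₁, F₂, hF₁, hF₂, hle, hF₁i, hF₂i⟩ :=
    hring ι (Cz * α) y q b hb (by positivity) K Ω ω hK hΩ hhom hint hω hω0 hlogi
  set β : EuclideanSpace ℝ (Fin d) → ℂ := fun x => ∑ i, b i x with hβ
  have hβd : ContDiff ℝ (⊤ : ℕ∞) β := ContDiff.sum fun i _ => hb.contDiff i
  have hβeq : β = fun x => f x - g x := by
    ext x; rw [hfg x, hβ]; ring
  have hβc : HasCompactSupport β := by
    rw [hβeq]; exact hfc.sub hgc
  have hfun : f = fun z => g z + β z := funext hfg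
  obtain ⟨G, hG⟩ : ∃ G : Set (EuclideanSpace ℝ (Fin d)), G = {x | T f x = T g x + T β x ∧
      (x ∉ (⋃ i, closedBall (y i) (Λ * 2 ^ q i)) → ‖T β x‖ₑ ≤ F₁ x + F₂ x)} := ⟨_, rfl⟩
  have hGae : volume Gᶜ = 0 := by
    rw [← mem_ae_iff]
    filter_upwards [hPV f hf hfc, hPV g hg hgc, hPV β hβd hβc] with x h1 h2 h3
    rw [hG, Set.mem_ofPred_eq]
    constructor
    · refine tendsto_nhds_unique h1 ((h2.add h3).congr' ?_)
      filter_upwards [self_mem_nhdsWithin] with ε hε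
      rw [← hK.truncatedIntegral_add hC₀ hδ hΩ hhom hint x hε hg.continuous hgc
        hβd.continuous hβc, ← hfun]
    · intro hx
      rw [Set.mem_iUnion, not_exists] at hx
      obtain ⟨N, hN⟩ := hb.exists_truncated_eq_sum_ringOp hK hC₀ hδ hΩ hhom hint (hΛ ▸ hx)
      have h4 := tendsto_nhds_unique h3 (tendsto_const_nhds.congr' (hN.mono fun ε h => h.symm))
      rw [h4]
      exact hle N x
  have hmeas : AEMeasurable (fun x => ‖T g x‖ₑ) volume :=
    (hK.aestronglyMeasurable_of_tendsto hδ hΩ hg.continuous (hPV g hg hgc)).enorm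
  set V := W * F / lam with hV
  have hV0 : 0 ≤ V := by positivity
  have hFα : F / α = V := by rw [hα, hV]; field_simp
  have e1 : volume {x | ENNReal.ofReal (lam / 2) ≤ ‖T g x‖ₑ} ≤
      ENNReal.ofReal (4 * A ^ 2 * Cz * V) := by
    have h1 : ∫⁻ x, ‖T g x‖ₑ ^ 2 ≤ ENNReal.ofReal ((A * M) ^ 2 * (Cz * α * F)) := by
      rw [← eLpNorm_two_sq, ENNReal.ofReal_mul (by positivity), ENNReal.ofReal_pow (by positivity)]
      calc eLpNorm (T g) 2 volume ^ 2
          ≤ (ENNReal.ofReal (A * M) * eLpNorm g 2 volume) ^ 2 := by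
            gcongr
            exact hL2 g hg hgc
        _ ≤ _ := by
            rw [mul_pow, eLpNorm_two_sq]
            gcongr
            exact lintegral_enorm_sq_le (hg.continuous.integrable_of_hasCompactSupport hgc)
              (by positivity) hgB hgF
    refine (meas_ofReal_le_le_of_lintegral_sq hmeas (by positivity) h1).trans
      (ENNReal.ofReal_le_ofReal ?_)
    calc (A * M) ^ 2 * (Cz * α * F) / (lam / 2) ^ 2
        ≤ (A * W) ^ 2 * (Cz * α * F) / (lam / 2) ^ 2 := by gcongr
      _ = 4 * A ^ 2 * Cz * V := by rw [hα, hV]; field_simp; norm_num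
  have e2 : volume (⋃ i, closedBall (y i) (Λ * 2 ^ q i)) ≤
      ENNReal.ofReal (Λ ^ d * B * Cz * V) := by
    refine (volume_iUnion_closedBall_le y hΛ0 (fun i => (2 : ℝ) ^ q i)
      fun i => by positivity).trans (ENNReal.ofReal_le_ofReal ?_)
    have h1 : ∑ i, ((2 : ℝ) ^ q i) ^ d ≤ Cz * V := by
      rw [← hFα, ← mul_div_assoc, le_div_iff₀' hα0]
      exact hvol
    calc Λ ^ d * B * ∑ i, ((2 : ℝ) ^ q i) ^ d ≤ Λ ^ d * B * (Cz * V) :=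
          mul_le_mul_of_nonneg_left h1 (by positivity)
      _ = Λ ^ d * B * Cz * V := by ring
  have hsum0 : 0 ≤ ∑ i, ∫ x, ‖b i x‖ :=
    Finset.sum_nonneg fun i _ => integral_nonneg fun x => norm_nonneg _
  have e3 : volume {x | ENNReal.ofReal (lam / 4) ≤ F₁ x} ≤ ENNReal.ofReal (8 * Cr * V) := by
    refine (meas_ofReal_le_le_of_lintegral hF₁.aemeasurable (by positivity) hF₁i).trans
      (ENNReal.ofReal_le_ofReal ?_)
    calc _ ≤ Cr * W * (2 * F) / (lam / 4) := by gcongr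
      _ = 8 * Cr * V := by rw [hV]; field_simp; ring
  have e4 : volume {x | ENNReal.ofReal (lam / 4) ≤ F₂ x} ≤ ENNReal.ofReal (32 * Cr * Cz * V) := by
    refine (meas_ofReal_le_le_of_lintegral_sq hF₂.aemeasurable (by positivity) hF₂i).trans
      (ENNReal.ofReal_le_ofReal ?_)
    calc _ ≤ Cr * W ^ 2 * (Cz * α) * (2 * F) / (lam / 4) ^ 2 := by gcongr
      _ = 32 * Cr * Cz * V := by rw [hα, hV]; field_simp; ring
  have hsub := setOf_lt_norm_subset (N := Gᶜ) (S := ⋃ i, closedBall (y i) (Λ * 2 ^ q i))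
    (Tf := T f) (Tg := T g) (Tb := T β) (F₁ := F₁) (F₂ := F₂) hlam fun x hx => by
      rwa [Set.notMem_compl_iff, hG] at hx
  refine (measure_mono hsub).trans ?_
  refine (measure_union_le _ _).trans ?_
  rw [add_mul, add_mul, add_mul, ENNReal.ofReal_add (by positivity) (by positivity),
    ENNReal.ofReal_add (by positivity) (by positivity),
    ENNReal.ofReal_add (by positivity) (by positivity)]
  refine add_le_add ((measure_union_le _ _).trans (add_le_add ((measure_union_le _ _).trans
    (add_le_add ((measure_union_le _ _).trans ?_) e2)) e3)) e4
  rw [hGae, zero_add]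
  exact e1

end WeakType

theorem weak11_criterion
    (d : ℕ) (hd : 2 ≤ d) (δ : ℝ) (hδ0 : 0 < δ) (hδ1 : δ ≤ 1)
    (C₀ A : ℝ) (hC₀ : 0 < C₀) (hA : 0 < A) :
    ∃ C : ℝ, 0 < C ∧
      ∀ (K : EuclideanSpace ℝ (Fin d) → EuclideanSpace ℝ (Fin d) → ℂ)
        (Ω : EuclideanSpace ℝ (Fin d) → ℝ)
        (T : (EuclideanSpace ℝ (Fin d) → ℂ) → EuclideanSpace ℝ (Fin d) → ℂ),
        -- size condition (1.8)
        (∀ x y, x ≠ y → ‖K x y‖ ≤ C₀ / ‖x - y‖ ^ d) →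
        -- regularity conditions (1.9)
        (∀ x₁ x₂ y, ‖x₁ - y‖ > 2 * ‖x₁ - x₂‖ →
          ‖K x₁ y - K x₂ y‖ ≤ C₀ * ‖x₁ - x₂‖ ^ δ / ‖x₁ - y‖ ^ ((d : ℝ) + δ)) →
        (∀ x y₁ y₂, ‖x - y₁‖ > 2 * ‖y₁ - y₂‖ →
          ‖K x y₁ - K x y₂‖ ≤ C₀ * ‖y₁ - y₂‖ ^ δ / ‖x - y₁‖ ^ ((d : ℝ) + δ)) →
        -- Ω is measurable, homogeneous of degree zero, and in L log⁺ L(S^{d-1})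
        Measurable Ω →
        (∀ r : ℝ, 0 < r → ∀ x : EuclideanSpace ℝ (Fin d), x ≠ 0 → Ω (r • x) = Ω x) →
        Integrable (fun θ : sphere (0 : EuclideanSpace ℝ (Fin d)) 1 =>
          |Ω θ| * Real.log (2 + |Ω θ|)) (sphereMeasure d) →
        -- T f is the a.e. principal value of the singular integral, for f ∈ C_c^∞
        (∀ f : EuclideanSpace ℝ (Fin d) → ℂ, ContDiff ℝ (⊤ : ℕ∞) f → HasCompactSupport f →
          ∀ᵐ x : EuclideanSpace ℝ (Fin d) ∂volume,
            Tendsto (fun ε : ℝ =>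
                ∫ y in {y : EuclideanSpace ℝ (Fin d) | ε < ‖x - y‖},
                  (Ω (x - y) : ℂ) * K x y * f y)
              (𝓝[>] 0) (𝓝 (T f x))) →
        -- T is bounded on L² with bound A ‖Ω‖_{L log⁺ L}
        (∀ f : EuclideanSpace ℝ (Fin d) → ℂ, ContDiff ℝ (⊤ : ℕ∞) f → HasCompactSupport f →
          eLpNorm (T f) 2 volume ≤
            ENNReal.ofReal (A * sphLlogL d Ω) * eLpNorm f 2 volume) →
        -- weak type (1,1) bound
        ∀ lam : ℝ, 0 < lam →
          ∀ f : EuclideanSpace ℝ (Fin d) → ℂ, ContDiff ℝ (⊤ : ℕ∞) f → HasCompactSupport f →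
            ENNReal.ofReal lam *
                volume {x : EuclideanSpace ℝ (Fin d) | lam < ‖T f x‖} ≤
              ENNReal.ofReal (C * COmega d Ω) * eLpNorm f 1 volume := by
  obtain ⟨C, hC, hmain⟩ := exists_weak_type_bound hd hC₀ hδ0 hδ1 hA
  refine ⟨C, hC, fun K Ω T hsize hleft hright hΩ hhom hΩlog hPV hL2 lam hlam f hf hfc => ?_⟩
  have hK : IsStandardKernel C₀ δ K := by
    constructor <;> simpa only [finrank_euclideanSpace_fin]
  have hint : Integrable (fun θ : sphere (0 : EuclideanSpace ℝ (Fin d)) 1 => Ω θ)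
      (sphereMeasure d) := integrable_of_mul_log hΩ hΩlog
  have hlogi := integrable_logWeight_of_mul_log hΩ hΩlog (sphL1 d Ω)
  have hω0 : 0 ≤ sphL1 d Ω := integral_nonneg fun θ => abs_nonneg _
  have hM0 : 0 ≤ sphLlogL d Ω := integral_nonneg fun θ =>
    mul_nonneg (abs_nonneg _) (Real.log_nonneg (by linarith [abs_nonneg (Ω θ)]))
  have hωle : sphL1 d Ω ≤ ∫ θ : sphere (0 : EuclideanSpace ℝ (Fin d)) 1,
      logWeight (sphL1 d Ω) Ω θ ∂(sphereMeasure d) :=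
    integral_mono hint.abs hlogi fun θ => abs_le_logWeight _ _
  have hCΩ : COmega d Ω = sphLlogL d Ω + ∫ θ : sphere (0 : EuclideanSpace ℝ (Fin d)) 1,
      logWeight (sphL1 d Ω) Ω θ ∂(sphereMeasure d) := rfl
  rcases hω0.eq_or_lt with hω | hω
  · have hae : ∀ᵐ θ : sphere (0 : EuclideanSpace ℝ (Fin d)) 1 ∂(sphereMeasure d), |Ω θ| = 0 :=
      (integral_eq_zero_iff_of_nonneg (fun θ => abs_nonneg _) hint.abs).1 hω.symm
    have hM : sphLlogL d Ω = 0 := by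
      refine integral_eq_zero_of_ae ?_
      filter_upwards [hae] with θ hθ
      rw [hθ, zero_mul, Pi.zero_apply]
    have hTf := hL2 f hf hfc
    rw [hM, mul_zero, ENNReal.ofReal_zero, zero_mul, nonpos_iff_eq_zero, eLpNorm_eq_zero_iff
      (hK.aestronglyMeasurable_of_tendsto hδ0 hΩ hf.continuous (hPV f hf hfc)) two_ne_zero] at hTf
    have h0 : volume {x : EuclideanSpace ℝ (Fin d) | lam < ‖T f x‖} = 0 := by
      refine measure_mono_null ?_ (ae_iff.1 hTf)
      intro x hx hx0
      rw [Set.mem_ofPred_eq, hx0, Pi.zero_apply, norm_zero] at hx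
      exact hlam.not_gt hx
    rw [h0, mul_zero]
    exact zero_le
  · have h := hmain K Ω T (sphLlogL d Ω) (sphL1 d Ω) (COmega d Ω) hK hΩ hhom hint le_rfl hω hlogi
      (by rw [hCΩ]; exact le_add_of_nonneg_left hM0) (by linarith) hM0 (by linarith)
      hPV hL2 lam hlam f hf hfc
    have hW0 : 0 ≤ COmega d Ω := by linarith
    have hf1 : eLpNorm f 1 volume = ENNReal.ofReal (∫ x, ‖f x‖) := by
      rw [eLpNorm_one_eq_lintegral_enorm, ofReal_integral_norm_eq_lintegral_enorm
        (hf.continuous.integrable_of_hasCompactSupport hfc)]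
    calc ENNReal.ofReal lam * volume {x : EuclideanSpace ℝ (Fin d) | lam < ‖T f x‖}
        ≤ ENNReal.ofReal lam * ENNReal.ofReal (C * (COmega d Ω * (∫ x, ‖f x‖) / lam)) := by
          gcongr
      _ = ENNReal.ofReal (C * COmega d Ω) * eLpNorm f 1 volume := by
          rw [hf1, ← ENNReal.ofReal_mul hlam.le, ← ENNReal.ofReal_mul (by positivity)]
          congr 1
          field_simp

end
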